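/- For every ε > 0, 0 < α ≤ ζ ≤ 1 and D, K ≥ 1 there is a constant C = C(D) depending only on D such that the following holds for all sufficiently small δ > 0 (depending on D, K, ε). Let 𝓕 be a family of cinematic functions over a compact interval J with cinematic constant K and doubling constant D, let E ⊆ [0,1]² be a (δ,α;δ^{−ε})₁×(δ,α;δ^{−ε})₁ quasi-product, and let F ⊆ 𝓕 be a finite set satisfying the Frostman-type non-concentration condition #(F ∩ B) ≤ δ^{−ε}(r/δ)^ζ for every ball B ⊂ C²(J) of radius r ≥ δ. Then ∫_E (∑_{f∈F} 1_{f^δ})^{3/2} ≤ δ^{2−α/2−ζ/2−Cε} · #F, where f^δ = {(θ,y) ∈ J×ℝ : |f(θ)−y| ≤ δ}. -/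

import Mathlib

open Set MeasureTheory
open scoped ENNReal

/-- The `C²(J)` distance between two functions: the sup over `J` of
`|f-g| + |f'-g'| + |f''-g''|`. -/
noncomputable def c2dist (J : Set ℝ) (f g : ℝ → ℝ) : ℝ :=
  sSup ((fun θ => |f θ - g θ| + |deriv f θ - deriv g θ| +
      |deriv (deriv f) θ - deriv (deriv g) θ|) '' J)

/-- A family of cinematic functions over `J` with cinematic constant `K`:
a set of `C²` functions, of diameter at most `K` in `C²(J)`, such that for any
two members the pointwise quantity `|f-g| + |f'-g'| + |f''-g''|` is bounded
below by `K⁻¹ ‖f-g‖_{C²(J)}` everywhere on `J`. -/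
def CinematicFamily (J : Set ℝ) (K : ℝ) (𝓕 : Set (ℝ → ℝ)) : Prop :=
  (∀ f ∈ 𝓕, ContDiff ℝ 2 f) ∧
  (∀ f ∈ 𝓕, ∀ g ∈ 𝓕, c2dist J f g ≤ K) ∧
  (∀ f ∈ 𝓕, ∀ g ∈ 𝓕, ∀ θ ∈ J, K⁻¹ * c2dist J f g ≤
      |f θ - g θ| + |deriv f θ - deriv g θ| + |deriv (deriv f) θ - deriv (deriv g) θ|)

/-- `𝓕` is doubling (for the `C²(J)` metric) with doubling constant `D`:
every ball of radius `2r` in `𝓕` can be covered by at most `D` balls of radius `r`. -/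
def DoublingFamily (J : Set ℝ) (D : ℝ) (𝓕 : Set (ℝ → ℝ)) : Prop :=
  ∀ g ∈ 𝓕, ∀ r : ℝ, 0 < r → ∃ S : Finset (ℝ → ℝ), ↑S ⊆ 𝓕 ∧ (S.card : ℝ) ≤ D ∧
    ∀ f ∈ 𝓕, c2dist J f g ≤ 2 * r → ∃ h ∈ S, c2dist J f h ≤ r

/-- A `(δ,α;C)₁`-set: a union of intervals of length `δ` contained in `[0,1]`,
satisfying the Frostman-type non-concentration condition
`|A ∩ I| ≤ C δ^{1-α} |I|^α` for every interval `I ⊆ [0,1]`. -/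
def IsDeltaSet (δ α C : ℝ) (A : Set ℝ) : Prop :=
  A ⊆ Set.Icc 0 1 ∧
  (∃ T : Set ℝ, A = ⋃ x ∈ T, Set.Icc x (x + δ)) ∧
  ∀ u v : ℝ, u ≤ v → Set.Icc u v ⊆ Set.Icc (0:ℝ) 1 →
    volume (A ∩ Set.Icc u v) ≤ ENNReal.ofReal (C * δ ^ (1 - α) * (v - u) ^ α)

/-- A `(δ,α;C)₁ × (δ,β;C)₁` quasi-product: a Borel set of the form
`⋃_{a ∈ A} {a} × B_a` where `A` is a `(δ,α;C)₁`-set and each `B_a` is a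
`(δ,β;C)₁`-set. -/
def IsQuasiProduct (δ α β C : ℝ) (E : Set (ℝ × ℝ)) : Prop :=
  MeasurableSet E ∧
  ∃ (A : Set ℝ) (B : ℝ → Set ℝ), IsDeltaSet δ α C A ∧ (∀ a ∈ A, IsDeltaSet δ β C (B a)) ∧
    E = {p : ℝ × ℝ | p.1 ∈ A ∧ p.2 ∈ B p.1}

/-- `f^δ`, the vertical `δ`-neighborhood of the graph of `f` over `J`. -/
def vtube (J : Set ℝ) (f : ℝ → ℝ) (s : ℝ) : Set (ℝ × ℝ) :=
  {p : ℝ × ℝ | p.1 ∈ J ∧ |f p.1 - p.2| ≤ s}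

section PartA

/-- indicator of a finset as a real number -/
noncomputable def ind {β : Type*} [DecidableEq β] (S : Finset β) (a : β) : ℝ := if a ∈ S then 1 else 0

theorem ind_nonneg {β : Type*} [DecidableEq β] (S : Finset β) (a : β) : 0 ≤ ind S a := by
  unfold ind; split_ifs <;> norm_num

theorem gram0 {π β : Type*} (P : Finset π) (B : Finset β) (Z : π → β → β → ℝ) :
    ∑ p ∈ P, ∑ p' ∈ P, ∑ a ∈ B, ∑ b ∈ B, Z p a b * Z p' a b
      = ∑ a ∈ B, ∑ b ∈ B, (∑ p ∈ P, Z p a b) ^ 2 := by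
  have h1 : ∀ a b, (∑ p ∈ P, Z p a b) ^ 2 = ∑ p ∈ P, ∑ p' ∈ P, Z p a b * Z p' a b := by
    intro a b; rw [sq, Finset.sum_mul_sum]
  simp_rw [h1]
  rw [Finset.sum_congr rfl (fun p _ => Finset.sum_comm)]
  rw [Finset.sum_comm]
  refine Finset.sum_congr rfl (fun a _ => ?_)
  rw [Finset.sum_congr rfl (fun p _ => Finset.sum_comm)]
  rw [Finset.sum_comm]

theorem gram1 {π β : Type*} (P : Finset π) (B : Finset β) (x y : π → β → ℝ) :
    ∑ p ∈ P, ∑ p' ∈ P, (∑ a ∈ B, x p a * x p' a) * (∑ b ∈ B, y p b * y p' b)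
      = ∑ a ∈ B, ∑ b ∈ B, (∑ p ∈ P, x p a * y p b) ^ 2 := by
  rw [← gram0 P B (fun p a b => x p a * y p b)]
  refine Finset.sum_congr rfl (fun p _ => Finset.sum_congr rfl (fun p' _ => ?_))
  rw [Finset.sum_mul_sum]
  refine Finset.sum_congr rfl (fun a _ => Finset.sum_congr rfl (fun b _ => ?_))
  ring

theorem sum_ind_mul {β : Type*} [DecidableEq β] (B S S' : Finset β) (h : S ⊆ B) :
    ∑ a ∈ B, ind S a * ind S' a = ((S ∩ S').card : ℝ) := by
  have : ∀ a, ind S a * ind S' a = if a ∈ S ∩ S' then (1:ℝ) else 0 := by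
    intro a; unfold ind; simp only [Finset.mem_inter]; split_ifs <;> simp_all
  simp_rw [this]
  rw [← Finset.sum_filter, Finset.sum_const, nsmul_eq_mul, mul_one]
  congr 2
  ext a; simp only [Finset.mem_filter, Finset.mem_inter]
  constructor
  · exact fun h => h.2
  · exact fun h' => ⟨h h'.1, h'⟩

/-- sign of the order of `a`, `b` with respect to the rank `ρ` -/
noncomputable def sg {β : Type*} (ρ : β → ℕ) (a b : β) : ℝ :=
  if ρ a < ρ b then 1 else if ρ b < ρ a then -1 else 0

theorem sg_self {β : Type*} (ρ : β → ℕ) (a : β) : sg ρ a a = 0 := by simp [sg]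

theorem sg_abs_le {β : Type*} (ρ : β → ℕ) (a b : β) : |sg ρ a b| ≤ 1 := by
  unfold sg; split_ifs <;> norm_num

theorem sg_mul_le_one {β : Type*} (ρ ρ' : β → ℕ) (a b : β) : sg ρ a b * sg ρ' a b ≤ 1 := by
  unfold sg; split_ifs <;> norm_num

/-- the sign correlation of two ranks on a set is at most the cardinality if there is no common
increasing triple. -/
theorem sgn_corr_le {β : Type*} [DecidableEq β] (X : Finset β) (ρ ρ' : β → ℕ)
    (hρ : Set.InjOn ρ X) (hρ' : Set.InjOn ρ' X)
    (h123 : ∀ a ∈ X, ∀ b ∈ X, ∀ c ∈ X, ρ a < ρ b → ρ b < ρ c → ρ' a < ρ' b → ρ' b < ρ' c → False) :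
    ∑ a ∈ X, ∑ b ∈ X, sg ρ a b * sg ρ' a b ≤ X.card := by
  classical
  let e : β → ℝ := fun b => if ∃ a ∈ X, ρ a < ρ b ∧ ρ' a < ρ' b then 1 else -1
  have key : ∀ a ∈ X, ∀ b ∈ X, sg ρ a b * sg ρ' a b ≤ - (e a * e b) + if a = b then 1 else 0 := by
    intro a ha b hb
    by_cases hab : a = b
    · subst hab
      simp only [sg_self, if_true, e]
      split_ifs <;> norm_num
    · have h1 : ρ a ≠ ρ b := fun h => hab (hρ ha hb h)
      have h2 : ρ' a ≠ ρ' b := fun h => hab (hρ' ha hb h)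
      simp only [hab, if_false, add_zero]
      by_cases h : sg ρ a b * sg ρ' a b ≤ -1
      · refine h.trans ?_
        simp only [e]; split_ifs <;> norm_num
      · have h3 : (ρ a < ρ b ∧ ρ' a < ρ' b) ∨ (ρ b < ρ a ∧ ρ' b < ρ' a) := by
          rcases lt_or_gt_of_ne h1 with h1 | h1 <;> rcases lt_or_gt_of_ne h2 with h2 | h2
          · exact Or.inl ⟨h1, h2⟩
          · exfalso; apply h; simp [sg, h1, h2, h2.not_gt]
          · exfalso; apply h; simp [sg, h1, h2, h1.not_gt]
          · exact Or.inr ⟨h1, h2⟩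
        refine (sg_mul_le_one ρ ρ' a b).trans ?_
        rcases h3 with ⟨h3, h4⟩ | ⟨h3, h4⟩
        · have hb1 : e b = 1 := by
            simp only [e]; rw [if_pos ⟨a, ha, h3, h4⟩]
          have ha1 : e a = -1 := by
            simp only [e]; rw [if_neg]
            rintro ⟨c, hc, h5, h6⟩
            exact h123 c hc a ha b hb h5 h3 h6 h4
          rw [ha1, hb1]; norm_num
        · have hb1 : e a = 1 := by
            simp only [e]; rw [if_pos ⟨b, hb, h3, h4⟩]
          have ha1 : e b = -1 := by
            simp only [e]; rw [if_neg]
            rintro ⟨c, hc, h5, h6⟩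
            exact h123 c hc b hb a ha h5 h3 h6 h4
          rw [ha1, hb1]; norm_num
  calc ∑ a ∈ X, ∑ b ∈ X, sg ρ a b * sg ρ' a b
      ≤ ∑ a ∈ X, ∑ b ∈ X, (- (e a * e b) + if a = b then 1 else 0) :=
        Finset.sum_le_sum fun a ha => Finset.sum_le_sum fun b hb => key a ha b hb
    _ = - (∑ a ∈ X, e a) ^ 2 + X.card := by
        simp_rw [Finset.sum_add_distrib, Finset.sum_neg_distrib]
        rw [sq, Finset.sum_mul_sum]
        congr 1
        simp
    _ ≤ X.card := by nlinarith [sq_nonneg (∑ a ∈ X, e a)]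

theorem sgn_corr_pure {β : Type*} [DecidableEq β] (X : Finset β) (ρ ρ' : β → ℕ)
    (hρ : Set.InjOn ρ X) (hρ' : Set.InjOn ρ' X)
    (h12 : ∀ a ∈ X, ∀ b ∈ X, ρ a < ρ b → ρ' a < ρ' b → False) :
    ∑ a ∈ X, ∑ b ∈ X, sg ρ a b * sg ρ' a b = X.card - (X.card : ℝ) ^ 2 := by
  classical
  have key : ∀ a ∈ X, ∀ b ∈ X, sg ρ a b * sg ρ' a b = - 1 + if a = b then 1 else 0 := by
    intro a ha b hb
    by_cases hab : a = b
    · subst hab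
      simp [sg_self]
    · have h1 : ρ a ≠ ρ b := fun h => hab (hρ ha hb h)
      have h2 : ρ' a ≠ ρ' b := fun h => hab (hρ' ha hb h)
      simp only [hab, if_false, add_zero]
      rcases lt_or_gt_of_ne h1 with h1 | h1 <;> rcases lt_or_gt_of_ne h2 with h2 | h2
      · exact (h12 a ha b hb h1 h2).elim
      · simp [sg, h1, h2, h2.not_gt]
      · simp [sg, h1, h2, h1.not_gt]
      · exact (h12 b hb a ha h1 h2).elim
  rw [Finset.sum_congr rfl fun a ha => Finset.sum_congr rfl fun b hb => key a ha b hb]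
  simp_rw [Finset.sum_add_distrib]
  simp
  ring

theorem cs2 {π : Type*} (P : Finset π) (x y : π → π → ℝ) :
    (∑ p ∈ P, ∑ p' ∈ P, x p p' * y p p') ^ 2 ≤
      (∑ p ∈ P, ∑ p' ∈ P, (x p p') ^ 2) * ∑ p ∈ P, ∑ p' ∈ P, (y p p') ^ 2 := by
  have h := Finset.sum_mul_sq_le_sq_mul_sq (P ×ˢ P) (fun q => x q.1 q.2) (fun q => y q.1 q.2)
  rw [Finset.sum_product, Finset.sum_product, Finset.sum_product] at h
  exact h

set_option maxHeartbeats 800000 in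
theorem splitBound {π β : Type*} [DecidableEq π] [DecidableEq β] (P : Finset π) (B : Finset β)
    (Lf Rf : π → Finset β) (ρ : π → β → ℕ)
    (hLB : ∀ p ∈ P, Lf p ⊆ B)
    (hinj : ∀ p ∈ P, Set.InjOn (ρ p) (Lf p))
    (h123 : ∀ p ∈ P, ∀ p' ∈ P, p ≠ p' → ∀ a ∈ Lf p ∩ Lf p', ∀ b ∈ Lf p ∩ Lf p', ∀ c ∈ Lf p ∩ Lf p',
      ρ p a < ρ p b → ρ p b < ρ p c → ρ p' a < ρ p' b → ρ p' b < ρ p' c → False)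
    (h12 : ∀ p ∈ P, ∀ p' ∈ P, p ≠ p' → ∀ a ∈ Lf p ∩ Lf p', ∀ b ∈ Lf p ∩ Lf p', ∀ c ∈ Rf p ∩ Rf p',
      ρ p a < ρ p b → ρ p' a < ρ p' b → False) :
    (∑ p ∈ P, ∑ p' ∈ P, ((Lf p ∩ Lf p').card : ℝ) * ((Rf p ∩ Rf p').card : ℝ)) ^ 2
      ≤ (2 * ∑ p ∈ P, ((Lf p).card : ℝ) ^ 2 + ∑ p ∈ P, ∑ p' ∈ P, ((Lf p ∩ Lf p').card : ℝ)) *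
        ∑ p ∈ P, ∑ p' ∈ P, ((Rf p ∩ Rf p').card : ℝ) ^ 2 := by
  classical
  let S : π → π → ℝ := fun p p' =>
    ∑ a ∈ Lf p ∩ Lf p', ∑ b ∈ Lf p ∩ Lf p', sg (ρ p) a b * sg (ρ p') a b
  let w : π → π → ℝ := fun p p' =>
    if p = p' ∨ ∀ a ∈ Lf p ∩ Lf p', ∀ b ∈ Lf p ∩ Lf p', ρ p a < ρ p b → ρ p' a < ρ p' b → False
    then ((Lf p ∩ Lf p').card : ℝ) else 0
  have hS : 0 ≤ ∑ p ∈ P, ∑ p' ∈ P, S p p' := by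
    have h := gram0 P B (fun p a b => ind (Lf p) a * ind (Lf p) b * sg (ρ p) a b)
    have h' : ∀ p ∈ P, ∀ p' ∈ P, S p p' = ∑ a ∈ B, ∑ b ∈ B,
        (ind (Lf p) a * ind (Lf p) b * sg (ρ p) a b) *
        (ind (Lf p') a * ind (Lf p') b * sg (ρ p') a b) := by
      intro p hp p' hp'
      have hsub : Lf p ∩ Lf p' ⊆ B := Finset.inter_subset_left.trans (hLB p hp)
      simp only [S]
      rw [← Finset.sum_subset hsub]
      · refine Finset.sum_congr rfl fun a ha => ?_
        rw [← Finset.sum_subset hsub]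
        · refine Finset.sum_congr rfl fun b hb => ?_
          rw [Finset.mem_inter] at ha hb
          simp [ind, ha.1, ha.2, hb.1, hb.2]
        · intro b _ hb
          rw [Finset.mem_inter, not_and_or] at hb
          rcases hb with hb | hb <;> simp [ind, hb]
      · intro b _ hb
        rw [Finset.mem_inter, not_and_or] at hb
        rcases hb with hb | hb <;> simp [ind, hb]
    rw [Finset.sum_congr rfl fun p hp => Finset.sum_congr rfl fun p' hp' => h' p hp p' hp']
    rw [h]
    positivity
  have hw : ∀ p ∈ P, ∀ p' ∈ P, (w p p') ^ 2 ≤ ((Lf p ∩ Lf p').card : ℝ) - S p p' +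
      if p = p' then 2 * ((Lf p).card : ℝ) ^ 2 else 0 := by
    intro p hp p' hp'
    by_cases hpp : p = p'
    · subst hpp
      have hSle : S p p ≤ ((Lf p).card : ℝ) ^ 2 := by
        simp only [S, Finset.inter_self]
        calc _ ≤ ∑ a ∈ Lf p, ∑ b ∈ Lf p, (1:ℝ) :=
              Finset.sum_le_sum fun a _ => Finset.sum_le_sum fun b _ => sg_mul_le_one _ _ _ _
          _ = _ := by simp [sq]
      simp only [w, Finset.inter_self, true_or, if_true]
      have : (0:ℝ) ≤ (Lf p).card := by positivity
      nlinarith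
    · have i1 : Set.InjOn (ρ p) (Lf p ∩ Lf p' : Finset β) :=
        (hinj p hp).mono (by intro x hx; exact (Finset.mem_inter.1 hx).1)
      have i2 : Set.InjOn (ρ p') (Lf p ∩ Lf p' : Finset β) :=
        (hinj p' hp').mono (by intro x hx; exact (Finset.mem_inter.1 hx).2)
      simp only [hpp, if_false, add_zero, w, false_or]
      split_ifs with hpure
      · have := sgn_corr_pure _ _ _ i1 i2 hpure
        simp only [S]; rw [this]; linarith
      · have := sgn_corr_le _ _ _ i1 i2 (h123 p hp p' hp' hpp)
        simp only [S]; nlinarith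
  have hle : ∀ p ∈ P, ∀ p' ∈ P, ((Lf p ∩ Lf p').card : ℝ) * ((Rf p ∩ Rf p').card : ℝ)
      ≤ w p p' * ((Rf p ∩ Rf p').card : ℝ) := by
    intro p hp p' hp'
    by_cases hc : p = p' ∨ ∀ a ∈ Lf p ∩ Lf p', ∀ b ∈ Lf p ∩ Lf p', ρ p a < ρ p b → ρ p' a < ρ p' b → False
    · simp only [w]; rw [if_pos hc]
    · have hR : Rf p ∩ Rf p' = ∅ := by
        push Not at hc
        obtain ⟨hpp, a, ha, b, hb, h1, h2⟩ := hc
        rw [Finset.eq_empty_iff_forall_notMem]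
        intro c hc
        exact h12 p hp p' hp' hpp a ha b hb c hc h1 h2.1
      simp [hR]
  have hCS : (∑ p ∈ P, ∑ p' ∈ P, w p p' * ((Rf p ∩ Rf p').card : ℝ)) ^ 2 ≤
      (∑ p ∈ P, ∑ p' ∈ P, (w p p') ^ 2) * ∑ p ∈ P, ∑ p' ∈ P, ((Rf p ∩ Rf p').card : ℝ) ^ 2 := by
    exact cs2 P w (fun p p' => ((Rf p ∩ Rf p').card : ℝ))
  have hw2 : ∑ p ∈ P, ∑ p' ∈ P, (w p p') ^ 2 ≤
      2 * ∑ p ∈ P, ((Lf p).card : ℝ) ^ 2 + ∑ p ∈ P, ∑ p' ∈ P, ((Lf p ∩ Lf p').card : ℝ) := by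
    calc _ ≤ ∑ p ∈ P, ∑ p' ∈ P, (((Lf p ∩ Lf p').card : ℝ) - S p p' +
      if p = p' then 2 * ((Lf p).card : ℝ) ^ 2 else 0) :=
          Finset.sum_le_sum fun p hp => Finset.sum_le_sum fun p' hp' => hw p hp p' hp'
      _ = (∑ p ∈ P, ∑ p' ∈ P, ((Lf p ∩ Lf p').card : ℝ)) - ∑ p ∈ P, ∑ p' ∈ P, S p p' +
            2 * ∑ p ∈ P, ((Lf p).card : ℝ) ^ 2 := by
          simp_rw [Finset.sum_add_distrib, Finset.sum_sub_distrib]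
          congr 1
          rw [Finset.mul_sum]
          refine Finset.sum_congr rfl fun p hp => ?_
          simp [hp]
      _ ≤ _ := by linarith
  have hR0 : 0 ≤ ∑ p ∈ P, ∑ p' ∈ P, ((Rf p ∩ Rf p').card : ℝ) ^ 2 :=
    Finset.sum_nonneg fun p _ => Finset.sum_nonneg fun p' _ => sq_nonneg _
  have hL0 : 0 ≤ ∑ p ∈ P, ∑ p' ∈ P, ((Lf p ∩ Lf p').card : ℝ) * ((Rf p ∩ Rf p').card : ℝ) :=
    Finset.sum_nonneg fun p _ => Finset.sum_nonneg fun p' _ =>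
      mul_nonneg (Nat.cast_nonneg _) (Nat.cast_nonneg _)
  have hfin := hCS.trans (mul_le_mul_of_nonneg_right hw2 hR0)
  have hsum : ∑ p ∈ P, ∑ p' ∈ P, ((Lf p ∩ Lf p').card : ℝ) * ((Rf p ∩ Rf p').card : ℝ) ≤
      ∑ p ∈ P, ∑ p' ∈ P, w p p' * ((Rf p ∩ Rf p').card : ℝ) :=
    Finset.sum_le_sum fun p hp => Finset.sum_le_sum fun p' hp' => hle p hp p' hp'
  exact (pow_le_pow_left₀ hL0 hsum 2).trans hfin

end PartA

section PartA2

theorem fib_card {ω β : Type*} [DecidableEq β] (Z : Finset ω) (Y : ω → Finset β) (X : Finset β)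
    (hX : ∀ z ∈ Z, Y z ⊆ X)
    (hd : ∀ z ∈ Z, ∀ z' ∈ Z, z ≠ z' → ∀ a ∈ Y z, a ∈ Y z' → False) :
    ∑ z ∈ Z, ((Y z).card : ℝ) ≤ X.card := by
  classical
  rw [← Nat.cast_sum]
  rw [← Finset.card_biUnion]
  · exact_mod_cast Finset.card_le_card (Finset.biUnion_subset.2 hX)
  · intro z hz z' hz' hne
    refine Finset.disjoint_left.2 ?_
    exact fun a h1 h2 => hd z hz z' hz' hne a h1 h2

theorem fib_card_sq {ω β : Type*} [DecidableEq β] (Z : Finset ω) (Y : ω → Finset β) (X : Finset β)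
    (hX : ∀ z ∈ Z, Y z ⊆ X)
    (hd : ∀ z ∈ Z, ∀ z' ∈ Z, z ≠ z' → ∀ a ∈ Y z, a ∈ Y z' → False) :
    ∑ z ∈ Z, ((Y z).card : ℝ) ^ 2 ≤ (X.card : ℝ) ^ 2 := by
  refine (Finset.sum_sq_le_sq_sum_of_nonneg (fun z _ => Nat.cast_nonneg _)).trans ?_
  exact pow_le_pow_left₀ (Finset.sum_nonneg fun z _ => Nat.cast_nonneg _) (fib_card Z Y X hX hd) 2

theorem bit_split (L x y : ℕ) (hx : x < 2 ^ L) (hy : y < 2 ^ L) (h : x < y) :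
    ∃ k < L, ∃ q < 2 ^ L, x / 2 ^ k = 2 * q ∧ y / 2 ^ k = 2 * q + 1 := by
  classical
  have hex : ∃ k, x / 2 ^ k = y / 2 ^ k := ⟨L, by rw [Nat.div_eq_of_lt hx, Nat.div_eq_of_lt hy]⟩
  have hs := Nat.find_spec hex
  have hm := fun k => Nat.find_min hex (m := k)
  have hle : Nat.find hex ≤ L := Nat.find_min' hex (by rw [Nat.div_eq_of_lt hx, Nat.div_eq_of_lt hy])
  set n := Nat.find hex
  rcases n with _ | k
  · simp at hs; omega
  · have h1 := hm k (Nat.lt_succ_self k)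
    have h2 : x / 2 ^ k ≤ y / 2 ^ k := Nat.div_le_div_right h.le
    have h3 : x / 2 ^ k ≤ x := Nat.div_le_self _ _
    rw [pow_succ, ← Nat.div_div_eq_div_mul, ← Nat.div_div_eq_div_mul] at hs
    refine ⟨k, by omega, x / 2 ^ k / 2, by omega, by omega, by omega⟩

theorem list_alg (L m n S V U : ℝ) (hL : 1 ≤ L) (hm : 0 ≤ m) (hn : 0 ≤ n) (hS : 0 ≤ S) (hV : 0 ≤ V)
    (hVU : V ≤ U) (hU : ∀ Y, 0 ≤ Y → Y ^ 2 = (2 * S + V) * U → U ≤ V + 4 * L ^ 2 * Y)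
    (hV2 : V ^ 2 ≤ m ^ 2 * U) (hS2 : S ^ 2 ≤ n ^ 2 * U) :
    S ≤ 100 * L ^ 4 * (n ^ 2 + n * m) := by
  have hU0 : 0 ≤ U := hV.trans hVU
  have h0 : 0 ≤ (2 * S + V) * U := by positivity
  have h1 := hU (Real.sqrt ((2 * S + V) * U)) (Real.sqrt_nonneg _) (Real.sq_sqrt h0)
  set Y := Real.sqrt ((2 * S + V) * U)
  have hY0 : 0 ≤ Y := Real.sqrt_nonneg _
  have hYs : Y ^ 2 = (2 * S + V) * U := Real.sq_sqrt h0
  have hVY : V ≤ Y := by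
    apply abs_le_of_sq_le_sq' _ hY0 |>.2
    rw [hYs]; nlinarith
  have hL2 : 1 ≤ L ^ 2 := by nlinarith
  have h2 : U ≤ 5 * L ^ 2 * Y := by nlinarith
  have h3 : U ≤ 25 * L ^ 4 * (2 * S + V) := by
    rcases hU0.eq_or_lt with h | h
    · rw [← h]; positivity
    · have : U ^ 2 ≤ (5 * L ^ 2 * Y) ^ 2 := pow_le_pow_left₀ hU0 h2 2
      have h4 : (5 * L ^ 2 * Y) ^ 2 = 25 * L ^ 4 * (2 * S + V) * U := by rw [mul_pow, hYs]; ring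
      rw [h4, sq] at this
      exact le_of_mul_le_mul_right this h
  have hc : 0 ≤ 25 * L ^ 4 := by positivity
  set c := 25 * L ^ 4 with hcdef
  have hgoal : 100 * L ^ 4 * (n ^ 2 + n * m) = 4 * c * (n ^ 2 + n * m) := by rw [hcdef]; ring
  rw [hgoal]
  have hS3 : S ^ 2 ≤ n ^ 2 * (c * (2 * S + V)) := hS2.trans (by gcongr)
  have hV3 : V ^ 2 ≤ m ^ 2 * (c * (2 * S + V)) := hV2.trans (by gcongr)
  have hnm : 0 ≤ n * m := by positivity
  by_cases hVS : V ≤ 2 * S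
  · have : S * S ≤ (4 * c * n ^ 2) * S := by
      have : n ^ 2 * (c * (2 * S + V)) ≤ n ^ 2 * (c * (4 * S)) := by gcongr; linarith
      nlinarith
    rcases hS.eq_or_lt with h | h
    · rw [← h]; positivity
    · have := le_of_mul_le_mul_right this h
      have : 0 ≤ c * (n * m) := by positivity
      nlinarith
  · push Not at hVS
    have hVpos : 0 < V := by linarith
    have hV4 : V ≤ 2 * c * m ^ 2 := by
      have : V * V ≤ (2 * c * m ^ 2) * V := by
        have : m ^ 2 * (c * (2 * S + V)) ≤ m ^ 2 * (c * (2 * V)) := by gcongr; linarith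
        nlinarith
      exact le_of_mul_le_mul_right this hVpos
    have : S ^ 2 ≤ (2 * c * (n * m)) ^ 2 := by
      calc S ^ 2 ≤ n ^ 2 * (c * (2 * S + V)) := hS3
        _ ≤ n ^ 2 * (c * (2 * (2 * c * m ^ 2))) := by gcongr; linarith
        _ = _ := by ring
    have := (abs_le_of_sq_le_sq' this (by positivity)).2
    have h5 : 0 ≤ c * (n * m) := by positivity
    have h6 : 0 ≤ c * n ^ 2 := by positivity
    nlinarith

set_option maxHeartbeats 800000 in
theorem listBound {ι β : Type*} [DecidableEq ι] [DecidableEq β] (W : Finset ι) (B : Finset β)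
    (A : ι → Finset β) (r : ι → β → ℕ) (L : ℕ) (hL : 1 ≤ L)
    (hAB : ∀ i ∈ W, A i ⊆ B) (hinj : ∀ i ∈ W, Set.InjOn (r i) (A i))
    (hlt : ∀ i ∈ W, ∀ a ∈ A i, r i a < 2 ^ L)
    (h123 : ∀ i ∈ W, ∀ j ∈ W, i ≠ j → ∀ a ∈ A i ∩ A j, ∀ b ∈ A i ∩ A j, ∀ c ∈ A i ∩ A j,
      r i a < r i b → r i b < r i c → r j a < r j b → r j b < r j c → False) :
    (∑ i ∈ W, ((A i).card : ℝ)) ^ 2 ≤ 100 * (L : ℝ) ^ 4 * W.card * B.card * (W.card + B.card) := by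
  classical
  obtain ⟨Q, hQ⟩ : ∃ Q : Finset ℕ, Q = Finset.range (2 ^ L) := ⟨_, rfl⟩
  obtain ⟨Lf, hLf⟩ : ∃ Lf : ℕ → ι × ℕ → Finset β,
      ∀ k p, Lf k p = (A p.1).filter (fun a => r p.1 a / 2 ^ k = 2 * p.2) := ⟨_, fun _ _ => rfl⟩
  obtain ⟨Rf, hRf⟩ : ∃ Rf : ℕ → ι × ℕ → Finset β,
      ∀ k p, Rf k p = (A p.1).filter (fun a => r p.1 a / 2 ^ k = 2 * p.2 + 1) := ⟨_, fun _ _ => rfl⟩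
  have mL : ∀ k p a, a ∈ Lf k p ↔ a ∈ A p.1 ∧ r p.1 a / 2 ^ k = 2 * p.2 := by
    intro k p a; rw [hLf, Finset.mem_filter]
  have mR : ∀ k p a, a ∈ Rf k p ↔ a ∈ A p.1 ∧ r p.1 a / 2 ^ k = 2 * p.2 + 1 := by
    intro k p a; rw [hRf, Finset.mem_filter]
  obtain ⟨S, hS⟩ : ∃ S : ℝ, S = ∑ i ∈ W, ((A i).card : ℝ) ^ 2 := ⟨_, rfl⟩
  obtain ⟨V, hV⟩ : ∃ V : ℝ, V = ∑ i ∈ W, ∑ j ∈ W, ((A i ∩ A j).card : ℝ) := ⟨_, rfl⟩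
  obtain ⟨U, hU⟩ : ∃ U : ℝ, U = ∑ i ∈ W, ∑ j ∈ W, ((A i ∩ A j).card : ℝ) ^ 2 := ⟨_, rfl⟩
  obtain ⟨T, hT⟩ : ∃ T : ℕ → ℝ, ∀ k, T k = ∑ p ∈ W ×ˢ Q, ∑ p' ∈ W ×ˢ Q,
    ((Lf k p ∩ Lf k p').card : ℝ) * ((Rf k p ∩ Rf k p').card : ℝ) := ⟨_, fun _ => rfl⟩
  have hS0 : 0 ≤ S := by rw [hS]; exact Finset.sum_nonneg fun i _ => sq_nonneg _
  have hV0 : 0 ≤ V := by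
    rw [hV]; exact Finset.sum_nonneg fun i _ => Finset.sum_nonneg fun j _ => Nat.cast_nonneg _
  -- reorganising double sums over pairs
  have reorg : ∀ x : ι × ℕ → ι × ℕ → ℝ, ∑ p ∈ W ×ˢ Q, ∑ p' ∈ W ×ˢ Q, x p p' =
      ∑ i ∈ W, ∑ j ∈ W, ∑ z ∈ Q ×ˢ Q, x (i, z.1) (j, z.2) := by
    intro x
    rw [Finset.sum_product]
    refine Finset.sum_congr rfl fun i _ => ?_
    have : ∀ q, ∑ p' ∈ W ×ˢ Q, x (i, q) p' = ∑ j ∈ W, ∑ q' ∈ Q, x (i, q) (j, q') := by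
      intro q; rw [Finset.sum_product]
    simp_rw [this]
    rw [Finset.sum_comm]
    refine Finset.sum_congr rfl fun j _ => ?_
    rw [Finset.sum_product]
  have hTk : ∀ k, T k ^ 2 ≤ (2 * S + V) * U := by
    intro k
    have h := splitBound (W ×ˢ Q) B (Lf k) (Rf k) (fun p => r p.1) ?_ ?_ ?_ ?_
    · rw [← hT] at h
      refine h.trans ?_
      have e1 : ∑ p ∈ W ×ˢ Q, ((Lf k p).card : ℝ) ^ 2 ≤ S := by
        rw [hS, Finset.sum_product]
        refine Finset.sum_le_sum fun i _ => ?_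
        refine fib_card_sq Q (fun q => Lf k (i, q)) (A i) ?_ ?_
        · intro q _ a ha; exact ((mL _ _ _).1 ha).1
        · intro q _ q' _ hne a h1 h2
          have h1 := ((mL _ _ _).1 h1).2
          have h2 := ((mL _ _ _).1 h2).2
          simp only at h1 h2
          omega
      have e2 : ∑ p ∈ W ×ˢ Q, ∑ p' ∈ W ×ˢ Q, ((Lf k p ∩ Lf k p').card : ℝ) ≤ V := by
        rw [hV, reorg]
        refine Finset.sum_le_sum fun i _ => Finset.sum_le_sum fun j _ => ?_
        refine fib_card (Q ×ˢ Q) (fun z => Lf k (i, z.1) ∩ Lf k (j, z.2)) (A i ∩ A j) ?_ ?_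
        · intro q _ a ha
          rw [Finset.mem_inter] at ha ⊢
          exact ⟨((mL _ _ _).1 ha.1).1, ((mL _ _ _).1 ha.2).1⟩
        · intro q _ q' _ hne a h1 h2
          rw [Finset.mem_inter, mL, mL] at h1 h2
          simp only at h1 h2
          exact hne (Prod.ext (by omega) (by omega))
      have e3 : ∑ p ∈ W ×ˢ Q, ∑ p' ∈ W ×ˢ Q, ((Rf k p ∩ Rf k p').card : ℝ) ^ 2 ≤ U := by
        rw [hU, reorg]
        refine Finset.sum_le_sum fun i _ => Finset.sum_le_sum fun j _ => ?_
        refine fib_card_sq (Q ×ˢ Q) (fun z => Rf k (i, z.1) ∩ Rf k (j, z.2)) (A i ∩ A j) ?_ ?_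
        · intro q _ a ha
          rw [Finset.mem_inter] at ha ⊢
          exact ⟨((mR _ _ _).1 ha.1).1, ((mR _ _ _).1 ha.2).1⟩
        · intro q _ q' _ hne a h1 h2
          rw [Finset.mem_inter, mR, mR] at h1 h2
          simp only at h1 h2
          exact hne (Prod.ext (by omega) (by omega))
      have e4 : 0 ≤ ∑ p ∈ W ×ˢ Q, ∑ p' ∈ W ×ˢ Q, ((Rf k p ∩ Rf k p').card : ℝ) ^ 2 :=
        Finset.sum_nonneg fun p _ => Finset.sum_nonneg fun p' _ => sq_nonneg _
      have e5 : 2 * ∑ p ∈ W ×ˢ Q, ((Lf k p).card : ℝ) ^ 2 +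
          ∑ p ∈ W ×ˢ Q, ∑ p' ∈ W ×ˢ Q, ((Lf k p ∩ Lf k p').card : ℝ) ≤ 2 * S + V := by linarith
      exact mul_le_mul e5 e3 e4 (by linarith)
    · intro p hp a ha
      exact hAB p.1 (Finset.mem_product.1 hp).1 ((mL _ _ _).1 ha).1
    · intro p hp
      exact (hinj p.1 (Finset.mem_product.1 hp).1).mono fun a ha => ((mL _ _ _).1 ha).1
    · intro p hp p' hp' hne a ha b hb c hc
      rw [Finset.mem_inter, mL, mL] at ha hb hc
      by_cases hpp : p.1 = p'.1
      · exfalso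
        rw [← hpp] at ha
        exact hne (Prod.ext hpp (by omega))
      · intro h1 h2 h3 h4
        exact h123 p.1 (Finset.mem_product.1 hp).1 p'.1 (Finset.mem_product.1 hp').1 hpp a
          (Finset.mem_inter.2 ⟨ha.1.1, ha.2.1⟩) b (Finset.mem_inter.2 ⟨hb.1.1, hb.2.1⟩) c
          (Finset.mem_inter.2 ⟨hc.1.1, hc.2.1⟩) h1 h2 h3 h4
    · intro p hp p' hp' hne a ha b hb c hc
      rw [Finset.mem_inter, mL, mL] at ha hb
      rw [Finset.mem_inter, mR, mR] at hc
      by_cases hpp : p.1 = p'.1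
      · exfalso
        rw [← hpp] at ha
        exact hne (Prod.ext hpp (by omega))
      · intro h1 h3
        have h2 : r p.1 b < r p.1 c := by
          by_contra hcon
          have := Nat.div_le_div_right (c := 2 ^ k) (not_lt.1 hcon)
          omega
        have h4 : r p'.1 b < r p'.1 c := by
          by_contra hcon
          have := Nat.div_le_div_right (c := 2 ^ k) (not_lt.1 hcon)
          omega
        exact h123 p.1 (Finset.mem_product.1 hp).1 p'.1 (Finset.mem_product.1 hp').1 hpp a
          (Finset.mem_inter.2 ⟨ha.1.1, ha.2.1⟩) b (Finset.mem_inter.2 ⟨hb.1.1, hb.2.1⟩) c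
          (Finset.mem_inter.2 ⟨hc.1.1, hc.2.1⟩) h1 h2 h3 h4
  -- gram expressions
  obtain ⟨κ, hκ⟩ : ∃ κ : β → β → ℝ, ∀ a b, κ a b = ∑ i ∈ W, ind (A i) a * ind (A i) b :=
    ⟨_, fun _ _ => rfl⟩
  obtain ⟨ν, hν⟩ : ∃ ν : ℕ → β → β → ℝ, ∀ k a b,
    ν k a b = ∑ p ∈ W ×ˢ Q, ind (Lf k p) a * ind (Rf k p) b := ⟨_, fun _ _ _ => rfl⟩
  have hν0 : ∀ k a b, 0 ≤ ν k a b := by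
    intro k a b; rw [hν]
    exact Finset.sum_nonneg fun p _ => mul_nonneg (ind_nonneg _ _) (ind_nonneg _ _)
  have gU : U = ∑ a ∈ B, ∑ b ∈ B, κ a b ^ 2 := by
    simp_rw [hκ]
    rw [← gram1, hU]
    refine Finset.sum_congr rfl fun i hi => Finset.sum_congr rfl fun j hj => ?_
    rw [sum_ind_mul B (A i) (A j) (hAB i hi), sq]
  have gT : ∀ k, T k = ∑ a ∈ B, ∑ b ∈ B, ν k a b ^ 2 := by
    intro k
    simp_rw [hν]
    rw [← gram1, hT]
    refine Finset.sum_congr rfl fun p hp => Finset.sum_congr rfl fun p' hp' => ?_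
    have hpW := hAB p.1 (Finset.mem_product.1 hp).1
    rw [sum_ind_mul B _ _ (fun a ha => hpW ((mL _ _ _).1 ha).1),
      sum_ind_mul B _ _ (fun a ha => hpW ((mR _ _ _).1 ha).1)]
  have gV : V = ∑ a ∈ B, κ a a ^ 2 := by
    have h1 : ∀ a, κ a a = ∑ i ∈ W, ind (A i) a := by
      intro a; rw [hκ]
      refine Finset.sum_congr rfl fun i _ => ?_
      unfold ind; split_ifs <;> norm_num
    simp_rw [h1, sq, Finset.sum_mul_sum]
    rw [Finset.sum_comm, hV]
    refine Finset.sum_congr rfl fun i hi => ?_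
    rw [Finset.sum_comm]
    refine Finset.sum_congr rfl fun j _ => ?_
    rw [sum_ind_mul B (A i) (A j) (hAB i hi)]
  have gS : S = ∑ a ∈ B, ∑ b ∈ B, κ a b := by
    simp_rw [hκ]
    rw [Finset.sum_congr rfl (fun a _ => Finset.sum_comm), Finset.sum_comm, hS]
    refine Finset.sum_congr rfl fun i hi => ?_
    rw [← Finset.sum_mul_sum]
    have h1 : ∑ a ∈ B, ind (A i) a = (A i).card := by
      have := sum_ind_mul B (A i) (A i) (hAB i hi)
      rw [Finset.inter_self] at this
      rw [← this]
      refine Finset.sum_congr rfl fun a _ => ?_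
      unfold ind; split_ifs <;> norm_num
    rw [h1, sq]
  have hpt : ∀ a b, a ≠ b → κ a b ≤ ∑ k ∈ Finset.range L, (ν k a b + ν k b a) := by
    intro a b hab
    have h1 : ∀ k, ν k a b + ν k b a = ∑ i ∈ W, ∑ q ∈ Q,
        (ind (Lf k (i, q)) a * ind (Rf k (i, q)) b + ind (Lf k (i, q)) b * ind (Rf k (i, q)) a) := by
      intro k; rw [hν, hν, ← Finset.sum_add_distrib, Finset.sum_product]
    simp_rw [h1]
    rw [Finset.sum_comm, hκ]
    refine Finset.sum_le_sum fun i hi => ?_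
    have hnn : ∀ k q, 0 ≤ ind (Lf k (i, q)) a * ind (Rf k (i, q)) b +
        ind (Lf k (i, q)) b * ind (Rf k (i, q)) a := fun k q =>
      add_nonneg (mul_nonneg (ind_nonneg _ _) (ind_nonneg _ _))
        (mul_nonneg (ind_nonneg _ _) (ind_nonneg _ _))
    by_cases hA : a ∈ A i ∧ b ∈ A i
    · have hl : ind (A i) a * ind (A i) b = 1 := by simp [ind, hA.1, hA.2]
      rw [hl]
      have hne : r i a ≠ r i b := fun h => hab (hinj i hi hA.1 hA.2 h)
      have : ∃ k < L, ∃ q < 2 ^ L, (r i a / 2 ^ k = 2 * q ∧ r i b / 2 ^ k = 2 * q + 1) ∨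
          (r i b / 2 ^ k = 2 * q ∧ r i a / 2 ^ k = 2 * q + 1) := by
        rcases lt_or_gt_of_ne hne with h | h
        · obtain ⟨k, hk, q, hq, h'⟩ := bit_split L _ _ (hlt i hi a hA.1) (hlt i hi b hA.2) h
          exact ⟨k, hk, q, hq, Or.inl h'⟩
        · obtain ⟨k, hk, q, hq, h'⟩ := bit_split L _ _ (hlt i hi b hA.2) (hlt i hi a hA.1) h
          exact ⟨k, hk, q, hq, Or.inr h'⟩
      obtain ⟨k, hk, q, hq, h⟩ := this
      have hqQ : q ∈ Q := by rw [hQ]; exact Finset.mem_range.2 hq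
      have s1 := Finset.single_le_sum (f := fun q => ind (Lf k (i, q)) a * ind (Rf k (i, q)) b +
        ind (Lf k (i, q)) b * ind (Rf k (i, q)) a) (fun q _ => hnn k q) hqQ
      have s2 := Finset.single_le_sum (f := fun k => ∑ q ∈ Q, (ind (Lf k (i, q)) a * ind (Rf k (i, q)) b +
        ind (Lf k (i, q)) b * ind (Rf k (i, q)) a)) (fun k _ => Finset.sum_nonneg fun q _ => hnn k q)
        (Finset.mem_range.2 hk)
      refine le_trans ?_ (s1.trans s2)
      rcases h with h | h
      · have h1 : a ∈ Lf k (i, q) := (mL _ _ _).2 ⟨hA.1, h.1⟩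
        have h2 : b ∈ Rf k (i, q) := (mR _ _ _).2 ⟨hA.2, h.2⟩
        have h3 : ind (Lf k (i, q)) a * ind (Rf k (i, q)) b = 1 := by simp [ind, h1, h2]
        simp only [h3]
        linarith [mul_nonneg (ind_nonneg (Lf k (i, q)) b) (ind_nonneg (Rf k (i, q)) a)]
      · have h1 : b ∈ Lf k (i, q) := (mL _ _ _).2 ⟨hA.2, h.1⟩
        have h2 : a ∈ Rf k (i, q) := (mR _ _ _).2 ⟨hA.1, h.2⟩
        have h3 : ind (Lf k (i, q)) b * ind (Rf k (i, q)) a = 1 := by simp [ind, h1, h2]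
        simp only [h3]
        linarith [mul_nonneg (ind_nonneg (Lf k (i, q)) a) (ind_nonneg (Rf k (i, q)) b)]
    · have hl : ind (A i) a * ind (A i) b = 0 := by
        rw [not_and_or] at hA
        rcases hA with h | h <;> simp [ind, h]
      rw [hl]
      exact Finset.sum_nonneg fun k _ => Finset.sum_nonneg fun q _ => hnn k q
  have hκ0 : ∀ a b, 0 ≤ κ a b := by
    intro a b; rw [hκ]
    exact Finset.sum_nonneg fun p _ => mul_nonneg (ind_nonneg _ _) (ind_nonneg _ _)
  have hpt2 : ∀ a b, κ a b ^ 2 ≤ (if a = b then κ a a ^ 2 else 0) +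
      2 * L * ∑ k ∈ Finset.range L, (ν k a b ^ 2 + ν k b a ^ 2) := by
    intro a b
    have hnn : 0 ≤ 2 * (L:ℝ) * ∑ k ∈ Finset.range L, (ν k a b ^ 2 + ν k b a ^ 2) := by positivity
    by_cases hab : a = b
    · subst hab; simp only [if_true]; linarith
    · simp only [hab, if_false, zero_add]
      have h1 := pow_le_pow_left₀ (hκ0 a b) (hpt a b hab) 2
      refine h1.trans ?_
      have h2 := sq_sum_le_card_mul_sum_sq (s := Finset.range L) (f := fun k => ν k a b + ν k b a)
      rw [Finset.card_range] at h2
      refine h2.trans ?_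
      have h3 : ∑ k ∈ Finset.range L, (ν k a b + ν k b a) ^ 2 ≤
          2 * ∑ k ∈ Finset.range L, (ν k a b ^ 2 + ν k b a ^ 2) := by
        rw [Finset.mul_sum]
        refine Finset.sum_le_sum fun k _ => ?_
        nlinarith [sq_nonneg (ν k a b - ν k b a)]
      have h4 : (L:ℝ) * ∑ k ∈ Finset.range L, (ν k a b + ν k b a) ^ 2 ≤
          L * (2 * ∑ k ∈ Finset.range L, (ν k a b ^ 2 + ν k b a ^ 2)) := by gcongr
      refine h4.trans (le_of_eq ?_)
      ring
  have hUT : U ≤ V + 4 * L * ∑ k ∈ Finset.range L, T k := by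
    rw [gU]
    calc ∑ a ∈ B, ∑ b ∈ B, κ a b ^ 2 ≤ ∑ a ∈ B, ∑ b ∈ B, ((if a = b then κ a a ^ 2 else 0) +
      2 * L * ∑ k ∈ Finset.range L, (ν k a b ^ 2 + ν k b a ^ 2)) :=
          Finset.sum_le_sum fun a _ => Finset.sum_le_sum fun b _ => hpt2 a b
      _ = V + 4 * L * ∑ k ∈ Finset.range L, T k := by
          simp_rw [Finset.sum_add_distrib]
          congr 1
          · rw [gV]
            refine Finset.sum_congr rfl fun a ha => ?_
            simp [ha]
          · have c1 : ∑ a ∈ B, ∑ b ∈ B, ∑ k ∈ Finset.range L, ν k a b ^ 2 =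
                ∑ k ∈ Finset.range L, T k := by
              simp_rw [gT]
              rw [Finset.sum_congr rfl (fun a _ => Finset.sum_comm), Finset.sum_comm]
            have c2 : ∑ a ∈ B, ∑ b ∈ B, ∑ k ∈ Finset.range L, ν k b a ^ 2 =
                ∑ k ∈ Finset.range L, T k := by
              rw [Finset.sum_comm, c1]
            simp_rw [mul_add, Finset.sum_add_distrib, ← Finset.mul_sum]
            rw [c1, c2]; ring
  have hfin : S ≤ 100 * (L:ℝ) ^ 4 * ((B.card:ℝ) ^ 2 + B.card * W.card) := by
    apply list_alg L W.card B.card S V U (by exact_mod_cast hL) (Nat.cast_nonneg _)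
      (Nat.cast_nonneg _) hS0 hV0
    · rw [hV, hU]
      refine Finset.sum_le_sum fun i _ => Finset.sum_le_sum fun j _ => ?_
      exact_mod_cast Nat.le_self_pow two_ne_zero _
    · intro Y hY0 hY
      refine hUT.trans ?_
      have : ∑ k ∈ Finset.range L, T k ≤ L * Y := by
        calc _ ≤ ∑ k ∈ Finset.range L, Y := Finset.sum_le_sum fun k _ => by
              have h := hTk k
              rw [← hY] at h
              exact (abs_le_of_sq_le_sq' h hY0).2
          _ = L * Y := by simp
      have h2 : 4 * (L:ℝ) * ∑ k ∈ Finset.range L, T k ≤ 4 * L * (L * Y) := by gcongr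
      nlinarith
    · have h := cs2 W (fun _ _ => (1:ℝ)) (fun i j => ((A i ∩ A j).card : ℝ))
      simp only [one_mul, one_pow, Finset.sum_const, nsmul_eq_mul, mul_one] at h
      rw [← hV, ← hU, ← sq] at h
      exact h
    · have h := cs2 B (fun _ _ => (1:ℝ)) κ
      simp only [one_mul, one_pow, Finset.sum_const, nsmul_eq_mul, mul_one] at h
      rw [← gS, ← gU, ← sq] at h
      exact h
  have h1 := sq_sum_le_card_mul_sum_sq (s := W) (f := fun i => ((A i).card : ℝ))
  rw [← hS] at h1
  calc _ ≤ (W.card:ℝ) * S := h1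
    _ ≤ W.card * (100 * (L:ℝ) ^ 4 * ((B.card:ℝ) ^ 2 + B.card * W.card)) := by gcongr
    _ = _ := by ring

end PartA2

section PartB

theorem two_mul_pow_le (m : ℕ) : 2 * m ^ (m + 1) ≤ (m + 1) ^ (m + 1) := by
  have h : m ^ (m + 1) + (m + 1) * m ^ m ≤ (m + 1) ^ (m + 1) := by
    rw [add_pow]
    rw [Finset.sum_range_succ, Finset.sum_range_succ]
    simp only [one_pow, mul_one, Nat.sub_self, pow_zero, Nat.choose_self, Nat.choose_succ_self_right]
    push_cast
    nlinarith [Nat.zero_le (∑ x ∈ Finset.range m, m ^ x * (m + 1).choose x)]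
  have : m ^ (m + 1) = m * m ^ m := by rw [pow_succ, mul_comm]
  nlinarith [Nat.zero_le (m ^ m)]

theorem card_avoid {γ : Type*} [Fintype γ] [DecidableEq γ] (n : ℕ) [NeZero n] (X : Finset γ)
    (hX : n ≤ X.card) :
    2 * (Finset.univ.filter (fun c : γ → Fin n => ∀ x ∈ X, c x ≠ 0)).card ≤ n ^ Fintype.card γ := by
  classical
  have h1 : (Finset.univ.filter (fun c : γ → Fin n => ∀ x ∈ X, c x ≠ 0)) =
      Fintype.piFinset (fun x => if x ∈ X then Finset.univ.erase (0 : Fin n) else Finset.univ) := by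
    ext c
    simp only [Finset.mem_filter, Finset.mem_univ, true_and, Fintype.mem_piFinset]
    refine forall_congr' fun x => ?_
    by_cases hx : x ∈ X <;> simp [hx]
  rw [h1, Fintype.card_piFinset]
  have h2 : ∀ x, (if x ∈ X then Finset.univ.erase (0 : Fin n) else Finset.univ).card =
      if x ∈ X then n - 1 else n := by
    intro x; split_ifs <;> simp
  simp_rw [h2]
  rw [Finset.prod_ite, Finset.prod_const, Finset.prod_const]
  have h3 : (Finset.univ.filter (fun x => x ∈ X)) = X := by ext; simp
  have h4 : (Finset.univ.filter (fun x => x ∉ X)) = Xᶜ := by ext; simp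
  rw [h3, h4, Finset.card_compl]
  have hXN : X.card ≤ Fintype.card γ := Finset.card_le_univ X
  obtain ⟨m, hm⟩ : ∃ m, n = m + 1 := ⟨n - 1, by have := NeZero.pos n; omega⟩
  have h5 : (n - 1) ^ X.card ≤ m ^ (m + 1) * n ^ (X.card - n) := by
    have : X.card = (m + 1) + (X.card - n) := by omega
    conv_lhs => rw [this, pow_add]
    rw [hm, Nat.add_sub_cancel]
    exact Nat.mul_le_mul_left _ (Nat.pow_le_pow_left (by omega) _)
  calc 2 * ((n - 1) ^ X.card * n ^ (Fintype.card γ - X.card))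
      ≤ 2 * (m ^ (m + 1) * n ^ (X.card - n) * n ^ (Fintype.card γ - X.card)) := by gcongr
    _ = (2 * m ^ (m + 1)) * (n ^ (X.card - n) * n ^ (Fintype.card γ - X.card)) := by ring
    _ ≤ n ^ n * (n ^ (X.card - n) * n ^ (Fintype.card γ - X.card)) := by
        gcongr
        rw [hm]
        exact two_mul_pow_le m
    _ = n ^ Fintype.card γ := by
        rw [← pow_add, ← pow_add]; congr 1; omega

theorem card_hit {γ : Type*} [Fintype γ] [DecidableEq γ] (n : ℕ) [NeZero n] (X : Finset γ)
    (hX : n ≤ X.card) :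
    (n:ℝ) ^ Fintype.card γ / 2 ≤
      (Finset.univ.filter (fun c : γ → Fin n => ∃ x ∈ X, c x = 0)).card := by
  classical
  have h := card_avoid n X hX
  have h2 := Finset.card_filter_add_card_filter_not (s := (Finset.univ : Finset (γ → Fin n)))
    (fun c => ∃ x ∈ X, c x = 0)
  have h3 : (Finset.univ.filter (fun c : γ → Fin n => ¬ ∃ x ∈ X, c x = 0)) =
      (Finset.univ.filter (fun c : γ → Fin n => ∀ x ∈ X, c x ≠ 0)) := by
    congr 1; ext c; push Not; rfl
  rw [h3] at h2
  simp only [Finset.card_univ, Fintype.card_fun, Fintype.card_fin] at h2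
  have h2' : ((Finset.univ.filter (fun c : γ → Fin n => ∃ x ∈ X, c x = 0)).card : ℝ) +
    (Finset.univ.filter (fun c : γ → Fin n => ∀ x ∈ X, c x ≠ 0)).card = (n:ℝ) ^ Fintype.card γ := by
    exact_mod_cast h2
  have h' : 2 * ((Finset.univ.filter (fun c : γ → Fin n => ∀ x ∈ X, c x ≠ 0)).card : ℝ)
    ≤ (n:ℝ) ^ Fintype.card γ := by exact_mod_cast h
  linarith

theorem sum_card_zero {γ : Type*} [Fintype γ] [DecidableEq γ] (n : ℕ) [NeZero n] :
    ∑ c : γ → Fin n, ((Finset.univ.filter (fun x => c x = 0)).card : ℝ) =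
      (n:ℝ) ^ Fintype.card γ * (Fintype.card γ / n) := by
  classical
  have hn : (n:ℝ) ≠ 0 := by exact_mod_cast NeZero.ne n
  have h1 : ∀ x : γ, ((Finset.univ.filter (fun c : γ → Fin n => c x = 0)).card : ℝ) =
      (n:ℝ) ^ Fintype.card γ / n := by
    intro x
    have : (Finset.univ.filter (fun c : γ → Fin n => c x = 0)) =
        Fintype.piFinset (fun y => if y = x then {(0 : Fin n)} else Finset.univ) := by
      ext c
      simp only [Finset.mem_filter, Finset.mem_univ, true_and, Fintype.mem_piFinset]
      constructor
      · intro h y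
        by_cases hy : y = x
        · subst hy; simp [h]
        · simp [hy]
      · intro h; simpa using h x
    rw [this, Fintype.card_piFinset]
    have h2 : ∀ y, (if y = x then {(0 : Fin n)} else Finset.univ).card = if y = x then 1 else n := by
      intro y; split_ifs <;> simp
    simp_rw [h2]
    rw [Finset.prod_ite, Finset.prod_const_one, one_mul, Finset.prod_const]
    have h4 : (Finset.univ.filter (fun y => ¬ y = x)) = {x}ᶜ := by ext; simp
    rw [h4, Finset.card_compl, Finset.card_singleton]
    have hpos : 0 < Fintype.card γ := Fintype.card_pos_iff.2 ⟨x⟩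
    rw [eq_div_iff hn]
    push_cast
    rw [← pow_succ]; congr 1; omega
  have h2 : ∀ c : γ → Fin n, ((Finset.univ.filter (fun x => c x = 0)).card : ℝ) =
      ∑ x : γ, if c x = 0 then (1:ℝ) else 0 := by
    intro c; simp
  simp_rw [h2]
  rw [Finset.sum_comm]
  have h3 : ∀ x : γ, ∑ c : γ → Fin n, (if c x = 0 then (1:ℝ) else 0) =
      (n:ℝ) ^ Fintype.card γ / n := by
    intro x; rw [← h1 x]; simp
  simp_rw [h3]
  simp
  ring

theorem sum_sqrt_card_zero {γ : Type*} [Fintype γ] [DecidableEq γ] (n : ℕ) [NeZero n] :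
    ∑ c : γ → Fin n, Real.sqrt ((Finset.univ.filter (fun x => c x = 0)).card : ℝ) ≤
      (n:ℝ) ^ Fintype.card γ * Real.sqrt (Fintype.card γ / n) := by
  have h := sq_sum_le_card_mul_sum_sq (s := (Finset.univ : Finset (γ → Fin n)))
    (f := fun c => Real.sqrt ((Finset.univ.filter (fun x => c x = 0)).card : ℝ))
  have h2 : ∀ c : γ → Fin n, Real.sqrt ((Finset.univ.filter (fun x => c x = 0)).card : ℝ) ^ 2 =
      ((Finset.univ.filter (fun x => c x = 0)).card : ℝ) := fun c => Real.sq_sqrt (Nat.cast_nonneg _)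
  simp_rw [h2] at h
  rw [sum_card_zero] at h
  simp only [Finset.card_univ, Fintype.card_fun, Fintype.card_fin] at h
  push_cast at h
  refine (abs_le_of_sq_le_sq' ?_ (by positivity)).2
  rw [mul_pow, Real.sq_sqrt (by positivity)]
  refine h.trans (le_of_eq (by ring))

theorem sampling {γ ρ : Type*} [Fintype γ] [DecidableEq γ] (R : Finset ρ)
    (GR : ρ → Finset γ) (far : ρ → γ → Finset γ) (n n' : ℕ) [NeZero n] [NeZero n']
    (hGR : ∀ x ∈ R, n ≤ (GR x).card) (hfar : ∀ x ∈ R, ∀ f ∈ GR x, n' ≤ (far x f).card)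
    (Q : ℝ) (hQ0 : 0 ≤ Q)
    (hQ : ∀ (W B : Finset γ) (R' : Finset ρ), R' ⊆ R →
      (∀ x ∈ R', ∃ f ∈ GR x, f ∈ W ∧ ∃ g ∈ far x f, g ∈ B) →
      (R'.card : ℝ) ≤ Q * (W.card * Real.sqrt B.card + B.card * Real.sqrt W.card)) :
    (R.card : ℝ) ≤ 4 * Q * ((Fintype.card γ / n) * Real.sqrt (Fintype.card γ / n') +
      (Fintype.card γ / n') * Real.sqrt (Fintype.card γ / n)) := by
  classical
  let Z : ∀ k : ℕ, [NeZero k] → (γ → Fin k) → Finset γ :=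
    fun k _ c => Finset.univ.filter (fun x => c x = 0)
  let good : (γ → Fin n) → (γ → Fin n') → ρ → Prop := fun c c' x =>
    ∃ f ∈ GR x, f ∈ Z n c ∧ ∃ g ∈ far x f, g ∈ Z n' c'
  let N := Fintype.card γ
  have up : ∑ c : γ → Fin n, ∑ c' : γ → Fin n', ((R.filter (good c c')).card : ℝ) ≤
      Q * (((n:ℝ) ^ N * (N / n)) * ((n':ℝ) ^ N * Real.sqrt (N / n')) +
        ((n':ℝ) ^ N * (N / n')) * ((n:ℝ) ^ N * Real.sqrt (N / n))) := by
    calc _ ≤ ∑ c : γ → Fin n, ∑ c' : γ → Fin n', Q * (((Z n c).card:ℝ) * Real.sqrt (Z n' c').card +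
            (Z n' c').card * Real.sqrt (Z n c).card) := by
          refine Finset.sum_le_sum fun c _ => Finset.sum_le_sum fun c' _ => ?_
          refine hQ (Z n c) (Z n' c') _ (Finset.filter_subset _ _) ?_
          intro x hx
          exact (Finset.mem_filter.1 hx).2
      _ = Q * ((∑ c : γ → Fin n, ((Z n c).card:ℝ)) * (∑ c' : γ → Fin n', Real.sqrt (Z n' c').card) +
            (∑ c' : γ → Fin n', ((Z n' c').card:ℝ)) * (∑ c : γ → Fin n, Real.sqrt (Z n c).card)) := by
          have b1 : ∀ x y : (γ → Fin n) → ℝ, ∀ u v : (γ → Fin n') → ℝ,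
              ∑ c, ∑ c', Q * (x c * v c' + u c' * y c) =
                Q * ((∑ c, x c) * (∑ c', v c') + (∑ c', u c') * ∑ c, y c) := by
            intro x y u v
            rw [Finset.sum_mul_sum, Finset.sum_mul_sum, Finset.sum_comm (s := Finset.univ (α := γ → Fin n')),
              ← Finset.sum_add_distrib, Finset.mul_sum]
            refine Finset.sum_congr rfl fun c _ => ?_
            rw [← Finset.sum_add_distrib, Finset.mul_sum]
          exact b1 (fun c => ((Z n c).card:ℝ)) (fun c => Real.sqrt (Z n c).card)
            (fun c' => ((Z n' c').card:ℝ)) (fun c' => Real.sqrt (Z n' c').card)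
      _ ≤ _ := by
          have a1 := sum_card_zero (γ := γ) n
          have a2 := sum_card_zero (γ := γ) n'
          have a3 := sum_sqrt_card_zero (γ := γ) n
          have a4 := sum_sqrt_card_zero (γ := γ) n'
          simp only [Z, N]
          rw [a1, a2]
          gcongr
  have low : (R.card : ℝ) * (((n:ℝ) ^ N / 2) * ((n':ℝ) ^ N / 2)) ≤
      ∑ c : γ → Fin n, ∑ c' : γ → Fin n', ((R.filter (good c c')).card : ℝ) := by
    have h1 : ∀ c c', ((R.filter (good c c')).card : ℝ) = ∑ x ∈ R, if good c c' x then (1:ℝ) else 0 := by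
      intro c c'
      exact (Finset.sum_boole (R := ℝ) (good c c') R).symm
    rw [Finset.sum_congr rfl fun c _ => Finset.sum_congr rfl fun c' _ => h1 c c']
    rw [Finset.sum_congr rfl (fun c _ => Finset.sum_comm), Finset.sum_comm]
    rw [← nsmul_eq_mul, ← Finset.sum_const]
    refine Finset.sum_le_sum fun x hx => ?_
    have h2 : ∀ c : γ → Fin n, (if ∃ f ∈ GR x, c f = 0 then ((n':ℝ) ^ N / 2) else 0) ≤
        ∑ c' : γ → Fin n', if good c c' x then (1:ℝ) else 0 := by
      intro c
      split_ifs with hc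
      · obtain ⟨f, hf, hcf⟩ := hc
        refine (card_hit n' (far x f) (hfar x hx f hf)).trans ?_
        have : ∀ c' : γ → Fin n', (if ∃ g ∈ far x f, c' g = 0 then (1:ℝ) else 0) ≤
            if good c c' x then (1:ℝ) else 0 := by
          intro c'
          by_cases hg : ∃ g ∈ far x f, c' g = 0
          · have : good c c' x := by
              obtain ⟨g, hg, hcg⟩ := hg
              exact ⟨f, hf, by simp [Z, hcf], g, hg, by simp [Z, hcg]⟩
            rw [if_pos hg, if_pos this]
          · rw [if_neg hg]; split_ifs <;> norm_num
        calc _ = ∑ c' : γ → Fin n', if ∃ g ∈ far x f, c' g = 0 then (1:ℝ) else 0 := by simp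
          _ ≤ _ := Finset.sum_le_sum fun c' _ => this c'
      · exact Finset.sum_nonneg fun c' _ => by split_ifs <;> norm_num
    refine le_trans ?_ (Finset.sum_le_sum fun c _ => h2 c)
    rw [← Finset.sum_filter, Finset.sum_const, nsmul_eq_mul]
    gcongr
    exact card_hit n (GR x) (hGR x hx)
  have hall := low.trans up
  have hn : (0:ℝ) < (n:ℝ) ^ N := pow_pos (by exact_mod_cast NeZero.pos n) _
  have hn' : (0:ℝ) < (n':ℝ) ^ N := pow_pos (by exact_mod_cast NeZero.pos n') _
  have hp : 0 < (n:ℝ) ^ N * (n':ℝ) ^ N := mul_pos hn hn'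
  refine le_of_mul_le_mul_right ?_ hp
  simp only [N] at *
  nlinarith

end PartB

section PartC

theorem mvt_bound (h h1 : ℝ → ℝ) (hd : ∀ x, HasDerivAt h (h1 x) x) (a b C : ℝ)
    (hb : ∀ x ∈ Set.Icc a b, |h1 x| ≤ C) (x y : ℝ) (hx : x ∈ Set.Icc a b) (hy : y ∈ Set.Icc a b) :
    |h x - h y| ≤ C * |x - y| := by
  have := Convex.norm_image_sub_le_of_norm_hasDerivWithin_le (f := h) (f' := h1) (s := Set.Icc a b)
    (fun x _ => (hd x).hasDerivWithinAt) (fun x hx => by simpa using hb x hx)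
    (convex_Icc a b) hy hx
  simpa using this

theorem taylor2 (h h1 h2 : ℝ → ℝ) (hd : ∀ x, HasDerivAt h (h1 x) x)
    (hd1 : ∀ x, HasDerivAt h1 (h2 x) x) (a b p x : ℝ) (hp : p ∈ Set.Icc a b) (hx : x ∈ Set.Icc a b)
    (hne : x ≠ p) :
    ∃ ξ ∈ Set.Icc a b, h x = h p + h1 p * (x - p) + h2 ξ * (x - p) ^ 2 / 2 := by
  have hxp : (x - p) ^ 2 ≠ 0 := pow_ne_zero 2 (sub_ne_zero.2 hne)
  obtain ⟨M, hM⟩ : ∃ M, h x = h p + h1 p * (x - p) + M * (x - p) ^ 2 / 2 :=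
    ⟨2 * (h x - h p - h1 p * (x - p)) / (x - p) ^ 2, by field_simp; ring⟩
  let u : ℝ → ℝ := fun y => h y - h p - h1 p * (y - p) - M * (y - p) ^ 2 / 2
  let u1 : ℝ → ℝ := fun y => h1 y - h1 p - M * (y - p)
  have hu : ∀ y, HasDerivAt u (u1 y) y := by
    intro y
    have e1 : HasDerivAt (fun y => h1 p * (y - p)) (h1 p * 1) y :=
      ((hasDerivAt_id y).sub_const p).const_mul _
    have e2 : HasDerivAt (fun y => M * (y - p) ^ 2 / 2) (M * (2 * (y - p) ^ 1 * 1) / 2) y :=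
      ((((hasDerivAt_id y).sub_const p).pow 2).const_mul M).div_const 2
    have h3 : HasDerivAt u (h1 y - h1 p * 1 - M * (2 * (y - p) ^ 1 * 1) / 2) y :=
      (((hd y).sub_const (h p)).sub e1).sub e2
    refine h3.congr_deriv ?_
    simp only [u1]; ring
  have hu1 : ∀ y, HasDerivAt u1 (h2 y - M) y := by
    intro y
    have e1 : HasDerivAt (fun y => M * (y - p)) (M * 1) y :=
      ((hasDerivAt_id y).sub_const p).const_mul _
    have h3 : HasDerivAt u1 (h2 y - M * 1) y := ((hd1 y).sub_const (h1 p)).sub e1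
    refine h3.congr_deriv ?_
    ring
  have u0 : u p = 0 := by simp [u]
  have ux : u x = 0 := by simp only [u]; rw [hM]; ring
  have u10 : u1 p = 0 := by simp [u1]
  have cu : Continuous u := continuous_iff_continuousAt.2 fun y => (hu y).continuousAt
  have cu1 : Continuous u1 := continuous_iff_continuousAt.2 fun y => (hu1 y).continuousAt
  have key : ∃ ξ ∈ Set.Icc a b, h2 ξ - M = 0 := by
    rcases lt_or_gt_of_ne hne with hlt | hlt
    · obtain ⟨c, hc, hc0⟩ := exists_hasDerivAt_eq_zero hlt cu.continuousOn (by rw [u0, ux])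
        (fun y _ => hu y)
      obtain ⟨e, he, he0⟩ := exists_hasDerivAt_eq_zero hc.2 cu1.continuousOn (by rw [hc0, u10])
        (fun y _ => hu1 y)
      exact ⟨e, ⟨by linarith [hx.1, hc.1, he.1], by linarith [hp.2, he.2]⟩, he0⟩
    · obtain ⟨c, hc, hc0⟩ := exists_hasDerivAt_eq_zero hlt cu.continuousOn (by rw [u0, ux])
        (fun y _ => hu y)
      obtain ⟨e, he, he0⟩ := exists_hasDerivAt_eq_zero hc.1 cu1.continuousOn (by rw [hc0, u10])
        (fun y _ => hu1 y)
      exact ⟨e, ⟨by linarith [hp.1, he.1], by linarith [hx.2, hc.2, he.2]⟩, he0⟩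
  obtain ⟨ξ, hξ, h0⟩ := key
  refine ⟨ξ, hξ, ?_⟩
  have : h2 ξ = M := by linarith
  rw [this, hM]

/-- no four alternations -/
theorem no_alt0 (h h1 h2 : ℝ → ℝ) (hd : ∀ x, HasDerivAt h (h1 x) x)
    (hd1 : ∀ x, HasDerivAt h1 (h2 x) x) (a b K D : ℝ) (hK : 1 ≤ K) (hlen : b - a ≤ 1 / (100 * K))
    (hjle : ∀ x ∈ Set.Icc a b, |h x| + |h1 x| + |h2 x| ≤ D)
    (hlej : ∀ x ∈ Set.Icc a b, D ≤ K * (|h x| + |h1 x| + |h2 x|))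
    (x1 x2 x3 x4 : ℝ) (hx1 : a ≤ x1) (h12 : x1 < x2) (h23 : x2 < x3) (h34 : x3 < x4) (hx4 : x4 ≤ b)
    (s1 : 0 < h x1) (s2 : h x2 < 0) (s3 : 0 < h x3) (s4 : h x4 < 0) : False := by
  have ch : Continuous h := continuous_iff_continuousAt.2 fun y => (hd y).continuousAt
  have ch1 : Continuous h1 := continuous_iff_continuousAt.2 fun y => (hd1 y).continuousAt
  obtain ⟨z1, hz1, z10⟩ := intermediate_value_Ioo' h12.le ch.continuousOn (⟨s2, s1⟩ : (0:ℝ) ∈ Set.Ioo _ _)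
  obtain ⟨z2, hz2, z20⟩ := intermediate_value_Ioo h23.le ch.continuousOn (⟨s2, s3⟩ : (0:ℝ) ∈ Set.Ioo _ _)
  obtain ⟨z3, hz3, z30⟩ := intermediate_value_Ioo' h34.le ch.continuousOn (⟨s4, s3⟩ : (0:ℝ) ∈ Set.Ioo _ _)
  obtain ⟨w1, hw1, w10⟩ := exists_hasDerivAt_eq_zero (hz1.2.trans hz2.1) ch.continuousOn
    (by rw [z10, z20]) (fun y _ => hd y)
  obtain ⟨w2, hw2, w20⟩ := exists_hasDerivAt_eq_zero (hz2.2.trans hz3.1) ch.continuousOn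
    (by rw [z20, z30]) (fun y _ => hd y)
  obtain ⟨w, hw, w0⟩ := exists_hasDerivAt_eq_zero (hw1.2.trans hw2.1) ch1.continuousOn
    (by rw [w10, w20]) (fun y _ => hd1 y)
  have hz1' := hz1.1
  have hz1'' := hz1.2
  have hz2' := hz2.1
  have hz2'' := hz2.2
  have hz3' := hz3.1
  have hz3'' := hz3.2
  have hw1' := hw1.1
  have hw1'' := hw1.2
  have hw2' := hw2.1
  have hw2'' := hw2.2
  have hw' := hw.1
  have hw'' := hw.2
  have Jx1 : x1 ∈ Set.Icc a b := ⟨hx1, by linarith⟩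
  have Jw : w ∈ Set.Icc a b := ⟨by linarith, by linarith⟩
  have Jw1 : w1 ∈ Set.Icc a b := ⟨by linarith, by linarith⟩
  have Jz1 : z1 ∈ Set.Icc a b := ⟨by linarith, by linarith⟩
  have Dpos : 0 < D := by
    have := hjle x1 Jx1
    have h1' := abs_pos.2 s1.ne'
    linarith [abs_nonneg (h1 x1), abs_nonneg (h2 x1)]
  have hη : 0 < 1 / (100 * K) := by positivity
  have B1 := mvt_bound h1 h2 hd1 a b D (fun x hx => by
    linarith [hjle x hx, abs_nonneg (h x), abs_nonneg (h1 x)]) w w1 Jw Jw1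
  have B0 := mvt_bound h h1 hd a b D (fun x hx => by
    linarith [hjle x hx, abs_nonneg (h x), abs_nonneg (h2 x)]) w z1 Jw Jz1
  rw [w10, sub_zero] at B1
  rw [z10, sub_zero] at B0
  have a1 : |w - w1| ≤ 1 / (100 * K) := by rw [abs_le]; constructor <;> linarith
  have a2 : |w - z1| ≤ 1 / (100 * K) := by rw [abs_le]; constructor <;> linarith
  have hf := hlej w Jw
  rw [w0, abs_zero, add_zero] at hf
  have c1 : |h w| ≤ D * (1 / (100 * K)) := B0.trans (by gcongr)
  have c2 : |h1 w| ≤ D * (1 / (100 * K)) := B1.trans (by gcongr)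
  have c3 : K * (|h w| + |h1 w|) ≤ K * (D * (1 / (100 * K)) + D * (1 / (100 * K))) := by gcongr
  have c4 : K * (D * (1 / (100 * K)) + D * (1 / (100 * K))) = D / 50 := by field_simp; ring
  linarith

/-- lens lemma -/
theorem lens0 (h h1 h2 : ℝ → ℝ) (hd : ∀ x, HasDerivAt h (h1 x) x)
    (hd1 : ∀ x, HasDerivAt h1 (h2 x) x) (hc2 : Continuous h2)
    (a b K D t s : ℝ) (hK : 1 ≤ K) (hlen : b - a ≤ 1 / (100 * K))
    (hjle : ∀ x ∈ Set.Icc a b, |h x| + |h1 x| + |h2 x| ≤ D)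
    (hlej : ∀ x ∈ Set.Icc a b, D ≤ K * (|h x| + |h1 x| + |h2 x|))
    (ht : 0 < t) (hs : 0 < s) (hst : s ≤ t / (1000 * K)) (hD : t / 4 < D)
    (p : ℝ) (hp : p ∈ Set.Icc a b) (hp0 : |h p| ≤ 7 * (s ^ 2 / t)) (hp1 : |h1 p| ≤ 7 * s) :
    (∀ x ∈ Set.Icc a b, 100 * K * s / t ≤ |x - p| → 8 * (s ^ 2 / t) < h x) ∨
    (∀ x ∈ Set.Icc a b, 100 * K * s / t ≤ |x - p| → h x < - (8 * (s ^ 2 / t))) := by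
  have Kpos : 0 < K := by linarith
  obtain ⟨Δ, hΔ⟩ : ∃ Δ, Δ = s ^ 2 / t := ⟨_, rfl⟩
  rw [← hΔ] at hp0 ⊢
  have hΔpos : 0 < Δ := by rw [hΔ]; positivity
  have hst' : s * (1000 * K) ≤ t := by rwa [le_div_iff₀ (by positivity)] at hst
  have hΔt : Δ * t = s ^ 2 := by rw [hΔ]; field_simp
  have hΔs : Δ ≤ s := by
    have : Δ * t ≤ s * t := by rw [hΔt, sq]; gcongr; nlinarith
    exact le_of_mul_le_mul_right this ht
  have hlen' : (b - a) * (100 * K) ≤ 1 := by rwa [le_div_iff₀ (by positivity)] at hlen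
  have Dpos : 0 < D := by linarith
  have hlow : ∀ x ∈ Set.Icc a b, t / (5 * K) ≤ |h2 x| := by
    intro x hx
    have B1 := mvt_bound h1 h2 hd1 a b D (fun x hx => by
      linarith [hjle x hx, abs_nonneg (h x), abs_nonneg (h1 x)]) x p hx hp
    have B0 := mvt_bound h h1 hd a b D (fun x hx => by
      linarith [hjle x hx, abs_nonneg (h x), abs_nonneg (h2 x)]) x p hx hp
    have hxp : |x - p| ≤ b - a := by
      rw [abs_le]; constructor <;> linarith [hx.1, hx.2, hp.1, hp.2]
    have c0 : |h x| ≤ 7 * Δ + D * (b - a) := by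
      have := abs_sub_abs_le_abs_sub (h x) (h p)
      have : D * |x - p| ≤ D * (b - a) := by gcongr
      linarith
    have c1 : |h1 x| ≤ 7 * s + D * (b - a) := by
      have := abs_sub_abs_le_abs_sub (h1 x) (h1 p)
      have : D * |x - p| ≤ D * (b - a) := by gcongr
      linarith
    have c2 := hlej x hx
    rw [div_le_iff₀ (by positivity)]
    have c3 : K * (|h x| + |h1 x| + |h2 x|) ≤ K * (14 * s + 2 * (D * (b - a)) + |h2 x|) :=
      mul_le_mul_of_nonneg_left (by linarith) Kpos.le
    have c4 : D * ((b - a) * (100 * K)) ≤ D * 1 := by gcongr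
    nlinarith
  have hsign : (∀ x ∈ Set.Icc a b, t / (5 * K) ≤ h2 x) ∨ (∀ x ∈ Set.Icc a b, h2 x ≤ - (t / (5 * K))) := by
    have hpos : 0 < t / (5 * K) := by positivity
    by_contra hcon
    push Not at hcon
    obtain ⟨⟨x, hx, hx'⟩, ⟨y, hy, hy'⟩⟩ := hcon
    have hx2 : h2 x < 0 := by
      have := hlow x hx
      rcases le_abs'.1 this with h | h <;> linarith
    have hy2 : 0 < h2 y := by
      have := hlow y hy
      rcases le_abs'.1 this with h | h <;> linarith
    have := (convex_Icc a b).isPreconnected.intermediate_value hx hy hc2.continuousOn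
      (⟨hx2.le, hy2.le⟩ : (0:ℝ) ∈ Set.Icc _ _)
    obtain ⟨z, hz, hz0⟩ := this
    have := hlow z hz
    rw [hz0, abs_zero] at this
    linarith
  have est : ∀ X : ℝ, 100 * K * s / t ≤ X → 15 * Δ < t / (5 * K) * X ^ 2 / 2 - 7 * s * X := by
    intro X hX
    have hX' : 100 * K * s ≤ X * t := by rwa [div_le_iff₀ ht] at hX
    have hXpos : 0 < X := lt_of_lt_of_le (by positivity) hX
    have e1 : 10 * s ≤ t / (5 * K) * X / 2 := by
      rw [div_mul_eq_mul_div, div_div, le_div_iff₀ (by positivity)]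
      nlinarith
    have e2 : 10 * s * X ≤ t / (5 * K) * X ^ 2 / 2 := by nlinarith
    have e3 : 100 * K * Δ ≤ s * X := by
      have : 100 * K * Δ * t ≤ s * X * t := by
        rw [mul_assoc, hΔt]; nlinarith
      exact le_of_mul_le_mul_right this ht
    nlinarith
  have hρ : 0 < 100 * K * s / t := by positivity
  rcases hsign with hsg | hsg
  · left
    intro x hx hxp
    have hne : x ≠ p := by
      rintro rfl; simp at hxp; linarith
    obtain ⟨ξ, hξ, hT⟩ := taylor2 h h1 h2 hd hd1 a b p x hp hx hne
    have e := est _ hxp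
    rw [sq_abs] at e
    have e1 : t / (5 * K) * (x - p) ^ 2 / 2 ≤ h2 ξ * (x - p) ^ 2 / 2 := by
      have := hsg ξ hξ; gcongr
    have e2 : |h1 p * (x - p)| ≤ 7 * s * |x - p| := by rw [abs_mul]; gcongr
    have e3 := (abs_le.1 e2).1
    have e4 := (abs_le.1 hp0).1
    linarith
  · right
    intro x hx hxp
    have hne : x ≠ p := by
      rintro rfl; simp at hxp; linarith
    obtain ⟨ξ, hξ, hT⟩ := taylor2 h h1 h2 hd hd1 a b p x hp hx hne
    have e := est _ hxp
    rw [sq_abs] at e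
    have e1 : h2 ξ * (x - p) ^ 2 / 2 ≤ (- (t / (5 * K))) * (x - p) ^ 2 / 2 := by
      have := hsg ξ hξ; gcongr
    have e2 : |h1 p * (x - p)| ≤ 7 * s * |x - p| := by rw [abs_mul]; gcongr
    have e3 := (abs_le.1 e2).2
    have e4 := (abs_le.1 hp0).2
    linarith

/-- local cinematic setup for an indexed finite family -/
structure Cin {γ : Type*} (φ : γ → ℝ → ℝ) (d : γ → γ → ℝ) (a b K : ℝ) : Prop where
  smooth : ∀ f, ContDiff ℝ 2 (φ f)
  hK : 1 ≤ K
  hab : a ≤ b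
  hlen : b - a ≤ 1 / (100 * K)
  jet_le : ∀ f g, ∀ θ ∈ Set.Icc a b, |φ f θ - φ g θ| + |deriv (φ f) θ - deriv (φ g) θ| +
    |deriv (deriv (φ f)) θ - deriv (deriv (φ g)) θ| ≤ d f g
  le_jet : ∀ f g, ∀ θ ∈ Set.Icc a b, d f g ≤ K * (|φ f θ - φ g θ| + |deriv (φ f) θ - deriv (φ g) θ| +
    |deriv (deriv (φ f)) θ - deriv (deriv (φ g)) θ|)

theorem smooth_facts (f : ℝ → ℝ) (hf : ContDiff ℝ 2 f) :
    (∀ x, HasDerivAt f (deriv f x) x) ∧ (∀ x, HasDerivAt (deriv f) (deriv (deriv f) x) x) ∧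
      Continuous (deriv (deriv f)) := by
  have h2 : ContDiff ℝ (1 + 1) f := by norm_num; exact hf
  have h1 := (contDiff_succ_iff_deriv.1 h2)
  have h1' : ContDiff ℝ (0 + 1) (deriv f) := by norm_num; exact h1.2.2
  have h0 := (contDiff_succ_iff_deriv.1 h1')
  exact ⟨fun x => (h1.1 x).hasDerivAt, fun x => (h0.1 x).hasDerivAt, h0.2.2.continuous⟩

theorem Cin.no_alt {γ : Type*} {φ : γ → ℝ → ℝ} {d : γ → γ → ℝ} {a b K : ℝ} (C : Cin φ d a b K)
    (f g : γ) (x1 x2 x3 x4 : ℝ) (hx1 : a ≤ x1) (h12 : x1 < x2) (h23 : x2 < x3) (h34 : x3 < x4)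
    (hx4 : x4 ≤ b) (s1 : φ g x1 < φ f x1) (s2 : φ f x2 < φ g x2) (s3 : φ g x3 < φ f x3)
    (s4 : φ f x4 < φ g x4) : False := by
  obtain ⟨f0, f1, f2⟩ := smooth_facts _ (C.smooth f)
  obtain ⟨g0, g1, g2⟩ := smooth_facts _ (C.smooth g)
  exact no_alt0 (fun x => φ f x - φ g x) (fun x => deriv (φ f) x - deriv (φ g) x)
    (fun x => deriv (deriv (φ f)) x - deriv (deriv (φ g)) x)
    (fun x => (f0 x).sub (g0 x)) (fun x => (f1 x).sub (g1 x)) a b K (d f g) C.hK C.hlen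
    (C.jet_le f g) (C.le_jet f g) x1 x2 x3 x4 hx1 h12 h23 h34 hx4 (by linarith) (by linarith)
    (by linarith) (by linarith)

/-- `g` lies above `f - 8Δ` at `x` and below away from `x` -/
def Lens {γ : Type*} (φ : γ → ℝ → ℝ) (a b Δ ρ : ℝ) (f g : γ) (x : ℝ) : Prop :=
  φ f x - 8 * Δ < φ g x ∧ ∀ y ∈ Set.Icc a b, ρ ≤ |y - x| → φ g y < φ f y - 8 * Δ

theorem Cin.lens {γ : Type*} {φ : γ → ℝ → ℝ} {d : γ → γ → ℝ} {a b K : ℝ} (C : Cin φ d a b K)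
    (f g : γ) (t s : ℝ) (ht : 0 < t) (hs : 0 < s) (hst : s ≤ t / (1000 * K)) (hD : t / 4 < d f g)
    (p : ℝ) (hp : p ∈ Set.Icc a b) (hp0 : |φ f p - φ g p| ≤ 7 * (s ^ 2 / t))
    (hp1 : |deriv (φ f) p - deriv (φ g) p| ≤ 7 * s) :
    Lens φ a b (s ^ 2 / t) (100 * K * s / t) f g p ∨ Lens φ a b (s ^ 2 / t) (100 * K * s / t) g f p := by
  obtain ⟨f0, f1, f2⟩ := smooth_facts _ (C.smooth f)
  obtain ⟨g0, g1, g2⟩ := smooth_facts _ (C.smooth g)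
  have hΔ : 0 < s ^ 2 / t := by positivity
  rcases lens0 (fun x => φ f x - φ g x) (fun x => deriv (φ f) x - deriv (φ g) x)
    (fun x => deriv (deriv (φ f)) x - deriv (deriv (φ g)) x)
    (fun x => (f0 x).sub (g0 x)) (fun x => (f1 x).sub (g1 x)) (f2.sub g2) a b K (d f g) t s C.hK C.hlen
    (C.jet_le f g) (C.le_jet f g) ht hs hst hD p hp hp0 hp1 with h | h
  · left
    refine ⟨?_, fun y hy hyp => by linarith [h y hy hyp]⟩
    have := (abs_le.1 hp0).2
    linarith
  · right
    refine ⟨?_, fun y hy hyp => by linarith [h y hy hyp]⟩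
    have := (abs_le.1 hp0).1
    linarith

theorem Cin.nested {γ : Type*} {φ : γ → ℝ → ℝ} {d : γ → γ → ℝ} {a b K : ℝ} (C : Cin φ d a b K)
    (f1 f2 g1 g2 : γ) (Δ ρ x11 x12 x21 x22 : ℝ)
    (J11 : x11 ∈ Set.Icc a b) (J12 : x12 ∈ Set.Icc a b) (J21 : x21 ∈ Set.Icc a b)
    (J22 : x22 ∈ Set.Icc a b)
    (l11 : Lens φ a b Δ ρ f1 g1 x11) (l12 : Lens φ a b Δ ρ f1 g2 x12)
    (l21 : Lens φ a b Δ ρ f2 g1 x21) (l22 : Lens φ a b Δ ρ f2 g2 x22)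
    (s1 : ρ ≤ |x11 - x12|) (s2 : ρ ≤ |x21 - x22|) (s3 : ρ ≤ |x11 - x21|) (s4 : ρ ≤ |x12 - x22|)
    (h1 : x11 < x12) (h2 : x21 < x22) :
    (x11 < x21 ∧ x22 < x12) ∨ (x21 < x11 ∧ x12 < x22) := by
  have s1' : ρ ≤ |x12 - x11| := by rwa [abs_sub_comm]
  have s2' : ρ ≤ |x22 - x21| := by rwa [abs_sub_comm]
  have s3' : ρ ≤ |x21 - x11| := by rwa [abs_sub_comm]
  have s4' : ρ ≤ |x22 - x12| := by rwa [abs_sub_comm]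
  have A1 : φ f1 x11 < φ f2 x11 := by linarith [l11.1, l21.2 x11 J11 s3]
  have A2 : φ f1 x12 < φ f2 x12 := by linarith [l12.1, l22.2 x12 J12 s4]
  have A3 : φ f2 x21 < φ f1 x21 := by linarith [l21.1, l11.2 x21 J21 s3']
  have A4 : φ f2 x22 < φ f1 x22 := by linarith [l22.1, l12.2 x22 J22 s4']
  have B1 : φ g2 x11 < φ g1 x11 := by linarith [l11.1, l12.2 x11 J11 s1]
  have B2 : φ g2 x21 < φ g1 x21 := by linarith [l21.1, l22.2 x21 J21 s2]
  have B3 : φ g1 x12 < φ g2 x12 := by linarith [l12.1, l11.2 x12 J12 s1']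
  have B4 : φ g1 x22 < φ g2 x22 := by linarith [l22.1, l21.2 x22 J22 s2']
  have n1 : x11 ≠ x21 := by intro h; rw [h] at A1; linarith
  have n2 : x12 ≠ x22 := by intro h; rw [h] at A2; linarith
  have n3 : x11 ≠ x22 := by intro h; rw [h] at A1; linarith
  have n4 : x12 ≠ x21 := by intro h; rw [h] at A2; linarith
  rcases lt_or_gt_of_ne n1 with c1 | c1
  · rcases lt_or_gt_of_ne n2 with c2 | c2
    · exfalso
      rcases lt_or_gt_of_ne n4 with c4 | c4
      · exact C.no_alt g1 g2 x11 x12 x21 x22 J11.1 h1 c4 h2 J22.2 B1 B3 B2 B4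
      · exact C.no_alt f2 f1 x11 x21 x12 x22 J11.1 c1 c4 c2 J22.2 A1 A3 A2 A4
    · exact Or.inl ⟨c1, c2⟩
  · rcases lt_or_gt_of_ne n2 with c2 | c2
    · exact Or.inr ⟨c1, c2⟩
    · exfalso
      rcases lt_or_gt_of_ne n3 with c4 | c4
      · exact C.no_alt f1 f2 x21 x11 x22 x12 J21.1 c1 c4 c2 J12.2 A3 A1 A4 A2
      · exact C.no_alt g1 g2 x21 x22 x11 x12 J21.1 h2 c4 h1 J12.2 B2 B4 B1 B3

end PartC

section PartC2

theorem Cin.edge_bound {γ τ : Type*} [DecidableEq γ] {φ : γ → ℝ → ℝ} {d : γ → γ → ℝ} {a b K : ℝ}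
    (C : Cin φ d a b K) (Ed : Finset τ) (fe ge : τ → γ) (ke : τ → ℕ) (x : ℕ → ℝ) (hx : StrictMono x)
    (Δ ρ : ℝ) (hρ : 0 < ρ) (W B : Finset γ) (L : ℕ) (hL : 1 ≤ L)
    (hW : ∀ e ∈ Ed, fe e ∈ W) (hB : ∀ e ∈ Ed, ge e ∈ B) (hk : ∀ e ∈ Ed, ke e < 2 ^ L)
    (hJ : ∀ e ∈ Ed, x (ke e) ∈ Set.Icc a b)
    (hl : ∀ e ∈ Ed, Lens φ a b Δ ρ (fe e) (ge e) (x (ke e)))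
    (hsep : ∀ e ∈ Ed, ∀ e' ∈ Ed, e ≠ e' → (fe e = fe e' ∨ ge e = ge e') →
      ρ ≤ |x (ke e) - x (ke e')|) :
    (Ed.card : ℝ) ≤ 10 * (L:ℝ) ^ 2 * (W.card * Real.sqrt B.card + B.card * Real.sqrt W.card) := by
  classical
  rcases Ed.eq_empty_or_nonempty with he | ⟨e0, he0⟩
  · rw [he]; simp; positivity
  have : ∀ f g, ∃ e, (∃ e ∈ Ed, fe e = f ∧ ge e = g) → e ∈ Ed ∧ fe e = f ∧ ge e = g := by
    intro f g
    by_cases h : ∃ e ∈ Ed, fe e = f ∧ ge e = g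
    · obtain ⟨e, he⟩ := h; exact ⟨e, fun _ => he⟩
    · exact ⟨e0, fun h' => (h h').elim⟩
  choose E hE using this
  let A : γ → Finset γ := fun f => B.filter (fun g => ∃ e ∈ Ed, fe e = f ∧ ge e = g)
  have mA : ∀ f g, g ∈ A f → E f g ∈ Ed ∧ fe (E f g) = f ∧ ge (E f g) = g := by
    intro f g hg; exact hE f g (Finset.mem_filter.1 hg).2
  have hinjE : ∀ e ∈ Ed, ∀ e' ∈ Ed, fe e = fe e' → ge e = ge e' → e = e' := by
    intro e he e' he' h1 h2
    by_contra hne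
    have hs := hsep e he e' he' hne (Or.inl h1)
    rw [abs_sub_comm] at hs
    have a1 := (hl e he).2 _ (hJ e' he') hs
    have a2 := (hl e' he').1
    rw [h1, h2] at a1
    linarith
  have hlist := listBound W B A (fun f g => ke (E f g)) L hL ?_ ?_ ?_ ?_
  · have hcard : (Ed.card : ℝ) ≤ ∑ f ∈ W, ((A f).card : ℝ) := by
      have h1 : Ed.card ≤ (W.sigma A).card := by
        refine Finset.card_le_card_of_injOn (fun e => ⟨fe e, ge e⟩) ?_ ?_
        · intro e he
          simp only [Finset.coe_sigma, Set.mem_sigma_iff, Finset.mem_coe]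
          exact ⟨hW e he, Finset.mem_filter.2 ⟨hB e he, e, he, rfl, rfl⟩⟩
        · intro e he e' he' h
          simp only [Sigma.mk.injEq] at h
          exact hinjE e he e' he' h.1 (eq_of_heq h.2)
      rw [Finset.card_sigma] at h1
      exact_mod_cast h1
    have h2 := (pow_le_pow_left₀ (Nat.cast_nonneg _) hcard 2).trans hlist
    refine (abs_le_of_sq_le_sq' ?_ (by positivity)).2
    refine h2.trans ?_
    have q1 : Real.sqrt (B.card:ℝ) ^ 2 = B.card := Real.sq_sqrt (Nat.cast_nonneg _)
    have q2 : Real.sqrt (W.card:ℝ) ^ 2 = W.card := Real.sq_sqrt (Nat.cast_nonneg _)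
    have q3 : 0 ≤ Real.sqrt (B.card:ℝ) := Real.sqrt_nonneg _
    have q4 : 0 ≤ Real.sqrt (W.card:ℝ) := Real.sqrt_nonneg _
    have q5 : (0:ℝ) ≤ W.card := Nat.cast_nonneg _
    have q6 : (0:ℝ) ≤ B.card := Nat.cast_nonneg _
    have q7 : (W.card:ℝ) * B.card * (W.card + B.card) ≤
        (W.card * Real.sqrt B.card + B.card * Real.sqrt W.card) ^ 2 := by
      have e1 : (W.card * Real.sqrt B.card + B.card * Real.sqrt W.card) ^ 2 =
        (W.card:ℝ) ^ 2 * Real.sqrt (B.card:ℝ) ^ 2 + (B.card:ℝ) ^ 2 * Real.sqrt (W.card:ℝ) ^ 2 +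
          2 * ((W.card:ℝ) * B.card * (Real.sqrt B.card * Real.sqrt W.card)) := by ring
      rw [e1, q1, q2]
      have : 0 ≤ (W.card:ℝ) * B.card * (Real.sqrt B.card * Real.sqrt W.card) := by positivity
      nlinarith
    calc 100 * (L:ℝ) ^ 4 * W.card * B.card * (W.card + B.card)
        = 100 * (L:ℝ) ^ 4 * ((W.card:ℝ) * B.card * (W.card + B.card)) := by ring
      _ ≤ 100 * (L:ℝ) ^ 4 * (W.card * Real.sqrt B.card + B.card * Real.sqrt W.card) ^ 2 := by gcongr
      _ = _ := by ring
  · intro f _; exact Finset.filter_subset _ _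
  · intro f _ g hg g' hg' h
    obtain ⟨e1, e2, e3⟩ := mA f g hg
    obtain ⟨e1', e2', e3'⟩ := mA f g' hg'
    by_contra hne
    have hEne : E f g ≠ E f g' := by
      intro h'; apply hne; rw [← e3, ← e3', h']
    have := hsep _ e1 _ e1' hEne (Or.inl (by rw [e2, e2']))
    simp only at h
    rw [h, sub_self, abs_zero] at this
    linarith
  · intro f _ g hg
    exact hk _ (mA f g hg).1
  · intro i _ j _ hij g1 hg1 g2 hg2 g3 hg3 h1 h2 h3 h4
    rw [Finset.mem_inter] at hg1 hg2 hg3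
    have n12 : g1 ≠ g2 := by rintro rfl; exact lt_irrefl _ h1
    have n23 : g2 ≠ g3 := by rintro rfl; exact lt_irrefl _ h2
    have n13 : g1 ≠ g3 := by rintro rfl; exact lt_irrefl _ (h1.trans h2)
    have sepf : ∀ f g g', g ∈ A f → g' ∈ A f → g ≠ g' → ρ ≤ |x (ke (E f g)) - x (ke (E f g'))| := by
      intro f g g' hg hg' hne
      obtain ⟨e1, e2, e3⟩ := mA f g hg
      obtain ⟨e1', e2', e3'⟩ := mA f g' hg'
      refine hsep _ e1 _ e1' ?_ (Or.inl (by rw [e2, e2']))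
      intro h'; apply hne; rw [← e3, ← e3', h']
    have sepg : ∀ g, g ∈ A i → g ∈ A j → ρ ≤ |x (ke (E i g)) - x (ke (E j g))| := by
      intro g hg hg'
      obtain ⟨e1, e2, e3⟩ := mA i g hg
      obtain ⟨e1', e2', e3'⟩ := mA j g hg'
      refine hsep _ e1 _ e1' ?_ (Or.inr (by rw [e3, e3']))
      intro h'; apply hij; rw [← e2, ← e2', h']
    have JJ : ∀ f g, g ∈ A f → x (ke (E f g)) ∈ Set.Icc a b := fun f g hg => hJ _ (mA f g hg).1
    have LL : ∀ f g, g ∈ A f → Lens φ a b Δ ρ f g (x (ke (E f g))) := by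
      intro f g hg
      obtain ⟨e1, e2, e3⟩ := mA f g hg
      have := hl _ e1
      rw [e2, e3] at this
      exact this
    have nest : ∀ g g', g ∈ A i ∧ g ∈ A j → g' ∈ A i ∧ g' ∈ A j → g ≠ g' →
        ke (E i g) < ke (E i g') → ke (E j g) < ke (E j g') →
        (x (ke (E i g)) < x (ke (E j g)) ∧ x (ke (E j g')) < x (ke (E i g'))) ∨
        (x (ke (E j g)) < x (ke (E i g)) ∧ x (ke (E i g')) < x (ke (E j g'))) := by
      intro g g' hg hg' hne k1 k2
      exact C.nested i j g g' Δ ρ _ _ _ _ (JJ _ _ hg.1) (JJ _ _ hg'.1) (JJ _ _ hg.2) (JJ _ _ hg'.2)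
        (LL _ _ hg.1) (LL _ _ hg'.1) (LL _ _ hg.2) (LL _ _ hg'.2)
        (sepf _ _ _ hg.1 hg'.1 hne) (sepf _ _ _ hg.2 hg'.2 hne) (sepg _ hg.1 hg.2)
        (sepg _ hg'.1 hg'.2) (hx k1) (hx k2)
    have N12 := nest g1 g2 hg1 hg2 n12 h1 h3
    have N23 := nest g2 g3 hg2 hg3 n23 h2 h4
    have N13 := nest g1 g3 hg1 hg3 n13 (h1.trans h2) (h3.trans h4)
    rcases N12 with ⟨p1, p2⟩ | ⟨p1, p2⟩ <;> rcases N23 with ⟨p3, p4⟩ | ⟨p3, p4⟩ <;>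
      rcases N13 with ⟨p5, p6⟩ | ⟨p5, p6⟩ <;> linarith

/-- functions of the family whose 1-jet at `x` is close to `(uΔ, vs)` -/
noncomputable def cellG {γ : Type*} [Fintype γ] (φ : γ → ℝ → ℝ) (x Δ s : ℝ) (u v : ℤ) : Finset γ :=
  Finset.univ.filter (fun f => |⌊φ f x / Δ⌋ - u| ≤ 3 ∧ |⌊deriv (φ f) x / s⌋ - v| ≤ 3)

theorem mem_cellG {γ : Type*} [Fintype γ] (φ : γ → ℝ → ℝ) (x Δ s : ℝ) (u v : ℤ) (f : γ) :
    f ∈ cellG φ x Δ s u v ↔ |⌊φ f x / Δ⌋ - u| ≤ 3 ∧ |⌊deriv (φ f) x / s⌋ - v| ≤ 3 := by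
  simp [cellG]

theorem floor_close (y z Δ : ℝ) (hΔ : 0 < Δ) (u : ℤ) (hy : |⌊y / Δ⌋ - u| ≤ 3) (hz : |⌊z / Δ⌋ - u| ≤ 3) :
    |y - z| ≤ 7 * Δ := by
  rw [abs_le] at hy hz
  have h1 : ⌊y / Δ⌋ - ⌊z / Δ⌋ ≤ 6 := by omega
  have h2 : -6 ≤ ⌊y / Δ⌋ - ⌊z / Δ⌋ := by omega
  have h1' : ((⌊y / Δ⌋ : ℤ) : ℝ) - (⌊z / Δ⌋ : ℤ) ≤ 6 := by exact_mod_cast h1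
  have h2' : (-6:ℝ) ≤ ((⌊y / Δ⌋ : ℤ) : ℝ) - (⌊z / Δ⌋ : ℤ) := by exact_mod_cast h2
  have a1 := Int.floor_le (y / Δ)
  have a2 := Int.lt_floor_add_one (y / Δ)
  have a3 := Int.floor_le (z / Δ)
  have a4 := Int.lt_floor_add_one (z / Δ)
  have b1 : y / Δ - z / Δ ≤ 7 := by linarith
  have b2 : -7 ≤ y / Δ - z / Δ := by linarith
  rw [← sub_div] at b1 b2
  rw [div_le_iff₀ hΔ] at b1
  rw [le_div_iff₀ hΔ] at b2
  rw [abs_le]; constructor <;> linarith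

theorem Cin.class_bound {γ : Type*} [Fintype γ] [DecidableEq γ] {φ : γ → ℝ → ℝ} {d : γ → γ → ℝ}
    {a b K : ℝ} (C : Cin φ d a b K) (t s : ℝ) (ht : 0 < t) (hs : 0 < s) (hst : s ≤ t / (1000 * K))
    (L : ℕ) (hL : 1 ≤ L) (M0 : ℕ) (hM0 : 400 * K ≤ M0)
    (R : Finset (ℕ × ℤ × ℤ)) (hk : ∀ x ∈ R, x.1 < 2 ^ L) (hkb : ∀ x ∈ R, a + x.1 * (s / (4 * t)) ≤ b)
    (hres : ∀ x ∈ R, ∀ y ∈ R, x.1 % M0 = y.1 % M0 ∧ x.2.1 % 7 = y.2.1 % 7 ∧ x.2.2 % 7 = y.2.2 % 7)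
    (n n' : ℕ) [NeZero n] [NeZero n']
    (hn : ∀ x ∈ R, n ≤ (cellG φ (a + x.1 * (s / (4 * t))) (s ^ 2 / t) s x.2.1 x.2.2).card)
    (hn' : ∀ x ∈ R, ∀ f ∈ cellG φ (a + x.1 * (s / (4 * t))) (s ^ 2 / t) s x.2.1 x.2.2,
      n' ≤ ((cellG φ (a + x.1 * (s / (4 * t))) (s ^ 2 / t) s x.2.1 x.2.2).filter
        (fun g => t / 4 < d f g)).card) :
    (R.card : ℝ) ≤ 80 * (L:ℝ) ^ 2 * ((Fintype.card γ / n) * Real.sqrt (Fintype.card γ / n') +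
      (Fintype.card γ / n') * Real.sqrt (Fintype.card γ / n)) := by
  classical
  obtain ⟨ℓ, hℓ⟩ : ∃ ℓ, ℓ = s / (4 * t) := ⟨_, rfl⟩
  rw [← hℓ] at hkb hn hn'
  have hℓpos : 0 < ℓ := by rw [hℓ]; positivity
  have hΔpos : 0 < s ^ 2 / t := by positivity
  have hKpos : 0 < K := by linarith [C.hK]
  have hρℓ : 100 * K * s / t = 400 * K * ℓ := by rw [hℓ]; field_simp; ring
  have h := sampling R (fun x => cellG φ (a + x.1 * ℓ) (s ^ 2 / t) s x.2.1 x.2.2)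
    (fun x f => (cellG φ (a + x.1 * ℓ) (s ^ 2 / t) s x.2.1 x.2.2).filter (fun g => t / 4 < d f g))
    n n' hn hn' (20 * (L:ℝ) ^ 2) (by positivity) ?_
  · refine h.trans (le_of_eq (by ring))
  intro W B R' hR' hR
  rcases R'.eq_empty_or_nonempty with he | ⟨e0, he0⟩
  · rw [he]; simp; positivity
  have hne : Nonempty γ := by obtain ⟨f, _⟩ := hR e0 he0; exact ⟨f⟩
  have hex : ∀ x ∈ R', ∃ f g, f ∈ cellG φ (a + x.1 * ℓ) (s ^ 2 / t) s x.2.1 x.2.2 ∧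
      g ∈ cellG φ (a + x.1 * ℓ) (s ^ 2 / t) s x.2.1 x.2.2 ∧ f ∈ W ∧ g ∈ B ∧ t / 4 < d f g := by
    intro x hx
    obtain ⟨f, hf, hfW, g, hg, hgB⟩ := hR x hx
    rw [Finset.mem_filter] at hg
    exact ⟨f, g, hf, hg.1, hfW, hgB, hg.2⟩
  choose! fe ge hfg using hex
  obtain ⟨X, hXd⟩ : ∃ X : ℕ → ℝ, ∀ k, X k = a + k * ℓ := ⟨_, fun _ => rfl⟩
  have hXmono : StrictMono X := by
    intro k k' hkk
    rw [hXd, hXd]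
    have : (k:ℝ) < k' := by exact_mod_cast hkk
    nlinarith
  have hXJ : ∀ x ∈ R', X x.1 ∈ Set.Icc a b := by
    intro x hx
    rw [hXd]
    exact ⟨by have : 0 ≤ (x.1:ℝ) * ℓ := by positivity
              linarith, hkb x (hR' hx)⟩
  have hsep : ∀ x ∈ R', ∀ y ∈ R', x ≠ y →
      (∃ f, f ∈ cellG φ (a + x.1 * ℓ) (s ^ 2 / t) s x.2.1 x.2.2 ∧
        f ∈ cellG φ (a + y.1 * ℓ) (s ^ 2 / t) s y.2.1 y.2.2) →
      100 * K * s / t ≤ |X x.1 - X y.1| := by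
    intro x hx y hy hxy ⟨f, hf, hf'⟩
    rw [mem_cellG] at hf hf'
    obtain ⟨r1, r2, r3⟩ := hres x (hR' hx) y (hR' hy)
    have hk1 : x.1 ≠ y.1 := by
      intro hke
      rw [hke] at hf
      have u1 := hf.1
      have u2 := hf.2
      have u3 := hf'.1
      have u4 := hf'.2
      rw [abs_le] at u1 u2 u3 u4
      apply hxy
      refine Prod.ext hke (Prod.ext ?_ ?_)
      · omega
      · omega
    have hMle : (M0:ℝ) ≤ |(x.1:ℝ) - y.1| := by
      have h1 : (M0:ℤ) ∣ (x.1:ℤ) - y.1 := by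
        have : (y.1:ℤ) ≡ x.1 [ZMOD M0] := by
          rw [Int.natCast_modEq_iff]; exact r1.symm
        exact this.dvd
      have h2 : (x.1:ℤ) - y.1 ≠ 0 := by
        intro h; apply hk1; omega
      have h3 := Int.le_of_dvd (abs_pos.2 h2) ((dvd_abs _ _).2 h1)
      exact_mod_cast h3
    rw [hρℓ, hXd, hXd]
    have : a + (x.1:ℝ) * ℓ - (a + y.1 * ℓ) = ((x.1:ℝ) - y.1) * ℓ := by ring
    rw [this, abs_mul, abs_of_pos hℓpos]
    gcongr
    exact hM0.trans hMle
  have hρ : 0 < 100 * K * s / t := by positivity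
  have hlens : ∀ x ∈ R', Lens φ a b (s ^ 2 / t) (100 * K * s / t) (fe x) (ge x) (X x.1) ∨
      Lens φ a b (s ^ 2 / t) (100 * K * s / t) (ge x) (fe x) (X x.1) := by
    intro x hx
    obtain ⟨h1, h2, _, _, h5⟩ := hfg x hx
    rw [mem_cellG] at h1 h2
    refine C.lens _ _ t s ht hs hst h5 _ (hXJ x hx) ?_ ?_
    · rw [hXd]; exact floor_close _ _ _ hΔpos _ h1.1 h2.1
    · rw [hXd]; exact floor_close _ _ _ hs _ h1.2 h2.2
  have e1 := C.edge_bound (R'.filter (fun x => Lens φ a b (s ^ 2 / t) (100 * K * s / t) (fe x) (ge x) (X x.1)))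
    fe ge (fun x => x.1) X hXmono (s ^ 2 / t) (100 * K * s / t) hρ W B L hL
    (fun x hx => (hfg x (Finset.mem_filter.1 hx).1).2.2.1)
    (fun x hx => (hfg x (Finset.mem_filter.1 hx).1).2.2.2.1)
    (fun x hx => hk x (hR' (Finset.mem_filter.1 hx).1))
    (fun x hx => hXJ x (Finset.mem_filter.1 hx).1)
    (fun x hx => (Finset.mem_filter.1 hx).2) ?_
  · have e2 := C.edge_bound (R'.filter (fun x => ¬ Lens φ a b (s ^ 2 / t) (100 * K * s / t) (fe x) (ge x) (X x.1)))
      ge fe (fun x => x.1) X hXmono (s ^ 2 / t) (100 * K * s / t) hρ B W L hL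
      (fun x hx => (hfg x (Finset.mem_filter.1 hx).1).2.2.2.1)
      (fun x hx => (hfg x (Finset.mem_filter.1 hx).1).2.2.1)
      (fun x hx => hk x (hR' (Finset.mem_filter.1 hx).1))
      (fun x hx => hXJ x (Finset.mem_filter.1 hx).1)
      (fun x hx => (hlens x (Finset.mem_filter.1 hx).1).resolve_left (Finset.mem_filter.1 hx).2) ?_
    · have e3 := Finset.card_filter_add_card_filter_not (s := R')
        (fun x => Lens φ a b (s ^ 2 / t) (100 * K * s / t) (fe x) (ge x) (X x.1))
      have e4 : ((R'.filter (fun x => Lens φ a b (s ^ 2 / t) (100 * K * s / t) (fe x) (ge x) (X x.1))).card : ℝ) +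
        (R'.filter (fun x => ¬ Lens φ a b (s ^ 2 / t) (100 * K * s / t) (fe x) (ge x) (X x.1))).card = R'.card := by
        exact_mod_cast e3
      rw [← e4]
      linarith
    · intro x hx y hy hxy hor
      have hx' := (Finset.mem_filter.1 hx).1
      have hy' := (Finset.mem_filter.1 hy).1
      refine hsep x hx' y hy' hxy ?_
      rcases hor with h | h
      · exact ⟨ge x, (hfg x hx').2.1, h ▸ (hfg y hy').2.1⟩
      · exact ⟨fe x, (hfg x hx').1, h ▸ (hfg y hy').1⟩
  · intro x hx y hy hxy hor
    have hx' := (Finset.mem_filter.1 hx).1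
    have hy' := (Finset.mem_filter.1 hy).1
    refine hsep x hx' y hy' hxy ?_
    rcases hor with h | h
    · exact ⟨fe x, (hfg x hx').1, h ▸ (hfg y hy').1⟩
    · exact ⟨ge x, (hfg x hx').2.1, h ▸ (hfg y hy').2.1⟩

end PartC2

section PartC3

theorem cell_mult {γ : Type*} [Fintype γ] [DecidableEq γ] (φ : γ → ℝ → ℝ) (X : ℕ → ℝ) (Δ s : ℝ)
    (R : Finset (ℕ × ℤ × ℤ)) (m : ℕ) (hm : ∀ x ∈ R, x.1 < m) :
    ∑ x ∈ R, ((cellG φ (X x.1) Δ s x.2.1 x.2.2).card : ℝ) ≤ 49 * m * Fintype.card γ := by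
  classical
  have h1 : ∀ x : ℕ × ℤ × ℤ, ((cellG φ (X x.1) Δ s x.2.1 x.2.2).card : ℝ) =
      ∑ f : γ, if f ∈ cellG φ (X x.1) Δ s x.2.1 x.2.2 then (1:ℝ) else 0 := by
    intro x; simp
  simp_rw [h1]
  rw [Finset.sum_comm]
  have h2 : ∀ f : γ, ∑ x ∈ R, (if f ∈ cellG φ (X x.1) Δ s x.2.1 x.2.2 then (1:ℝ) else 0) ≤ 49 * m := by
    intro f
    rw [Finset.sum_boole]
    have : (R.filter (fun x => f ∈ cellG φ (X x.1) Δ s x.2.1 x.2.2)).card ≤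
        (Finset.range m ×ˢ Finset.Icc (-3:ℤ) 3 ×ˢ Finset.Icc (-3:ℤ) 3).card := by
      refine Finset.card_le_card_of_injOn (fun x => (x.1, ⌊φ f (X x.1) / Δ⌋ - x.2.1,
        ⌊deriv (φ f) (X x.1) / s⌋ - x.2.2)) ?_ ?_
      · intro x hx
        have hx := Finset.mem_filter.1 (Finset.mem_coe.1 hx)
        have h3 := (mem_cellG _ _ _ _ _ _ _).1 hx.2
        rw [abs_le, abs_le] at h3
        simp only [Finset.coe_product, Set.mem_prod, Finset.mem_coe, Finset.mem_range, Finset.mem_Icc]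
        exact ⟨hm x hx.1, ⟨by omega, by omega⟩, ⟨by omega, by omega⟩⟩
      · intro x _ y _ hxy
        simp only [Prod.mk.injEq] at hxy
        obtain ⟨e1, e2, e3⟩ := hxy
        rw [e1] at e2 e3
        exact Prod.ext e1 (Prod.ext (by omega) (by omega))
    rw [Finset.card_product, Finset.card_product, Finset.card_range] at this
    simp only [Int.card_Icc] at this
    norm_num at this
    have h' : ((R.filter (fun x => f ∈ cellG φ (X x.1) Δ s x.2.1 x.2.2)).card : ℝ) ≤ m * 49 := by
      exact_mod_cast this
    linarith
  calc _ ≤ ∑ f : γ, 49 * (m:ℝ) := Finset.sum_le_sum fun f _ => h2 f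
    _ = _ := by simp; ring

theorem star_alg (N n n' c L : ℝ) (hN : 0 ≤ N) (hn' : 0 < n') (hnn : n' ≤ n)
    (hc : c ≤ 80 * L ^ 2 * ((N / n) * Real.sqrt (N / n') + (N / n') * Real.sqrt (N / n))) :
    c * (4 * (Real.sqrt n * n')) ≤ 640 * L ^ 2 * (N * Real.sqrt N) := by
  have hn : 0 < n := lt_of_lt_of_le hn' hnn
  obtain ⟨p, hp, hpn⟩ : ∃ p, 0 < p ∧ p ^ 2 = n := ⟨Real.sqrt n, Real.sqrt_pos.2 hn, Real.sq_sqrt hn.le⟩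
  obtain ⟨q, hq, hqn⟩ : ∃ q, 0 < q ∧ q ^ 2 = n' :=
    ⟨Real.sqrt n', Real.sqrt_pos.2 hn', Real.sq_sqrt hn'.le⟩
  have hqp : q ≤ p := by
    refine (abs_le_of_sq_le_sq' ?_ hp.le).2
    rw [hpn, hqn]; exact hnn
  rw [Real.sqrt_div hN, Real.sqrt_div hN, ← hpn, ← hqn, Real.sqrt_sq hp.le, Real.sqrt_sq hq.le] at hc
  rw [← hpn, ← hqn, Real.sqrt_sq hp.le]
  have hsq : 0 ≤ Real.sqrt N := Real.sqrt_nonneg _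
  calc c * (4 * (p * q ^ 2)) ≤ 80 * L ^ 2 * (N / p ^ 2 * (Real.sqrt N / q) + N / q ^ 2 * (Real.sqrt N / p)) *
        (4 * (p * q ^ 2)) := by gcongr
    _ = 320 * L ^ 2 * (N * Real.sqrt N) * (q / p + 1) := by field_simp; ring
    _ ≤ 320 * L ^ 2 * (N * Real.sqrt N) * (1 + 1) := by
        gcongr
        rwa [div_le_one hp]
    _ = _ := by ring

set_option maxHeartbeats 800000 in
theorem Cin.star {γ : Type*} [Fintype γ] [DecidableEq γ] {φ : γ → ℝ → ℝ} {d : γ → γ → ℝ}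
    {a b K : ℝ} (C : Cin φ d a b K) (t s : ℝ) (ht : 0 < t) (hs : 0 < s)
    (L : ℕ) (hL : 1 ≤ L) (hN : Fintype.card γ ≤ 2 ^ L)
    (R : Finset (ℕ × ℤ × ℤ)) (hk : ∀ x ∈ R, x.1 < 2 ^ L) (hkb : ∀ x ∈ R, a + x.1 * (s / (4 * t)) ≤ b)
    (nf : ℕ × ℤ × ℤ → ℕ)
    (hnf : ∀ x ∈ R, ∀ f ∈ cellG φ (a + x.1 * (s / (4 * t))) (s ^ 2 / t) s x.2.1 x.2.2,
      nf x ≤ ((cellG φ (a + x.1 * (s / (4 * t))) (s ^ 2 / t) s x.2.1 x.2.2).filter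
        (fun g => t / 4 < d f g)).card) :
    ∑ x ∈ R, Real.sqrt ((cellG φ (a + x.1 * (s / (4 * t))) (s ^ 2 / t) s x.2.1 x.2.2).card : ℝ) * nf x
      ≤ 10 ^ 8 * K * (L:ℝ) ^ 4 * (Fintype.card γ * Real.sqrt (Fintype.card γ)) := by
  classical
  have hK := C.hK
  have hKpos : 0 < K := by linarith
  have hL1 : (1:ℝ) ≤ L := by exact_mod_cast hL
  obtain ⟨G, hG⟩ : ∃ G : ℕ × ℤ × ℤ → Finset γ,
    ∀ x, G x = cellG φ (a + x.1 * (s / (4 * t))) (s ^ 2 / t) s x.2.1 x.2.2 := ⟨_, fun _ => rfl⟩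
  simp_rw [← hG] at hnf ⊢
  have hnfle : ∀ x ∈ R, 0 < (G x).card → nf x ≤ (G x).card := by
    intro x hx hpos
    obtain ⟨f, hf⟩ := Finset.card_pos.1 hpos
    exact (hnf x hx f hf).trans (Finset.card_le_card (Finset.filter_subset _ _))
  have hGN : ∀ x, (G x).card ≤ Fintype.card γ := fun x => Finset.card_le_univ _
  by_cases hst : s ≤ t / (1000 * K)
  · -- main case
    obtain ⟨M0, hM0⟩ : ∃ M0 : ℕ, M0 = ⌈400 * K⌉₊ := ⟨_, rfl⟩
    have hM1 : 400 * K ≤ M0 := by rw [hM0]; exact Nat.le_ceil _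
    have hM2 : (M0:ℝ) ≤ 401 * K := by
      have := Nat.ceil_lt_add_one (show 0 ≤ 400 * K by positivity)
      rw [← hM0] at this; linarith
    have hM0pos : 0 < M0 := by
      have : (0:ℝ) < M0 := by linarith
      exact_mod_cast this
    let key : ℕ × ℤ × ℤ → ℕ × ℕ × ℕ × ℕ × ℕ := fun x =>
      (x.1 % M0, (x.2.1 % 7).toNat, (x.2.2 % 7).toNat, Nat.log 2 (G x).card, Nat.log 2 (nf x))
    let R' := R.filter (fun x => 0 < (G x).card ∧ 0 < nf x)
    let T := Finset.range M0 ×ˢ Finset.range 7 ×ˢ Finset.range 7 ×ˢ Finset.range (L + 1) ×ˢ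
      Finset.range (L + 1)
    have hR'sum : ∑ x ∈ R, Real.sqrt ((G x).card : ℝ) * nf x =
        ∑ x ∈ R', Real.sqrt ((G x).card : ℝ) * nf x := by
      symm
      refine Finset.sum_subset (Finset.filter_subset _ _) ?_
      intro x hx hx'
      have : ¬ (0 < (G x).card ∧ 0 < nf x) := fun h => hx' (Finset.mem_filter.2 ⟨hx, h⟩)
      rw [not_and_or, not_lt, not_lt] at this
      rcases this with h | h
      · have : (G x).card = 0 := by omega
        rw [this]; simp
      · have : nf x = 0 := by omega
        rw [this]; simp
    have hmaps : ∀ x ∈ R', key x ∈ T := by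
      intro x hx
      have hx := Finset.mem_filter.1 hx
      have hlog : ∀ k, k ≤ Fintype.card γ → Nat.log 2 k < L + 1 := by
        intro k hkN
        have : Nat.log 2 k ≤ Nat.log 2 (2 ^ L) := Nat.log_mono_right (hkN.trans hN)
        rw [Nat.log_pow (by norm_num)] at this
        omega
      simp only [T, key, Finset.mem_product, Finset.mem_range]
      refine ⟨Nat.mod_lt _ hM0pos, by omega, by omega, hlog _ (hGN x), hlog _ ?_⟩
      exact (hnfle x hx.1 hx.2.1).trans (hGN x)
    rw [hR'sum, ← Finset.sum_fiberwise_of_maps_to hmaps]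
    have hclass : ∀ κ ∈ T, ∑ x ∈ R' with key x = κ, Real.sqrt ((G x).card : ℝ) * nf x ≤
        640 * (L:ℝ) ^ 2 * (Fintype.card γ * Real.sqrt (Fintype.card γ)) := by
      intro κ _
      rcases (R'.filter (fun x => key x = κ)).eq_empty_or_nonempty with he | ⟨x0, hx0⟩
      · rw [he, Finset.sum_empty]; positivity
      have hmem : ∀ x ∈ R'.filter (fun x => key x = κ), x ∈ R ∧ 0 < (G x).card ∧ 0 < nf x ∧ key x = κ := by
        intro x hx
        have h1 := Finset.mem_filter.1 hx
        have h2 := Finset.mem_filter.1 h1.1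
        exact ⟨h2.1, h2.2.1, h2.2.2, h1.2⟩
      have hk1 : ∀ x ∈ R'.filter (fun x => key x = κ), Nat.log 2 (G x).card = κ.2.2.2.1 := by
        intro x hx; rw [← (hmem x hx).2.2.2]
      have hk2 : ∀ x ∈ R'.filter (fun x => key x = κ), Nat.log 2 (nf x) = κ.2.2.2.2 := by
        intro x hx; rw [← (hmem x hx).2.2.2]
      obtain ⟨e1, he1⟩ : ∃ e1, e1 = κ.2.2.2.1 := ⟨_, rfl⟩
      obtain ⟨e2, he2⟩ : ∃ e2, e2 = κ.2.2.2.2 := ⟨_, rfl⟩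
      have hNZ1 : NeZero (2 ^ e1) := ⟨by positivity⟩
      have hNZ2 : NeZero (2 ^ e2) := ⟨by positivity⟩
      have b1 : ∀ x ∈ R'.filter (fun x => key x = κ), 2 ^ e1 ≤ (G x).card ∧ (G x).card ≤ 2 ^ (e1 + 1) := by
        intro x hx
        rw [he1, ← hk1 x hx]
        exact ⟨Nat.pow_log_le_self 2 (hmem x hx).2.1.ne', (Nat.lt_pow_succ_log_self (by norm_num) _).le⟩
      have b2 : ∀ x ∈ R'.filter (fun x => key x = κ), 2 ^ e2 ≤ nf x ∧ nf x ≤ 2 ^ (e2 + 1) := by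
        intro x hx
        rw [he2, ← hk2 x hx]
        exact ⟨Nat.pow_log_le_self 2 (hmem x hx).2.2.1.ne', (Nat.lt_pow_succ_log_self (by norm_num) _).le⟩
      have hcb := C.class_bound t s ht hs hst L hL M0 hM1 (R'.filter (fun x => key x = κ))
        (fun x hx => hk x (hmem x hx).1) (fun x hx => hkb x (hmem x hx).1) ?_ (2 ^ e1) (2 ^ e2)
        (fun x hx => by rw [← hG]; exact (b1 x hx).1)
        (fun x hx f hf => by
          rw [← hG] at hf ⊢
          exact (b2 x hx).1.trans (hnf x (hmem x hx).1 f hf))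
      · have hee : e2 ≤ e1 := by
          rw [he1, he2, ← hk1 x0 hx0, ← hk2 x0 hx0]
          exact Nat.log_mono_right (hnfle x0 (hmem x0 hx0).1 (hmem x0 hx0).2.1)
        push_cast at hcb
        have := star_alg (Fintype.card γ) (2 ^ e1) (2 ^ e2) _ L (Nat.cast_nonneg _) (by positivity)
          (pow_le_pow_right₀ (by norm_num) hee) hcb
        refine le_trans ?_ this
        rw [← nsmul_eq_mul, ← Finset.sum_const]
        refine Finset.sum_le_sum fun x hx => ?_
        have c1 : ((G x).card : ℝ) ≤ 2 ^ e1 * 2 ^ 2 := by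
          have : ((G x).card : ℝ) ≤ 2 ^ (e1 + 1) := by exact_mod_cast (b1 x hx).2
          have h0 : (0:ℝ) < 2 ^ e1 := by positivity
          rw [pow_succ] at this; linarith
        have c2 : (nf x : ℝ) ≤ 2 ^ e2 * 2 := by
          have : (nf x : ℝ) ≤ 2 ^ (e2 + 1) := by exact_mod_cast (b2 x hx).2
          rwa [pow_succ] at this
        have c3 : Real.sqrt ((G x).card : ℝ) ≤ Real.sqrt (2 ^ e1) * 2 := by
          refine (Real.sqrt_le_sqrt c1).trans ?_
          rw [Real.sqrt_mul (by positivity), Real.sqrt_sq (by norm_num)]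
        calc Real.sqrt ((G x).card : ℝ) * nf x ≤ (Real.sqrt (2 ^ e1) * 2) * (2 ^ e2 * 2) := by gcongr
          _ = _ := by ring
      · intro x hx y hy
        have h1 : key x = key y := by rw [(hmem x hx).2.2.2, (hmem y hy).2.2.2]
        simp only [key, Prod.mk.injEq] at h1
        refine ⟨h1.1, by omega, by omega⟩
    refine (Finset.sum_le_sum hclass).trans ?_
    rw [Finset.sum_const, nsmul_eq_mul]
    have hT : (T.card : ℝ) ≤ 401 * K * (49 * (2 * (L:ℝ)) ^ 2) := by
      have : T.card = M0 * (7 * (7 * ((L + 1) * (L + 1)))) := by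
        simp only [T, Finset.card_product, Finset.card_range]
      rw [this]; push_cast
      calc (M0:ℝ) * (7 * (7 * (((L:ℝ) + 1) * (L + 1)))) = M0 * (49 * ((L:ℝ) + 1) ^ 2) := by ring
        _ ≤ 401 * K * (49 * (2 * (L:ℝ)) ^ 2) := by gcongr; linarith
    calc (T.card : ℝ) * (640 * (L:ℝ) ^ 2 * (Fintype.card γ * Real.sqrt (Fintype.card γ)))
        ≤ 401 * K * (49 * (2 * (L:ℝ)) ^ 2) * (640 * (L:ℝ) ^ 2 * (Fintype.card γ * Real.sqrt (Fintype.card γ))) := by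
          gcongr
      _ = (401 * 49 * 4 * 640) * K * (L:ℝ) ^ 4 * (Fintype.card γ * Real.sqrt (Fintype.card γ)) := by ring
      _ ≤ _ := by gcongr; norm_num
  · push Not at hst
    have hst' : t < s * (1000 * K) := by rwa [div_lt_iff₀ (by positivity)] at hst
    obtain ⟨m, hm⟩ : ∃ m : ℕ, m = ⌈4000 * K⌉₊ + 1 := ⟨_, rfl⟩
    have hm2 : (m:ℝ) ≤ 4002 * K := by
      have := Nat.ceil_lt_add_one (show 0 ≤ 4000 * K by positivity)
      rw [hm]; push_cast; linarith
    have hmk : ∀ x ∈ R, x.1 < m := by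
      intro x hx
      have h1 := hkb x hx
      have h2 : b - a ≤ 1 := C.hlen.trans (by rw [div_le_one (by positivity)]; linarith)
      have h3 : (x.1:ℝ) * (s / (4 * t)) ≤ 1 := by linarith
      rw [mul_div_assoc', div_le_one (by positivity)] at h3
      have h4 : (x.1:ℝ) ≤ 4000 * K := by
        by_contra hcon
        push Not at hcon
        have : 4000 * K * s < x.1 * s := by gcongr
        linarith
      have h5 : (x.1:ℝ) ≤ (⌈4000 * K⌉₊ : ℕ) := h4.trans (Nat.le_ceil _)
      have h6 : x.1 ≤ ⌈4000 * K⌉₊ := by exact_mod_cast h5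
      omega
    have hmult := cell_mult φ (fun k => a + k * (s / (4 * t))) (s ^ 2 / t) s R m hmk
    simp_rw [← hG] at hmult
    calc ∑ x ∈ R, Real.sqrt ((G x).card : ℝ) * nf x
        ≤ ∑ x ∈ R, Real.sqrt (Fintype.card γ) * (G x).card := by
          refine Finset.sum_le_sum fun x hx => ?_
          rcases Nat.eq_zero_or_pos (G x).card with h0 | h0
          · rw [h0]; simp
          · have h1 : (nf x : ℝ) ≤ (G x).card := by exact_mod_cast hnfle x hx h0
            have h2 : ((G x).card : ℝ) ≤ Fintype.card γ := by exact_mod_cast hGN x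
            gcongr
      _ = Real.sqrt (Fintype.card γ) * ∑ x ∈ R, ((G x).card : ℝ) := by rw [Finset.mul_sum]
      _ ≤ Real.sqrt (Fintype.card γ) * (49 * (4002 * K) * Fintype.card γ) := by
          gcongr
          exact hmult.trans (by gcongr)
      _ = (49 * 4002) * K * 1 * (Fintype.card γ * Real.sqrt (Fintype.card γ)) := by ring
      _ ≤ _ := by
          gcongr
          · norm_num
          · exact one_le_pow₀ hL1

end PartC3


theorem strip_bound (A Y : Set ℝ) (E : Set (ℝ × ℝ)) (hEA : ∀ p ∈ E, p.1 ∈ A)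
    (f : ℝ → ℝ) (hf : Continuous f) (δ : ℝ) (X : Set (ℝ × ℝ)) (hX : MeasurableSet X)
    (hX1 : ∀ p ∈ X, p.1 ∈ Y ∧ |f p.1 - p.2| ≤ δ) (c : ℝ) (hδ : 0 < δ)
    (hc : volume (A ∩ Y) ≤ ENNReal.ofReal c) :
    (volume.restrict E) X ≤ ENNReal.ofReal (2 * δ * c) := by
  rw [Measure.restrict_apply hX]
  set Y' := toMeasurable volume (A ∩ Y) with hY'
  have hY'm : MeasurableSet Y' := measurableSet_toMeasurable _ _
  set T : Set (ℝ × ℝ) := {p | p.1 ∈ Y' ∧ |f p.1 - p.2| ≤ δ} with hT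
  have hTm : MeasurableSet T := by
    apply MeasurableSet.inter (measurable_fst hY'm)
    have : Measurable (fun p : ℝ × ℝ => |f p.1 - p.2|) := by
      have := hf.measurable
      have : Continuous (fun p : ℝ × ℝ => |f p.1 - p.2|) := by fun_prop
      exact this.measurable
    exact measurableSet_le this measurable_const
  have hsub : X ∩ E ⊆ T := by
    rintro p ⟨h1, h2⟩
    exact ⟨subset_toMeasurable _ _ ⟨hEA p h2, (hX1 p h1).1⟩, (hX1 p h1).2⟩
  calc volume (X ∩ E) ≤ volume T := measure_mono hsub
    _ = ∫⁻ x, volume (Prod.mk x ⁻¹' T) := by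
        rw [Measure.volume_eq_prod, Measure.prod_apply hTm]
    _ ≤ ∫⁻ x, Y'.indicator (fun _ => ENNReal.ofReal (2 * δ)) x := by
        apply lintegral_mono
        intro x
        by_cases hx : x ∈ Y'
        · simp only [hx, indicator_of_mem]
          have : Prod.mk x ⁻¹' T ⊆ Set.Icc (f x - δ) (f x + δ) := by
            intro y hy
            have := hy.2
            rw [abs_le] at this
            simp only at this
            constructor <;> linarith
          refine (measure_mono this).trans ?_
          rw [Real.volume_Icc]
          apply ENNReal.ofReal_le_ofReal
          linarith
        · have : Prod.mk x ⁻¹' T = ∅ := by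
            ext y; simp [hT, hx]
          simp [this]
    _ = ENNReal.ofReal (2 * δ) * volume Y' := by
        rw [lintegral_indicator_const hY'm]
    _ ≤ ENNReal.ofReal (2 * δ) * ENNReal.ofReal c := by
        rw [hY', measure_toMeasurable]
        gcongr
    _ = _ := by rw [← ENNReal.ofReal_mul (by linarith)]

theorem lint_sum_bound {Ω ι : Type*} [MeasurableSpace Ω] (μ : Measure Ω) (T : Finset ι) (S : ι → Ω → ℝ)
    (z : ι → ℝ) (hz : ∀ i ∈ T, 0 ≤ z i)
    (h : ∀ i ∈ T, Measurable (S i) ∧ (∀ p, 0 ≤ S i p) ∧ ∫⁻ p, ENNReal.ofReal (S i p) ∂μ ≤ ENNReal.ofReal (z i)) :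
    Measurable (fun p => ∑ i ∈ T, S i p) ∧ (∀ p, 0 ≤ ∑ i ∈ T, S i p) ∧
    ∫⁻ p, ENNReal.ofReal (∑ i ∈ T, S i p) ∂μ ≤ ENNReal.ofReal (∑ i ∈ T, z i) := by
  refine ⟨Finset.measurable_sum _ (fun i hi => (h i hi).1), fun p => Finset.sum_nonneg (fun i hi => (h i hi).2.1 p), ?_⟩
  calc ∫⁻ p, ENNReal.ofReal (∑ i ∈ T, S i p) ∂μ = ∫⁻ p, ∑ i ∈ T, ENNReal.ofReal (S i p) ∂μ := by
        congr 1; ext p; exact ENNReal.ofReal_sum_of_nonneg (fun i hi => (h i hi).2.1 p)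
    _ = ∑ i ∈ T, ∫⁻ p, ENNReal.ofReal (S i p) ∂μ :=
        lintegral_finsetSum' _ (fun i hi => (h i hi).1.ennreal_ofReal.aemeasurable)
    _ ≤ ∑ i ∈ T, ENNReal.ofReal (z i) := Finset.sum_le_sum (fun i hi => (h i hi).2.2)
    _ = _ := (ENNReal.ofReal_sum_of_nonneg hz).symm

theorem lint_ind_bound {Ω : Type*} [MeasurableSpace Ω] (μ : Measure Ω) (X : Set Ω) (hX : MeasurableSet X)
    (c z : ℝ) (hc : 0 ≤ c) (h : μ X ≤ ENNReal.ofReal z) :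
    Measurable (X.indicator (fun _ => c)) ∧ (∀ p, 0 ≤ X.indicator (fun _ => c) p) ∧
    ∫⁻ p, ENNReal.ofReal (X.indicator (fun _ => c) p) ∂μ ≤ ENNReal.ofReal (c * z) := by
  refine ⟨measurable_const.indicator hX, fun p => indicator_nonneg (fun _ _ => hc) p, ?_⟩
  have : ∀ p, ENNReal.ofReal (X.indicator (fun _ => c) p) = X.indicator (fun _ => ENNReal.ofReal c) p := by
    intro p; by_cases hp : p ∈ X <;> simp [hp]
  simp_rw [this]
  rw [lintegral_indicator_const hX, ENNReal.ofReal_mul hc]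
  gcongr


/-- pairs at distance about `t` with slopes differing by about `s` at `θ` -/
def Cls {γ : Type*} (φ : γ → ℝ → ℝ) (d : γ → γ → ℝ) (t s δ : ℝ) (f g : γ) (θ : ℝ) : Prop :=
  t / 2 < d f g ∧ d f g ≤ t ∧ |deriv (φ f) θ - deriv (φ g) θ| ≤ s ∧
    (s / 2 < |deriv (φ f) θ - deriv (φ g) θ| ∨ s ^ 2 ≤ δ * t)

theorem Cin.tay {γ : Type*} {φ : γ → ℝ → ℝ} {d : γ → γ → ℝ} {a b K : ℝ} (C : Cin φ d a b K)
    (f g : γ) (t x y : ℝ) (hd : d f g ≤ t) (hx : x ∈ Set.Icc a b) (hy : y ∈ Set.Icc a b) :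
    |deriv (φ f) y - deriv (φ g) y - (deriv (φ f) x - deriv (φ g) x)| ≤ t * |y - x| ∧
    |(φ f y - φ g y) - (φ f x - φ g x) - (deriv (φ f) x - deriv (φ g) x) * (y - x)| ≤
      t * |y - x| ^ 2 / 2 := by
  obtain ⟨f0, f1, f2⟩ := smooth_facts _ (C.smooth f)
  obtain ⟨g0, g1, g2⟩ := smooth_facts _ (C.smooth g)
  have hb : ∀ z ∈ Set.Icc a b, |deriv (deriv (φ f)) z - deriv (deriv (φ g)) z| ≤ t := by
    intro z hz
    have := C.jet_le f g z hz
    have := abs_nonneg (φ f z - φ g z)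
    have := abs_nonneg (deriv (φ f) z - deriv (φ g) z)
    linarith
  constructor
  · exact mvt_bound (fun x => deriv (φ f) x - deriv (φ g) x) _ (fun x => (f1 x).sub (g1 x)) a b t hb y x hy hx
  · by_cases hne : y = x
    · subst hne; simp
    · obtain ⟨ξ, hξ, he⟩ := taylor2 (fun x => φ f x - φ g x) _ _ (fun x => (f0 x).sub (g0 x))
        (fun x => (f1 x).sub (g1 x)) a b x y hx hy hne
      rw [he]
      have e : φ f x - φ g x + (deriv (φ f) x - deriv (φ g) x) * (y - x) +
        (deriv (deriv (φ f)) ξ - deriv (deriv (φ g)) ξ) * (y - x) ^ 2 / 2 - (φ f x - φ g x) -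
        (deriv (φ f) x - deriv (φ g) x) * (y - x) =
        (deriv (deriv (φ f)) ξ - deriv (deriv (φ g)) ξ) * ((y - x) ^ 2 / 2) := by ring
      rw [e, abs_mul, abs_of_nonneg (by positivity : (0:ℝ) ≤ (y - x) ^ 2 / 2), sq_abs]
      have := mul_le_mul_of_nonneg_right (hb ξ hξ) (by positivity : (0:ℝ) ≤ (y - x) ^ 2 / 2)
      linarith

theorem Cin.spread {γ : Type*} {φ : γ → ℝ → ℝ} {d : γ → γ → ℝ} {a b K : ℝ} (C : Cin φ d a b K)
    (f g : γ) (t s δ x y : ℝ) (ht : 0 < t) (hs : 0 < s) (hδ : 0 < δ)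
    (hx : x ∈ Set.Icc a b) (hy : y ∈ Set.Icc a b)
    (hxy : |y - x| ≤ s / (4 * t)) (hc : Cls φ d t s δ f g x) (h1 : |φ f x - φ g x| ≤ 2 * δ)
    (h2 : |φ f y - φ g y| ≤ 2 * δ) : |y - x| ≤ 16 * δ / s := by
  obtain ⟨c1, c2, c3, c4 | c4⟩ := hc
  · have ⟨_, T⟩ := C.tay f g t x y c2 hx hy
    rw [le_div_iff₀ hs]
    rw [le_div_iff₀ (by positivity)] at hxy
    have k1 : |(deriv (φ f) x - deriv (φ g) x) * (y - x)| ≤ t * |y - x| ^ 2 / 2 + 4 * δ := by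
      rw [abs_le] at *
      constructor <;> linarith [T.1, T.2, h1.1, h1.2, h2.1, h2.2]
    rw [abs_mul] at k1
    have k2 := mul_le_mul_of_nonneg_right c4.le (abs_nonneg (y - x))
    have k3 := mul_le_mul_of_nonneg_right hxy (abs_nonneg (y - x))
    nlinarith [mul_nonneg hs.le (abs_nonneg (y-x))]
  · refine hxy.trans ?_
    rw [div_le_div_iff₀ (by positivity) hs]
    nlinarith

theorem floor_diff (y z Δ : ℝ) (hΔ : 0 < Δ) (h : |y - z| ≤ 3 * Δ) : |⌊y / Δ⌋ - ⌊z / Δ⌋| ≤ 3 := by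
  have a1 := Int.floor_le (y / Δ)
  have a2 := Int.lt_floor_add_one (y / Δ)
  have a3 := Int.floor_le (z / Δ)
  have a4 := Int.lt_floor_add_one (z / Δ)
  have e : |y / Δ - z / Δ| ≤ 3 := by
    rw [← sub_div, abs_div, abs_of_pos hΔ, div_le_iff₀ hΔ]; exact h
  rw [abs_le] at e
  rw [abs_le]
  constructor
  · have : (-4 : ℝ) < ((⌊y / Δ⌋ - ⌊z / Δ⌋ : ℤ) : ℝ) := by push_cast; linarith
    have : (-4 : ℤ) < ⌊y / Δ⌋ - ⌊z / Δ⌋ := by exact_mod_cast this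
    omega
  · have : ((⌊y / Δ⌋ - ⌊z / Δ⌋ : ℤ) : ℝ) < 4 := by push_cast; linarith
    have : ⌊y / Δ⌋ - ⌊z / Δ⌋ < 4 := by exact_mod_cast this
    omega

theorem Cin.share {γ : Type*} [Fintype γ] {φ : γ → ℝ → ℝ} {d : γ → γ → ℝ} {a b K : ℝ} (C : Cin φ d a b K)
    (f g : γ) (t s δ x y : ℝ) (ht : 0 < t) (hs : 0 < s) (hδs : δ * t ≤ s ^ 2)
    (hx : x ∈ Set.Icc a b) (hy : y ∈ Set.Icc a b)
    (hxy : |y - x| ≤ s / (4 * t)) (hc : Cls φ d t s δ f g x) (h1 : |φ f x - φ g x| ≤ 2 * δ) :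
    f ∈ cellG φ y (s ^ 2 / t) s ⌊φ f y / (s ^ 2 / t)⌋ ⌊deriv (φ f) y / s⌋ ∧
    g ∈ cellG φ y (s ^ 2 / t) s ⌊φ f y / (s ^ 2 / t)⌋ ⌊deriv (φ f) y / s⌋ := by
  obtain ⟨c1, c2, c3, _⟩ := hc
  obtain ⟨T1, T2⟩ := C.tay f g t x y c2 hx hy
  have hΔ : 0 < s ^ 2 / t := by positivity
  have hδΔ : δ ≤ s ^ 2 / t := by rw [le_div_iff₀ ht]; exact hδs
  rw [mem_cellG, mem_cellG]
  have e1 : t * |y - x| ≤ s / 4 := by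
    rw [le_div_iff₀ (by positivity)] at hxy
    linarith
  have e2 : t * |y - x| ^ 2 / 2 ≤ s ^ 2 / t / 32 := by
    rw [div_div, div_le_div_iff₀ (by positivity) (by positivity)]
    have := mul_self_le_mul_self (by positivity) e1
    nlinarith
  have e3 : |(deriv (φ f) x - deriv (φ g) x) * (y - x)| ≤ s ^ 2 / t / 4 := by
    rw [abs_mul]
    calc _ ≤ s * (s / (4 * t)) := mul_le_mul c3 hxy (abs_nonneg _) hs.le
      _ = _ := by field_simp
  refine ⟨⟨by simp, by simp⟩, floor_diff _ _ _ hΔ ?_, floor_diff _ _ _ hs ?_⟩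
  · rw [abs_sub_comm]
    rw [abs_le] at *
    constructor <;> linarith [T2.1, T2.2, e3.1, e3.2, h1.1, h1.2]
  · rw [abs_sub_comm]
    rw [abs_le] at *
    constructor <;> linarith [T1.1, T1.2, c3.1, c3.2]


theorem amgm_aux (π ν m l : ℝ) (hπ : 0 ≤ π) (hν : 0 ≤ ν) (hm : 0 ≤ m) (hl : 0 < l) (h : π ≤ 2 * m * ν) :
    π ≤ Real.sqrt m * (l * π + ν * (1 / (2 * l))) := by
  have h0 : 0 ≤ l * π + ν * (1 / (2 * l)) := by positivity
  have h1 : 2 * π * ν ≤ (l * π + ν * (1 / (2 * l))) ^ 2 := by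
    have e : (l * π) * (ν * (1 / (2 * l))) = π * ν / 2 := by field_simp
    nlinarith [sq_nonneg (l * π - ν * (1 / (2 * l)))]
  apply (sq_le_sq₀ hπ (mul_nonneg (Real.sqrt_nonneg m) h0)).1
  rw [mul_pow, Real.sq_sqrt hm]
  have := mul_le_mul_of_nonneg_left h1 hm
  have := mul_le_mul_of_nonneg_left h hπ
  nlinarith

theorem far_pairs {γ : Type*} [DecidableEq γ] (d : γ → γ → ℝ) (hsymm : ∀ f g, d f g = d g f)
    (htri : ∀ f g h, d f h ≤ d f g + d g h) (H : Finset γ) (f0 : γ) (t : ℝ) :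
    (((H ×ˢ H).filter (fun q => t / 2 < d q.1 q.2)).card : ℝ) ≤
      2 * H.card * (H.filter (fun g => t / 4 < d f0 g)).card := by
  classical
  have : (H ×ˢ H).filter (fun q => t / 2 < d q.1 q.2) ⊆
      (H ×ˢ (H.filter (fun g => t / 4 < d f0 g))) ∪ ((H.filter (fun g => t / 4 < d f0 g)) ×ˢ H) := by
    rintro ⟨f, g⟩ hq
    simp only [Finset.mem_filter, Finset.mem_product, Finset.mem_union] at hq ⊢
    obtain ⟨⟨h1, h2⟩, h3⟩ := hq
    by_cases h4 : t / 4 < d f0 g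
    · left; exact ⟨h1, h2, h4⟩
    · right
      refine ⟨⟨h1, ?_⟩, h2⟩
      have := htri f f0 g
      rw [hsymm f f0] at this
      linarith
  have h2 := (Finset.card_le_card this).trans (Finset.card_union_le _ _)
  rw [Finset.card_product, Finset.card_product] at h2
  have h3 : (((H ×ˢ H).filter (fun q => t / 2 < d q.1 q.2)).card : ℝ) ≤
    ((H.card * (H.filter (fun g => t / 4 < d f0 g)).card +
      (H.filter (fun g => t / 4 < d f0 g)).card * H.card : ℕ) : ℝ) := by exact_mod_cast h2
  push_cast at h3
  linarith

theorem sum_ind {Ω ι : Type*} (T : Finset ι) (X : ι → Set Ω) (c : ℝ) (p : Ω) [DecidablePred (fun i => p ∈ X i)] :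
    ∑ i ∈ T, (X i).indicator (fun _ => c) p = c * (T.filter (fun i => p ∈ X i)).card := by
  classical
  simp only [Set.indicator_apply]
  rw [Finset.card_filter]
  push_cast
  rw [Finset.mul_sum]
  apply Finset.sum_congr rfl
  intro i _
  by_cases h : p ∈ X i <;> simp [h]

/-- piece of the tube -/
def XN (φ : ℝ → ℝ) (x y δ : ℝ) : Set (ℝ × ℝ) := {p | p.1 ∈ Set.Icc x y ∧ |φ p.1 - p.2| ≤ δ}

theorem XN_meas (φ : ℝ → ℝ) (hφ : Continuous φ) (x y δ : ℝ) : MeasurableSet (XN φ x y δ) := by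
  apply MeasurableSet.inter (measurable_fst measurableSet_Icc)
  have : Continuous (fun p : ℝ × ℝ => |φ p.1 - p.2|) := by fun_prop
  exact measurableSet_le this.measurable measurable_const

/-- piece of intersection of two tubes -/
def XP {γ : Type*} (φ : γ → ℝ → ℝ) (d : γ → γ → ℝ) (t s δ x y : ℝ) (q : γ × γ) : Set (ℝ × ℝ) :=
  {p | p ∈ XN (φ q.1) x y δ ∧ p ∈ XN (φ q.2) x y δ ∧ Cls φ d t s δ q.1 q.2 p.1}

theorem XP_meas {γ : Type*} (φ : γ → ℝ → ℝ) (hφ : ∀ f, ContDiff ℝ 2 (φ f)) (d : γ → γ → ℝ) (t s δ x y : ℝ)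
    (q : γ × γ) : MeasurableSet (XP φ d t s δ x y q) := by
  have hc : ∀ f, Continuous (deriv (φ f)) := fun f =>
    continuous_iff_continuousAt.2 (fun x => ((smooth_facts _ (hφ f)).2.1 x).continuousAt)
  have hm : Measurable (fun p : ℝ × ℝ => |deriv (φ q.1) p.1 - deriv (φ q.2) p.1|) := by
    have h1 := hc q.1
    have h2 := hc q.2
    have : Continuous (fun p : ℝ × ℝ => |deriv (φ q.1) p.1 - deriv (φ q.2) p.1|) := by fun_prop
    exact this.measurable
  apply (XN_meas _ (hφ q.1).continuous x y δ).inter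
  apply (XN_meas _ (hφ q.2).continuous x y δ).inter
  apply (MeasurableSet.const (t / 2 < d q.1 q.2)).inter
  apply (MeasurableSet.const (d q.1 q.2 ≤ t)).inter
  apply (measurableSet_le hm measurable_const).inter
  exact (measurableSet_lt measurable_const hm).union (MeasurableSet.const _)

theorem Cin.XP_vol {γ : Type*} {φ : γ → ℝ → ℝ} {d : γ → γ → ℝ} {a b K : ℝ} (C : Cin φ d a b K)
    (ha : 0 ≤ a) (hb : b ≤ 1) (t s δ : ℝ) (ht : 0 < t) (hs : 0 < s) (hδ : 0 < δ) (A : Set ℝ)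
    (E : Set (ℝ × ℝ)) (hEA : ∀ p ∈ E, p.1 ∈ A) (P α : ℝ) (hP : 0 ≤ P) (hα : 0 < α)
    (hA : ∀ u v, u ≤ v → 0 ≤ u → v ≤ 1 → volume (A ∩ Set.Icc u v) ≤ ENNReal.ofReal (P * (v - u) ^ α))
    (x : ℝ) (hx : a ≤ x) (q : γ × γ) :
    (volume.restrict E) (XP φ d t s δ x (min (x + s / (4 * t)) b) q) ≤
      ENNReal.ofReal (2 * δ * (P * (32 * δ / s) ^ α)) := by
  set r := 16 * δ / s with hr
  have hrpos : 0 < r := by positivity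
  by_cases hne : (XP φ d t s δ x (min (x + s / (4 * t)) b) q).Nonempty
  swap
  · rw [Set.not_nonempty_iff_eq_empty] at hne
    rw [hne]; simp
  obtain ⟨p0, hp0⟩ := hne
  have hJ : ∀ p ∈ XP φ d t s δ x (min (x + s / (4 * t)) b) q, p.1 ∈ Set.Icc a b ∧ p.1 ≤ x + s / (4 * t) ∧ x ≤ p.1 ∧
      |φ q.1 p.1 - φ q.2 p.1| ≤ 2 * δ := by
    rintro p ⟨h1, h2, _⟩
    have h3 := h1.1.2
    rw [le_min_iff] at h3
    refine ⟨⟨hx.trans h1.1.1, h3.2⟩, h3.1, h1.1.1, ?_⟩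
    have h4 := h1.2
    have h5 := h2.2
    rw [abs_le] at *
    constructor <;> linarith [h4.1, h4.2, h5.1, h5.2]
  obtain ⟨j1, j2, j3, j4⟩ := hJ p0 hp0
  refine strip_bound A (Set.Icc (max a (p0.1 - r)) (min b (p0.1 + r))) E hEA (φ q.1) (C.smooth q.1).continuous δ _
    (XP_meas φ C.smooth d _ _ _ _ _ q) ?_ _ hδ ?_
  · intro p hp
    obtain ⟨i1, i2, i3, i4⟩ := hJ p hp
    refine ⟨?_, hp.1.2⟩
    have := C.spread q.1 q.2 t s δ p0.1 p.1 ht hs hδ j1 i1 (by rw [abs_le]; constructor <;> linarith) hp0.2.2 j4 i4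
    rw [abs_le] at this
    exact ⟨max_le i1.1 (by linarith), le_min i1.2 (by linarith)⟩
  · have e : max a (p0.1 - r) ≤ min b (p0.1 + r) :=
      max_le (le_min C.hab (by linarith [j1.1])) (le_min (by linarith [j1.2]) (by linarith))
    refine (hA _ _ e (ha.trans (le_max_left _ _)) ((min_le_left _ _).trans hb)).trans ?_
    apply ENNReal.ofReal_le_ofReal
    apply mul_le_mul_of_nonneg_left _ hP
    apply Real.rpow_le_rpow (by linarith) _ hα.le
    have e1 := le_max_right a (p0.1 - r)
    have e2 := min_le_right b (p0.1 + r)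
    have e3 : 32 * δ / s = 2 * r := by rw [hr]; ring
    linarith

theorem Cin.XN_vol {γ : Type*} {φ : γ → ℝ → ℝ} {d : γ → γ → ℝ} {a b K : ℝ} (C : Cin φ d a b K)
    (ha : 0 ≤ a) (hb : b ≤ 1) (ℓ δ : ℝ) (hl : 0 < ℓ) (hδ : 0 < δ) (A : Set ℝ)
    (E : Set (ℝ × ℝ)) (hEA : ∀ p ∈ E, p.1 ∈ A) (P α : ℝ) (hP : 0 ≤ P) (hα : 0 < α)
    (hA : ∀ u v, u ≤ v → 0 ≤ u → v ≤ 1 → volume (A ∩ Set.Icc u v) ≤ ENNReal.ofReal (P * (v - u) ^ α))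
    (x : ℝ) (hx : a ≤ x) (hxb : x ≤ b) (f : γ) :
    (volume.restrict E) (XN (φ f) x (min (x + ℓ) b) δ) ≤ ENNReal.ofReal (2 * δ * (P * ℓ ^ α)) := by
  have e : x ≤ min (x + ℓ) b := le_min (by linarith) hxb
  refine strip_bound A (Set.Icc x (min (x + ℓ) b)) E hEA (φ f) (C.smooth f).continuous δ _
    (XN_meas _ (C.smooth f).continuous _ _ _) (fun p hp => hp) _ hδ ?_
  refine (hA _ _ e (ha.trans hx) ((min_le_right _ _).trans hb)).trans ?_
  apply ENNReal.ofReal_le_ofReal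
  apply mul_le_mul_of_nonneg_left _ hP
  apply Real.rpow_le_rpow (by linarith) _ hα.le
  have e2 := min_le_left (x + ℓ) b
  linarith


theorem cell_alg (n y1 y2 δ P F : ℝ) (hn : 0 < n) (h1 : 0 < y1) (h2 : 0 < y2) :
    2 * n ^ 2 * F * (y2 / y1 / n * (2 * δ * (P * y1 ^ 2))) + F * (1 / (2 * (y2 / y1 / n)) * (2 * δ * (P * y2 ^ 2))) =
      5 * δ * P * (y1 * y2) * (n * F) := by
  field_simp
  ring

/-- one cell -/
theorem Cin.one_cell {γ : Type*} [DecidableEq γ] {φ : γ → ℝ → ℝ} {d : γ → γ → ℝ} {a b K : ℝ}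
    (C : Cin φ d a b K) (hsymm : ∀ f g, d f g = d g f) (htri : ∀ f g h, d f h ≤ d f g + d g h)
    (ha : 0 ≤ a) (hb : b ≤ 1) (t s δ : ℝ) (ht : 0 < t) (hs : 0 < s) (hδ : 0 < δ) (A : Set ℝ)
    (E : Set (ℝ × ℝ)) (hEA : ∀ p ∈ E, p.1 ∈ A) (P α : ℝ) (hP : 0 ≤ P) (hα : 0 < α)
    (hA : ∀ u v, u ≤ v → 0 ≤ u → v ≤ 1 → volume (A ∩ Set.Icc u v) ≤ ENNReal.ofReal (P * (v - u) ^ α))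
    (x : ℝ) (hx : a ≤ x) (hxb : x ≤ b) (G : Finset γ) (hG : G.Nonempty) (f0 : γ) :
    ∃ S : ℝ × ℝ → ℝ, (Measurable S ∧ (∀ p, 0 ≤ S p) ∧ ∫⁻ p in E, ENNReal.ofReal (S p) ≤
      ENNReal.ofReal (5 * δ * P * Real.sqrt ((8 * δ / t) ^ α) *
        (Real.sqrt G.card * (G.filter (fun g => t / 4 < d f0 g)).card))) ∧
      ∀ (p : ℝ × ℝ) (M : ℝ) (U : Finset (γ × γ)),
        (∀ q ∈ U, q.1 ∈ G ∧ q.2 ∈ G ∧ p ∈ XP φ d t s δ x (min (x + s / (4 * t)) b) q) →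
        (∀ V : Finset γ, (∀ f ∈ V, |φ f p.1 - p.2| ≤ δ) → (V.card : ℝ) ≤ M) →
        (U.card : ℝ) ≤ Real.sqrt M * S p := by
  classical
  obtain ⟨y, hy⟩ : ∃ y, y = min (x + s / (4 * t)) b := ⟨_, rfl⟩
  obtain ⟨Far, hFar⟩ : ∃ Far, Far = G.filter (fun g => t / 4 < d f0 g) := ⟨_, rfl⟩
  obtain ⟨FP, hFP⟩ : ∃ FP, FP = (G ×ˢ G).filter (fun q => t / 2 < d q.1 q.2) := ⟨_, rfl⟩
  have hFPc : (FP.card : ℝ) ≤ 2 * G.card * Far.card := by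
    rw [hFP, hFar]; exact far_pairs d hsymm htri G f0 t
  obtain ⟨Y1, hY1⟩ : ∃ Y1 : ℝ, Y1 = (32 * δ / s) ^ α := ⟨_, rfl⟩
  obtain ⟨Y2, hY2⟩ : ∃ Y2 : ℝ, Y2 = (s / (4 * t)) ^ α := ⟨_, rfl⟩
  have hY1p : 0 < Y1 := by rw [hY1]; positivity
  have hY2p : 0 < Y2 := by rw [hY2]; positivity
  have hY12 : Y1 * Y2 = (8 * δ / t) ^ α := by
    rw [hY1, hY2, ← Real.mul_rpow (by positivity) (by positivity)]
    congr 1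
    field_simp; ring
  have hn : (0:ℝ) < G.card := by exact_mod_cast hG.card_pos
  obtain ⟨y1, hy1, e1⟩ : ∃ y1 : ℝ, 0 < y1 ∧ Y1 = y1 ^ 2 :=
    ⟨Real.sqrt Y1, Real.sqrt_pos.2 hY1p, (Real.sq_sqrt hY1p.le).symm⟩
  obtain ⟨y2, hy2, e2⟩ : ∃ y2 : ℝ, 0 < y2 ∧ Y2 = y2 ^ 2 :=
    ⟨Real.sqrt Y2, Real.sqrt_pos.2 hY2p, (Real.sq_sqrt hY2p.le).symm⟩
  obtain ⟨n, hnp, en⟩ : ∃ n : ℝ, 0 < n ∧ (G.card : ℝ) = n ^ 2 :=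
    ⟨Real.sqrt G.card, Real.sqrt_pos.2 hn, (Real.sq_sqrt hn.le).symm⟩
  have es : Real.sqrt ((8 * δ / t) ^ α) = y1 * y2 := by
    rw [← hY12, e1, e2, ← mul_pow, Real.sqrt_sq (by positivity)]
  have esn : Real.sqrt G.card = n := by rw [en, Real.sqrt_sq hnp.le]
  obtain ⟨l, hl⟩ : ∃ l : ℝ, l = y2 / y1 / n := ⟨_, rfl⟩
  have hlp : 0 < l := by rw [hl]; positivity
  have I1 := lint_sum_bound (volume.restrict E) FP
    (fun q => (XP φ d t s δ x y q).indicator (fun _ => l)) (fun _ => l * (2 * δ * (P * Y1)))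
    (fun i _ => by positivity)
    (fun q _ => lint_ind_bound _ _ (XP_meas φ C.smooth d _ _ _ _ _ q) _ _ hlp.le (by
      rw [hy, hY1]; exact C.XP_vol ha hb t s δ ht hs hδ A E hEA P α hP hα hA x hx q))
  have I2 := lint_sum_bound (volume.restrict E) Far
    (fun g => (XN (φ g) x y δ).indicator (fun _ => 1 / (2 * l))) (fun _ => (1 / (2 * l)) * (2 * δ * (P * Y2)))
    (fun i _ => by positivity)
    (fun q _ => lint_ind_bound _ _ (XN_meas _ (C.smooth q).continuous _ _ _) _ _ (by positivity) (by
      rw [hy, hY2]; exact C.XN_vol ha hb _ δ (by positivity) hδ A E hEA P α hP hα hA x hx hxb q))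
  refine ⟨fun p => ∑ q ∈ FP, (XP φ d t s δ x y q).indicator (fun _ => l) p +
    ∑ g ∈ Far, (XN (φ g) x y δ).indicator (fun _ => 1 / (2 * l)) p, ⟨I1.1.add I2.1,
      fun p => add_nonneg (I1.2.1 p) (I2.2.1 p), ?_⟩, ?_⟩
  · calc _ = ∫⁻ p in E, (ENNReal.ofReal (∑ q ∈ FP, (XP φ d t s δ x y q).indicator (fun _ => l) p) +
          ENNReal.ofReal (∑ g ∈ Far, (XN (φ g) x y δ).indicator (fun _ => 1 / (2 * l)) p)) := by
          congr 1; ext p; exact ENNReal.ofReal_add (I1.2.1 p) (I2.2.1 p)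
      _ = _ := lintegral_add_left I1.1.ennreal_ofReal _
      _ ≤ _ := add_le_add I1.2.2 I2.2.2
      _ = _ := by
          rw [← ENNReal.ofReal_add]
          · exact Finset.sum_nonneg (fun _ _ => by positivity)
          · exact Finset.sum_nonneg (fun _ _ => by positivity)
      _ ≤ _ := by
          apply ENNReal.ofReal_le_ofReal
          rw [Finset.sum_const, Finset.sum_const, nsmul_eq_mul, nsmul_eq_mul, es, esn, ← hFar]
          have h1 : (FP.card : ℝ) * (l * (2 * δ * (P * Y1))) ≤
              (2 * G.card * Far.card) * (l * (2 * δ * (P * Y1))) :=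
            mul_le_mul_of_nonneg_right hFPc (by positivity)
          refine (add_le_add_left h1 _).trans (le_of_eq ?_)
          rw [en, e1, e2, hl]
          exact cell_alg _ _ _ _ _ _ hnp hy1 hy2
  · intro p M U hU hM
    simp only
    rw [sum_ind FP (XP φ d t s δ x y) l p, sum_ind Far (fun g => XN (φ g) x y δ) _ p]
    have hUs : U ⊆ FP.filter (fun q => p ∈ XP φ d t s δ x y q) := by
      intro q hq
      obtain ⟨h1, h2, h3⟩ := hU q hq
      rw [Finset.mem_filter, hFP, Finset.mem_filter, Finset.mem_product, hy]
      exact ⟨⟨⟨h1, h2⟩, h3.2.2.1⟩, h3⟩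
    have hUc : (U.card : ℝ) ≤ (FP.filter (fun q => p ∈ XP φ d t s δ x y q)).card := by
      exact_mod_cast Finset.card_le_card hUs
    refine hUc.trans ?_
    have h2 : ((FP.filter (fun q => p ∈ XP φ d t s δ x y q)).card : ℝ) ≤
        2 * M * (Far.filter (fun g => p ∈ XN (φ g) x y δ)).card := by
      obtain ⟨H, hH⟩ : ∃ H, H = G.filter (fun g => p ∈ XN (φ g) x y δ) := ⟨_, rfl⟩
      have k1 : FP.filter (fun q => p ∈ XP φ d t s δ x y q) ⊆ (H ×ˢ H).filter (fun q => t / 2 < d q.1 q.2) := by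
        intro q hq
        rw [Finset.mem_filter, hFP, Finset.mem_filter, Finset.mem_product] at hq
        rw [Finset.mem_filter, Finset.mem_product, hH, Finset.mem_filter, Finset.mem_filter]
        exact ⟨⟨⟨hq.1.1.1, hq.2.1⟩, ⟨hq.1.1.2, hq.2.2.1⟩⟩, hq.1.2⟩
      have k2 := far_pairs d hsymm htri H f0 t
      have k3 : H.filter (fun g => t / 4 < d f0 g) = Far.filter (fun g => p ∈ XN (φ g) x y δ) := by
        rw [hH, hFar, Finset.filter_filter, Finset.filter_filter]
        apply Finset.filter_congr
        intro g _; exact and_comm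
      have k4 : (H.card : ℝ) ≤ M := by
        apply hM
        intro f hf
        rw [hH, Finset.mem_filter] at hf
        exact hf.2.2
      rw [k3] at k2
      calc _ ≤ (((H ×ˢ H).filter (fun q => t / 2 < d q.1 q.2)).card : ℝ) := by
            exact_mod_cast Finset.card_le_card k1
        _ ≤ _ := k2
        _ ≤ _ := mul_le_mul_of_nonneg_right (mul_le_mul_of_nonneg_left k4 two_pos.le) (Nat.cast_nonneg _)
    have hM0 : 0 ≤ M := by exact (Nat.cast_nonneg _).trans (hM ∅ (fun f hf => absurd hf (Finset.notMem_empty f)))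
    have := amgm_aux _ _ M l (Nat.cast_nonneg _) (Nat.cast_nonneg _) hM0 hlp h2
    rw [mul_comm (1 / (2 * l))]
    exact this

theorem Cin.ball_scale {γ : Type*} [Fintype γ] [DecidableEq γ] {φ : γ → ℝ → ℝ} {d : γ → γ → ℝ} {a b K : ℝ}
    (C : Cin φ d a b K) (hsymm : ∀ f g, d f g = d g f) (htri : ∀ f g h, d f h ≤ d f g + d g h)
    (ha : 0 ≤ a) (hb : b ≤ 1) (t s δ : ℝ) (ht : 0 < t) (hs : 0 < s) (hδ : 0 < δ) (A : Set ℝ)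
    (E : Set (ℝ × ℝ)) (hEA : ∀ p ∈ E, p.1 ∈ A) (P α : ℝ) (hP : 0 ≤ P) (hα : 0 < α)
    (hA : ∀ u v, u ≤ v → 0 ≤ u → v ≤ 1 → volume (A ∩ Set.Icc u v) ≤ ENNReal.ofReal (P * (v - u) ^ α))
    (hδs : δ * t ≤ s ^ 2) (L : ℕ) (hL : 1 ≤ L) (hN : Fintype.card γ ≤ 2 ^ L) (hkL : 4 * t / s ≤ 2 ^ L) :
    ∃ S : ℝ × ℝ → ℝ, (Measurable S ∧ (∀ p, 0 ≤ S p) ∧ ∫⁻ p in E, ENNReal.ofReal (S p) ≤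
      ENNReal.ofReal (5 * δ * P * Real.sqrt ((8 * δ / t) ^ α) *
        (10 ^ 8 * K * (L:ℝ) ^ 4 * (Fintype.card γ * Real.sqrt (Fintype.card γ))))) ∧
      ∀ (p : ℝ × ℝ) (M : ℝ) (U : Finset (γ × γ)), p.1 ∈ Set.Icc a b →
        (∀ q ∈ U, |φ q.1 p.1 - p.2| ≤ δ ∧ |φ q.2 p.1 - p.2| ≤ δ ∧ Cls φ d t s δ q.1 q.2 p.1) →
        (∀ V : Finset γ, (∀ f ∈ V, |φ f p.1 - p.2| ≤ δ) → (V.card : ℝ) ≤ M) →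
        (U.card : ℝ) ≤ Real.sqrt M * S p := by
  classical
  obtain ⟨ℓ, hℓ⟩ : ∃ ℓ, ℓ = s / (4 * t) := ⟨_, rfl⟩
  have hℓp : 0 < ℓ := by rw [hℓ]; positivity
  obtain ⟨cell, hcell⟩ : ∃ cell : ℕ × ℤ × ℤ → Finset γ, cell = fun x =>
    cellG φ (a + x.1 * (s / (4 * t))) (s ^ 2 / t) s x.2.1 x.2.2 := ⟨_, rfl⟩
  obtain ⟨ix, hix⟩ : ∃ ix : ℕ → γ → ℕ × ℤ × ℤ, ix = fun (k : ℕ) f =>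
    (k, ⌊φ f (a + k * (s / (4 * t))) / (s ^ 2 / t)⌋, ⌊deriv (φ f) (a + k * (s / (4 * t))) / s⌋) := ⟨_, rfl⟩
  obtain ⟨R, hR⟩ : ∃ R : Finset (ℕ × ℤ × ℤ), R = ((Finset.range (2 ^ L) ×ˢ (Finset.univ : Finset γ)).image
    (fun z => ix z.1 z.2)).filter (fun x => a + x.1 * (s / (4 * t)) ≤ b) := ⟨_, rfl⟩
  have hRm : ∀ x ∈ R, x.1 < 2 ^ L ∧ a + x.1 * (s / (4 * t)) ≤ b ∧ (cell x).Nonempty := by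
    intro x hx
    rw [hR, Finset.mem_filter, Finset.mem_image] at hx
    obtain ⟨⟨⟨k, f⟩, hz, rfl⟩, h2⟩ := hx
    rw [Finset.mem_product, Finset.mem_range] at hz
    refine ⟨by rw [hix]; exact hz.1, h2, f, ?_⟩
    rw [hcell, hix]
    simp only
    rw [mem_cellG]
    simp
  have hfstar : ∀ x : ℕ × ℤ × ℤ, ∃ f0 : Option γ, x ∈ R → ∃ f1, f0 = some f1 ∧ ∀ f ∈ cell x,
      ((cell x).filter (fun g => t / 4 < d f1 g)).card ≤ ((cell x).filter (fun g => t / 4 < d f g)).card := by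
    intro x
    by_cases hx : x ∈ R
    · obtain ⟨f1, _, h⟩ := Finset.exists_min_image (cell x)
        (fun f => ((cell x).filter (fun g => t / 4 < d f g)).card) (hRm x hx).2.2
      exact ⟨some f1, fun _ => ⟨f1, rfl, h⟩⟩
    · exact ⟨none, fun h => absurd h hx⟩
  choose fs hfs using hfstar
  have hcl : ∀ x : ℕ × ℤ × ℤ, ∃ (nf : ℕ) (S : ℝ × ℝ → ℝ), x ∈ R →
      ((∀ f ∈ cell x, nf ≤ ((cell x).filter (fun g => t / 4 < d f g)).card) ∧
       (Measurable S ∧ (∀ p, 0 ≤ S p) ∧ ∫⁻ p in E, ENNReal.ofReal (S p) ≤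
        ENNReal.ofReal (5 * δ * P * Real.sqrt ((8 * δ / t) ^ α) * (Real.sqrt (cell x).card * nf))) ∧
      ∀ (p : ℝ × ℝ) (M : ℝ) (U : Finset (γ × γ)),
        (∀ q ∈ U, q.1 ∈ cell x ∧ q.2 ∈ cell x ∧ p ∈ XP φ d t s δ (a + x.1 * (s / (4 * t)))
          (min (a + x.1 * (s / (4 * t)) + s / (4 * t)) b) q) →
        (∀ V : Finset γ, (∀ f ∈ V, |φ f p.1 - p.2| ≤ δ) → (V.card : ℝ) ≤ M) →
        (U.card : ℝ) ≤ Real.sqrt M * S p) := by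
    intro x
    by_cases hx : x ∈ R
    · obtain ⟨f1, _, h⟩ := hfs x hx
      obtain ⟨S, h1, h2⟩ := C.one_cell hsymm htri ha hb t s δ ht hs hδ A E hEA P α hP hα hA
        (a + x.1 * (s / (4 * t))) (le_add_of_nonneg_right (by positivity)) (hRm x hx).2.1 (cell x) (hRm x hx).2.2 f1
      exact ⟨_, S, fun _ => ⟨h, h1, h2⟩⟩
    · exact ⟨0, fun _ => 0, fun h => absurd h hx⟩
  choose nf S hS using hcl
  have hstar := C.star t s ht hs L hL hN R (fun x hx => (hRm x hx).1) (fun x hx => (hRm x hx).2.1) nf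
    (fun x hx f hf => by
      have := (hS x hx).1 f (by rw [hcell]; exact hf)
      rw [hcell] at this; exact this)
  have hI := lint_sum_bound (volume.restrict E) R S
    (fun x => 5 * δ * P * Real.sqrt ((8 * δ / t) ^ α) * (Real.sqrt (cell x).card * nf x))
    (fun i _ => by positivity) (fun x hx => (hS x hx).2.1)
  refine ⟨fun p => ∑ x ∈ R, S x p, ⟨hI.1, hI.2.1, hI.2.2.trans ?_⟩, ?_⟩
  · apply ENNReal.ofReal_le_ofReal
    rw [← Finset.mul_sum]
    apply mul_le_mul_of_nonneg_left _ (by positivity)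
    rw [hcell]
    exact hstar
  · intro p M U hp hU hM
    rw [Finset.mul_sum]
    obtain ⟨k, hk⟩ : ∃ k : ℕ, k = ⌊(p.1 - a) / ℓ⌋₊ := ⟨_, rfl⟩
    have hq0 : 0 ≤ (p.1 - a) / ℓ := div_nonneg (by linarith [hp.1]) hℓp.le
    have k1 : (k : ℝ) * ℓ ≤ p.1 - a := by
      rw [← le_div_iff₀ hℓp, hk]; exact Nat.floor_le hq0
    have k2 : p.1 - a ≤ k * ℓ + ℓ := by
      have := (Nat.lt_floor_add_one ((p.1 - a) / ℓ)).le
      rw [div_le_iff₀ hℓp, ← hk] at this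
      linarith
    have k3 : k < 2 ^ L := by
      have : (k : ℝ) < 2 ^ L := by
        have h1 : (k:ℝ) ≤ (p.1 - a) / ℓ := by rw [hk]; exact Nat.floor_le hq0
        have h2 : (p.1 - a) / ℓ = (p.1 - a) * (4 * t / s) := by rw [hℓ]; field_simp
        have h3 : p.1 - a ≤ 1 / 2 := by
          have h4 := C.hlen
          have h5 : 1 / (100 * K) ≤ 1 / 2 := by
            apply one_div_le_one_div_of_le (by norm_num); linarith [C.hK]
          linarith [hp.2]
        have h4 : (p.1 - a) * (4 * t / s) ≤ 1 / 2 * 2 ^ L :=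
          mul_le_mul h3 hkL (by positivity) (by norm_num)
        have : (0:ℝ) < 2 ^ L := by positivity
        linarith
      exact_mod_cast this
    have hxk : a + k * (s / (4 * t)) ≤ p.1 := by rw [← hℓ]; linarith
    have hxk2 : p.1 ≤ a + k * (s / (4 * t)) + s / (4 * t) := by rw [← hℓ]; linarith
    have hxJ : a + k * (s / (4 * t)) ∈ Set.Icc a b :=
      ⟨le_add_of_nonneg_right (by positivity), hxk.trans hp.2⟩
    have hUc : U.card ≤ ∑ x ∈ R, (U.filter (fun q => ix k q.1 = x)).card := by
      rw [← Finset.card_eq_sum_card_fiberwise]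
      intro q hq
      rw [hR, Finset.mem_coe, Finset.mem_filter, Finset.mem_image]
      refine ⟨⟨(k, q.1), by simp [k3], rfl⟩, ?_⟩
      rw [hix]; exact hxJ.2
    have hUc' : (U.card : ℝ) ≤ ∑ x ∈ R, ((U.filter (fun q => ix k q.1 = x)).card : ℝ) := by exact_mod_cast hUc
    refine hUc'.trans (Finset.sum_le_sum ?_)
    intro x hx
    apply (hS x hx).2.2 p M _ _ hM
    intro q hq
    rw [Finset.mem_filter] at hq
    obtain ⟨hqU, rfl⟩ := hq
    obtain ⟨u1, u2, u3⟩ := hU q hqU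
    have hh : |φ q.1 p.1 - φ q.2 p.1| ≤ 2 * δ := by
      rw [abs_le] at *
      constructor <;> linarith [u1.1, u1.2, u2.1, u2.2]
    have hsh := C.share q.1 q.2 t s δ p.1 (a + k * (s / (4 * t))) ht hs hδs hp hxJ
      (by rw [abs_le]; constructor <;> linarith) u3 hh
    have hmem : p.1 ∈ Set.Icc (a + k * (s / (4 * t))) (min (a + k * (s / (4 * t)) + s / (4 * t)) b) :=
      ⟨hxk, le_min hxk2 hp.2⟩
    rw [hcell, hix]
    exact ⟨hsh.1, hsh.2, ⟨hmem, u1⟩, ⟨hmem, u2⟩, u3⟩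


/-- ball of size about `t` in jet space -/
noncomputable def ballW {γ : Type*} [Fintype γ] (φ : γ → ℝ → ℝ) (x t : ℝ) (w : ℤ × ℤ × ℤ) : Finset γ :=
  Finset.univ.filter (fun f => |⌊φ f x / t⌋ - w.1| ≤ 3 ∧ |⌊deriv (φ f) x / t⌋ - w.2.1| ≤ 3 ∧
    |⌊deriv (deriv (φ f)) x / t⌋ - w.2.2| ≤ 3)

theorem mem_ballW {γ : Type*} [Fintype γ] (φ : γ → ℝ → ℝ) (x t : ℝ) (w : ℤ × ℤ × ℤ) (f : γ) :
    f ∈ ballW φ x t w ↔ |⌊φ f x / t⌋ - w.1| ≤ 3 ∧ |⌊deriv (φ f) x / t⌋ - w.2.1| ≤ 3 ∧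
    |⌊deriv (deriv (φ f)) x / t⌋ - w.2.2| ≤ 3 := by
  simp [ballW]

theorem ballW_mult {γ : Type*} [Fintype γ] [DecidableEq γ] (φ : γ → ℝ → ℝ) (x t : ℝ) (W : Finset (ℤ × ℤ × ℤ)) :
    ∑ w ∈ W, ((ballW φ x t w).card : ℝ) ≤ 343 * Fintype.card γ := by
  classical
  have h1 : ∀ w : ℤ × ℤ × ℤ, ((ballW φ x t w).card : ℝ) =
      ∑ f : γ, if f ∈ ballW φ x t w then (1:ℝ) else 0 := by
    intro x; simp
  simp_rw [h1]
  rw [Finset.sum_comm]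
  have h2 : ∀ f : γ, ∑ w ∈ W, (if f ∈ ballW φ x t w then (1:ℝ) else 0) ≤ 343 := by
    intro f
    rw [Finset.sum_boole]
    have : (W.filter (fun w => f ∈ ballW φ x t w)).card ≤
        (Finset.Icc (-3:ℤ) 3 ×ˢ Finset.Icc (-3:ℤ) 3 ×ˢ Finset.Icc (-3:ℤ) 3).card := by
      refine Finset.card_le_card_of_injOn (fun w => (⌊φ f x / t⌋ - w.1,
        ⌊deriv (φ f) x / t⌋ - w.2.1, ⌊deriv (deriv (φ f)) x / t⌋ - w.2.2)) ?_ ?_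
      · intro x hx
        have hx := Finset.mem_filter.1 (Finset.mem_coe.1 hx)
        have h3 := (mem_ballW _ _ _ _ _).1 hx.2
        rw [abs_le, abs_le, abs_le] at h3
        simp only [Finset.coe_product, Set.mem_prod, Finset.mem_coe, Finset.mem_Icc]
        exact ⟨⟨by omega, by omega⟩, ⟨by omega, by omega⟩, ⟨by omega, by omega⟩⟩
      · intro x _ y _ hxy
        simp only [Prod.mk.injEq] at hxy
        obtain ⟨e1, e2, e3⟩ := hxy
        exact Prod.ext (by omega) (Prod.ext (by omega) (by omega))
    rw [Finset.card_product, Finset.card_product, Int.card_Icc] at this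
    norm_num at this
    exact_mod_cast this
  calc _ ≤ ∑ f : γ, (343:ℝ) := Finset.sum_le_sum (fun f _ => h2 f)
    _ = _ := by rw [Finset.sum_const, nsmul_eq_mul, Finset.card_univ]; ring

theorem Cin.sub {γ : Type*} {φ : γ → ℝ → ℝ} {d : γ → γ → ℝ} {a b K : ℝ} (C : Cin φ d a b K) (B : Finset γ) :
    Cin (fun f : {f // f ∈ B} => φ f.1) (fun f g => d f.1 g.1) a b K :=
  ⟨fun f => C.smooth f.1, C.hK, C.hab, C.hlen, fun f g => C.jet_le f.1 g.1, fun f g => C.le_jet f.1 g.1⟩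

theorem Cin.ball_diam {γ : Type*} [Fintype γ] {φ : γ → ℝ → ℝ} {d : γ → γ → ℝ} {a b K : ℝ} (C : Cin φ d a b K)
    (t : ℝ) (ht : 0 < t) (w : ℤ × ℤ × ℤ) (f g : γ) (hf : f ∈ ballW φ a t w) (hg : g ∈ ballW φ a t w) :
    d f g ≤ 21 * K * t := by
  rw [mem_ballW] at hf hg
  have h1 := floor_close _ _ t ht _ hf.1 hg.1
  have h2 := floor_close _ _ t ht _ hf.2.1 hg.2.1
  have h3 := floor_close _ _ t ht _ hf.2.2 hg.2.2
  have h4 := C.le_jet f g a ⟨le_refl _, C.hab⟩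
  have hK : 0 < K := by linarith [C.hK]
  calc _ ≤ _ := h4
    _ ≤ K * (7 * t + 7 * t + 7 * t) := by gcongr
    _ = _ := by ring

theorem Cin.scale {γ : Type*} [Fintype γ] [DecidableEq γ] {φ : γ → ℝ → ℝ} {d : γ → γ → ℝ} {a b K : ℝ}
    (C : Cin φ d a b K) (hsymm : ∀ f g, d f g = d g f) (htri : ∀ f g h, d f h ≤ d f g + d g h)
    (ha : 0 ≤ a) (hb : b ≤ 1) (t s δ : ℝ) (ht : 0 < t) (hs : 0 < s) (hδ : 0 < δ) (A : Set ℝ)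
    (E : Set (ℝ × ℝ)) (hEA : ∀ p ∈ E, p.1 ∈ A) (P α : ℝ) (hP : 0 ≤ P) (hα : 0 < α)
    (hA : ∀ u v, u ≤ v → 0 ≤ u → v ≤ 1 → volume (A ∩ Set.Icc u v) ≤ ENNReal.ofReal (P * (v - u) ^ α))
    (hδs : δ * t ≤ s ^ 2) (L : ℕ) (hL : 1 ≤ L) (hN : Fintype.card γ ≤ 2 ^ L) (hkL : 4 * t / s ≤ 2 ^ L)
    (hδt : δ ≤ t) (M0 ζ : ℝ)
    (hFr : ∀ f, ∀ r, δ ≤ r → ((Finset.univ.filter (fun g => d g f ≤ r)).card : ℝ) ≤ M0 * (r / δ) ^ ζ) :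
    ∃ S : ℝ × ℝ → ℝ, (Measurable S ∧ (∀ p, 0 ≤ S p) ∧ ∫⁻ p in E, ENNReal.ofReal (S p) ≤
      ENNReal.ofReal (5 * δ * P * Real.sqrt ((8 * δ / t) ^ α) *
        (10 ^ 8 * K * (L:ℝ) ^ 4 * (343 * Fintype.card γ * Real.sqrt (M0 * (21 * K * t / δ) ^ ζ))))) ∧
      ∀ (p : ℝ × ℝ) (M : ℝ) (U : Finset (γ × γ)), p.1 ∈ Set.Icc a b →
        (∀ q ∈ U, |φ q.1 p.1 - p.2| ≤ δ ∧ |φ q.2 p.1 - p.2| ≤ δ ∧ Cls φ d t s δ q.1 q.2 p.1) →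
        (∀ V : Finset γ, (∀ f ∈ V, |φ f p.1 - p.2| ≤ δ) → (V.card : ℝ) ≤ M) →
        (U.card : ℝ) ≤ Real.sqrt M * S p := by
  classical
  have hKp : 0 < K := by linarith [C.hK]
  obtain ⟨ix, hix⟩ : ∃ ix : γ → ℤ × ℤ × ℤ, ix = fun f => (⌊φ f a / t⌋, ⌊deriv (φ f) a / t⌋,
    ⌊deriv (deriv (φ f)) a / t⌋) := ⟨_, rfl⟩
  obtain ⟨W, hW⟩ : ∃ W : Finset (ℤ × ℤ × ℤ), W = Finset.univ.image ix := ⟨_, rfl⟩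
  have hmain := fun w : ℤ × ℤ × ℤ => (C.sub (ballW φ a t w)).ball_scale (fun f g => hsymm f.1 g.1)
    (fun f g h => htri f.1 g.1 h.1) ha hb t s δ ht hs hδ A E hEA P α hP hα hA hδs L hL
    (by rw [Fintype.card_coe]; exact (Finset.card_le_univ _).trans hN) hkL
  choose S hS1 hS2 using hmain
  have hI := lint_sum_bound (volume.restrict E) W S _ (fun i _ => by positivity) (fun w _ => hS1 w)
  refine ⟨fun p => ∑ w ∈ W, S w p, ⟨hI.1, hI.2.1, hI.2.2.trans ?_⟩, ?_⟩
  · apply ENNReal.ofReal_le_ofReal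
    simp only [Fintype.card_coe]
    rw [← Finset.mul_sum]
    apply mul_le_mul_of_nonneg_left _ (by positivity)
    rw [← Finset.mul_sum]
    apply mul_le_mul_of_nonneg_left _ (by positivity)
    have hNw : ∀ w ∈ W, ((ballW φ a t w).card : ℝ) ≤ M0 * (21 * K * t / δ) ^ ζ := by
      intro w hw
      rw [hW, Finset.mem_image] at hw
      obtain ⟨f, _, rfl⟩ := hw
      have hf : f ∈ ballW φ a t (ix f) := by rw [mem_ballW, hix]; simp
      refine le_trans ?_ (hFr f (21 * K * t) ?_)
      · have : ballW φ a t (ix f) ⊆ Finset.univ.filter (fun g => d g f ≤ 21 * K * t) := by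
          intro g hg
          rw [Finset.mem_filter]
          exact ⟨Finset.mem_univ _, C.ball_diam t ht _ g f hg hf⟩
        exact_mod_cast Finset.card_le_card this
      · nlinarith [C.hK]
    calc ∑ w ∈ W, ((ballW φ a t w).card : ℝ) * Real.sqrt (ballW φ a t w).card ≤
          ∑ w ∈ W, ((ballW φ a t w).card : ℝ) * Real.sqrt (M0 * (21 * K * t / δ) ^ ζ) :=
          Finset.sum_le_sum (fun w hw => mul_le_mul_of_nonneg_left (Real.sqrt_le_sqrt (hNw w hw))
            (Nat.cast_nonneg _))
      _ = (∑ w ∈ W, ((ballW φ a t w).card : ℝ)) * Real.sqrt (M0 * (21 * K * t / δ) ^ ζ) := by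
          rw [Finset.sum_mul]
      _ ≤ _ := mul_le_mul_of_nonneg_right (ballW_mult φ a t W) (Real.sqrt_nonneg _)
  · intro p M U hp hU hM
    rw [Finset.mul_sum]
    have hUc : U.card ≤ ∑ w ∈ W, (U.filter (fun q => ix q.1 = w)).card := by
      rw [← Finset.card_eq_sum_card_fiberwise]
      intro q hq
      rw [hW, Finset.mem_coe, Finset.mem_image]
      exact ⟨q.1, Finset.mem_univ _, rfl⟩
    have hUc' : (U.card : ℝ) ≤ ∑ w ∈ W, ((U.filter (fun q => ix q.1 = w)).card : ℝ) := by exact_mod_cast hUc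
    refine hUc'.trans (Finset.sum_le_sum ?_)
    intro w hw
    obtain ⟨U', hU'⟩ : ∃ U' : Finset ({f // f ∈ ballW φ a t w} × {f // f ∈ ballW φ a t w}),
      U' = Finset.univ.filter (fun q => (q.1.1, q.2.1) ∈ U) := ⟨_, rfl⟩
    have hsub : U.filter (fun q => ix q.1 = w) ⊆ U'.image (fun q => (q.1.1, q.2.1)) := by
      rintro ⟨f, g⟩ hq
      rw [Finset.mem_filter] at hq
      obtain ⟨hq1, hq2⟩ := hq
      simp only at hq2
      have hc := (hU _ hq1).2.2
      have hj := C.jet_le f g a ⟨le_refl _, C.hab⟩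
      have hd : d f g ≤ t := hc.2.1
      have n1 := abs_nonneg (φ f a - φ g a)
      have n2 := abs_nonneg (deriv (φ f) a - deriv (φ g) a)
      have n3 := abs_nonneg (deriv (deriv (φ f)) a - deriv (deriv (φ g)) a)
      have hf : f ∈ ballW φ a t w := by rw [mem_ballW, ← hq2, hix]; simp
      have hg : g ∈ ballW φ a t w := by
        rw [mem_ballW, ← hq2, hix]
        refine ⟨floor_diff _ _ _ ht ?_, floor_diff _ _ _ ht ?_, floor_diff _ _ _ ht ?_⟩ <;>
        · rw [abs_sub_comm]; linarith
      rw [Finset.mem_image]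
      exact ⟨(⟨f, hf⟩, ⟨g, hg⟩), by rw [hU', Finset.mem_filter]; exact ⟨Finset.mem_univ _, hq1⟩, rfl⟩
    have hc1 : ((U.filter (fun q => ix q.1 = w)).card : ℝ) ≤ U'.card := by
      exact_mod_cast (Finset.card_le_card hsub).trans Finset.card_image_le
    refine hc1.trans (hS2 w p M U' hp ?_ ?_)
    · intro q hq
      rw [hU', Finset.mem_filter] at hq
      exact hU _ hq.2
    · intro V hV
      have := hM (V.map (Function.Embedding.subtype _)) (by
        intro f hf
        rw [Finset.mem_map] at hf
        obtain ⟨f', hf', rfl⟩ := hf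
        exact hV f' hf')
      rwa [Finset.card_map] at this


theorem unif_alg (K M0 δ t α ζ : ℝ) (hK : 1 ≤ K) (hM0 : 1 ≤ M0) (hδ : 0 < δ) (hδ1 : δ ≤ 1) (hδt : δ ≤ t) (ht : t ≤ 2 * K)
    (hα : 0 < α) (hαζ : α ≤ ζ) (hζ : ζ ≤ 1) :
    Real.sqrt ((8 * δ / t) ^ α) * Real.sqrt (M0 * (21 * K * t / δ) ^ ζ) ≤ 19 * K * M0 * (1 / δ) ^ ((ζ - α) / 2) := by
  have htp : 0 < t := by linarith
  have hKp : 0 < K := by linarith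
  have hM0p : 0 < M0 := by linarith
  rw [← Real.sqrt_mul (by positivity)]
  apply Real.sqrt_le_iff.2
  refine ⟨by positivity, ?_⟩
  have e1 : (8 * δ / t) ^ α ≤ 8 * (t / δ) ^ (-α) := by
    have : 8 * δ / t = 8 * (t / δ)⁻¹ := by field_simp
    rw [this, Real.mul_rpow (by norm_num) (by positivity), Real.inv_rpow (by positivity), ← Real.rpow_neg (by positivity)]
    apply mul_le_mul_of_nonneg_right _ (by positivity)
    calc (8:ℝ) ^ α ≤ 8 ^ (1:ℝ) := Real.rpow_le_rpow_of_exponent_le (by norm_num) (by linarith)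
      _ = 8 := by norm_num
  have e2 : (21 * K * t / δ) ^ ζ ≤ 21 * K * (t / δ) ^ ζ := by
    have : 21 * K * t / δ = (21 * K) * (t / δ) := by ring
    rw [this, Real.mul_rpow (by positivity) (by positivity)]
    apply mul_le_mul_of_nonneg_right _ (by positivity)
    calc (21 * K) ^ ζ ≤ (21 * K) ^ (1:ℝ) := Real.rpow_le_rpow_of_exponent_le (by linarith) hζ
      _ = 21 * K := by rw [Real.rpow_one]
  have e3 : (t / δ) ^ (-α) * (t / δ) ^ ζ ≤ 2 * K * (1 / δ) ^ (ζ - α) := by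
    rw [← Real.rpow_add (by positivity)]
    calc (t / δ) ^ (-α + ζ) ≤ (2 * K * (1 / δ)) ^ (-α + ζ) := by
          apply Real.rpow_le_rpow (by positivity) _ (by linarith)
          rw [mul_one_div]; gcongr
      _ = (2 * K) ^ (-α + ζ) * (1 / δ) ^ (-α + ζ) := Real.mul_rpow (by positivity) (by positivity)
      _ ≤ (2 * K) ^ (1:ℝ) * (1 / δ) ^ (-α + ζ) := by
          apply mul_le_mul_of_nonneg_right _ (by positivity)
          exact Real.rpow_le_rpow_of_exponent_le (by linarith) (by linarith)
      _ = _ := by rw [Real.rpow_one, show -α + ζ = ζ - α by ring]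
  have e4 : ((1 / δ) ^ ((ζ - α) / 2)) ^ 2 = (1 / δ) ^ (ζ - α) := by
    rw [← Real.rpow_natCast, ← Real.rpow_mul (by positivity)]
    congr 1; push_cast; ring
  calc (8 * δ / t) ^ α * (M0 * (21 * K * t / δ) ^ ζ) ≤ (8 * (t / δ) ^ (-α)) * (M0 * (21 * K * (t / δ) ^ ζ)) := by
        gcongr
    _ = 168 * K * M0 * ((t / δ) ^ (-α) * (t / δ) ^ ζ) := by ring
    _ ≤ 168 * K * M0 * (2 * K * (1 / δ) ^ (ζ - α)) := by gcongr
    _ = 336 * K ^ 2 * (1 / δ) ^ (ζ - α) * M0 := by ring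
    _ ≤ 361 * K ^ 2 * (1 / δ) ^ (ζ - α) * M0 ^ 2 := by
        have : M0 ≤ M0 ^ 2 := by nlinarith
        have h : (0:ℝ) ≤ K ^ 2 * (1 / δ) ^ (ζ - α) := by positivity
        nlinarith [mul_le_mul_of_nonneg_left this h, mul_nonneg h (sq_nonneg M0)]
    _ = (19 * K * M0 * (1 / δ) ^ ((ζ - α) / 2)) ^ 2 := by rw [mul_pow, e4]; ring

theorem pow32_aux (m M0 S : ℝ) (hm : m = 0 ∨ 1 ≤ m) (hM0 : 0 ≤ M0) (hS : 0 ≤ S)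
    (h : m ^ 2 ≤ M0 * m + Real.sqrt m * S) : m ^ ((3:ℝ) / 2) ≤ M0 * m + S := by
  rcases hm with rfl | hm
  · rw [Real.zero_rpow (by norm_num)]; simpa using hS
  · have hm0 : 0 ≤ m := by linarith
    obtain ⟨x, hx, rfl⟩ : ∃ x : ℝ, 1 ≤ x ∧ m = x ^ 2 := ⟨Real.sqrt m, Real.one_le_sqrt.2 hm, (Real.sq_sqrt hm0).symm⟩
    have hx0 : 0 < x := by linarith
    rw [Real.sqrt_sq hx0.le] at h
    have e : (x ^ 2) ^ ((3:ℝ) / 2) = x ^ 3 := by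
      rw [← Real.rpow_natCast x 2, ← Real.rpow_mul hx0.le, ← Real.rpow_natCast x 3]
      congr 1; norm_num
    rw [e]
    have h1 : x * x ^ 3 ≤ x * (M0 * x + S) := by nlinarith
    have h2 := le_of_mul_le_mul_left h1 hx0
    have : M0 * x ≤ M0 * x ^ 2 := by apply mul_le_mul_of_nonneg_left _ hM0; nlinarith
    linarith

theorem find_scale (y c : ℝ) (L : ℕ) (h : y ≤ 2 ^ L * c) :
    ∃ j ≤ L, y ≤ 2 ^ j * c ∧ (j = 0 ∨ (2 ^ j * c) / 2 < y) := by
  classical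
  have hex : ∃ j : ℕ, y ≤ 2 ^ j * c := ⟨L, h⟩
  refine ⟨Nat.find hex, Nat.find_min' hex h, Nat.find_spec hex, ?_⟩
  rcases Nat.eq_zero_or_pos (Nat.find hex) with h0 | h0
  · left; exact h0
  · right
    have := Nat.find_min hex (Nat.sub_lt h0 one_pos)
    push Not at this
    obtain ⟨k, hk⟩ := Nat.exists_eq_succ_of_ne_zero h0.ne'
    rw [hk] at this ⊢
    simp only [Nat.succ_eq_add_one, Nat.add_sub_cancel] at this
    rw [Nat.succ_eq_add_one, pow_succ]
    linarith

theorem Cin.loc {γ : Type*} [Fintype γ] [DecidableEq γ] {φ : γ → ℝ → ℝ} {d : γ → γ → ℝ} {a b K : ℝ}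
    (C : Cin φ d a b K) (hsymm : ∀ f g, d f g = d g f) (htri : ∀ f g h, d f h ≤ d f g + d g h)
    (hdK : ∀ f g, d f g ≤ K)
    (ha : 0 ≤ a) (hb : b ≤ 1) (δ : ℝ) (hδ : 0 < δ) (hδ1 : δ ≤ 1) (A : Set ℝ)
    (E : Set (ℝ × ℝ)) (hEA : ∀ p ∈ E, p.1 ∈ A) (P α : ℝ) (hP : 0 ≤ P) (hα : 0 < α)
    (hA : ∀ u v, u ≤ v → 0 ≤ u → v ≤ 1 → volume (A ∩ Set.Icc u v) ≤ ENNReal.ofReal (P * (v - u) ^ α))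
    (L : ℕ) (hL : 1 ≤ L) (hN : Fintype.card γ ≤ 2 ^ L) (hLK : 8 * K ≤ 2 ^ L * δ)
    (M0 ζ : ℝ) (hM0 : 1 ≤ M0) (hαζ : α ≤ ζ) (hζ : ζ ≤ 1)
    (hFr : ∀ f, ∀ r, δ ≤ r → ((Finset.univ.filter (fun g => d g f ≤ r)).card : ℝ) ≤ M0 * (r / δ) ^ ζ) :
    ∫⁻ p in E, (∑ f : γ, (XN (φ f) a b δ).indicator (fun _ => (1:ℝ≥0∞)) p) ^ ((3:ℝ) / 2) ≤
      ENNReal.ofReal (10 ^ 14 * K ^ 2 * (L:ℝ) ^ 6 * M0 * (δ * P) * (1 / δ) ^ ((ζ - α) / 2) * Fintype.card γ) := by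
  classical
  have hKp : 0 < K := by linarith [C.hK]
  have hL0 : (1:ℝ) ≤ L := by exact_mod_cast hL
  obtain ⟨T, hT⟩ : ∃ T : ℕ → ℝ, T = fun j => 2 ^ j * δ := ⟨_, rfl⟩
  obtain ⟨Sg, hSg⟩ : ∃ Sg : ℕ → ℕ → ℝ, Sg = fun j i => 2 ^ i * Real.sqrt (δ * T j) := ⟨_, rfl⟩
  have hTp : ∀ j, δ ≤ T j := by
    intro j; rw [hT]
    have : (1:ℝ) ≤ 2 ^ j := one_le_pow₀ (by norm_num)
    simp only; nlinarith
  have hsq : ∀ j, δ ≤ Real.sqrt (δ * T j) := by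
    intro j
    apply Real.le_sqrt_of_sq_le
    have := hTp j; nlinarith
  have hsq2 : ∀ j, Real.sqrt (δ * T j) ^ 2 = δ * T j := by
    intro j
    exact Real.sq_sqrt (mul_nonneg hδ.le (hδ.le.trans (hTp j)))
  have hS1 : ∀ j i, Real.sqrt (δ * T j) ≤ Sg j i := by
    intro j i; rw [hSg]
    have : (1:ℝ) ≤ 2 ^ i := one_le_pow₀ (by norm_num)
    have := hsq j
    simp only; nlinarith
  obtain ⟨I, hI⟩ : ∃ I : Finset (ℕ × ℕ), I = (Finset.range (L + 1) ×ˢ Finset.range (L + 1)).filter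
    (fun x => T x.1 ≤ 2 * K) := ⟨_, rfl⟩
  obtain ⟨Z, hZ⟩ : ∃ Z : ℝ, Z = 5 * δ * P * (10 ^ 8 * K * (L:ℝ) ^ 4 * (343 * Fintype.card γ *
    (19 * K * M0 * (1 / δ) ^ ((ζ - α) / 2)))) := ⟨_, rfl⟩
  have hZ0 : 0 ≤ Z := by rw [hZ]; positivity
  have hex : ∀ x : ℕ × ℕ, ∃ S : ℝ × ℝ → ℝ, x ∈ I → (Measurable S ∧ (∀ p, 0 ≤ S p) ∧
      ∫⁻ p in E, ENNReal.ofReal (S p) ≤ ENNReal.ofReal Z) ∧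
      ∀ (p : ℝ × ℝ) (M : ℝ) (U : Finset (γ × γ)), p.1 ∈ Set.Icc a b →
        (∀ q ∈ U, |φ q.1 p.1 - p.2| ≤ δ ∧ |φ q.2 p.1 - p.2| ≤ δ ∧ Cls φ d (T x.1) (Sg x.1 x.2) δ q.1 q.2 p.1) →
        (∀ V : Finset γ, (∀ f ∈ V, |φ f p.1 - p.2| ≤ δ) → (V.card : ℝ) ≤ M) →
        (U.card : ℝ) ≤ Real.sqrt M * S p := by
    intro x
    by_cases hx : x ∈ I
    swap
    · exact ⟨fun _ => 0, fun h => absurd h hx⟩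
    rw [hI, Finset.mem_filter] at hx
    have ht2 := hx.2
    have htp : 0 < T x.1 := hδ.trans_le (hTp _)
    have hsp : δ ≤ Sg x.1 x.2 := (hsq _).trans (hS1 _ _)
    have hsp0 : 0 < Sg x.1 x.2 := hδ.trans_le hsp
    obtain ⟨S, ⟨h1, h2, h3⟩, h4⟩ := C.scale hsymm htri ha hb (T x.1) (Sg x.1 x.2) δ htp hsp0 hδ A E hEA P α hP hα hA
      (by rw [← hsq2]; exact pow_le_pow_left₀ (Real.sqrt_nonneg _) (hS1 _ _) 2) L hL hN
      (by
        rw [div_le_iff₀ hsp0]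
        have h1 : (2:ℝ) ^ L * δ ≤ 2 ^ L * Sg x.1 x.2 := mul_le_mul_of_nonneg_left hsp (by positivity)
        linarith) (hTp _) M0 ζ hFr
    refine ⟨S, fun _ => ⟨⟨h1, h2, h3.trans (ENNReal.ofReal_le_ofReal ?_)⟩, h4⟩⟩
    have hu := unif_alg K M0 δ (T x.1) α ζ C.hK hM0 hδ hδ1 (hTp _) ht2 hα hαζ hζ
    have hc : (0:ℝ) ≤ 5 * δ * P * (10 ^ 8 * K * (L:ℝ) ^ 4 * (343 * Fintype.card γ)) := by positivity
    rw [hZ]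
    have := mul_le_mul_of_nonneg_left hu hc
    linarith
  choose S hS using hex
  have hJ1 := lint_sum_bound (volume.restrict E) I S (fun _ => Z) (fun _ _ => hZ0) (fun x hx => (hS x hx).1)
  have hbm : min (a + 1) b = b := min_eq_right (by linarith)
  have hJ2 := lint_sum_bound (volume.restrict E) Finset.univ
    (fun f => (XN (φ f) a b δ).indicator (fun _ => M0)) (fun _ => M0 * (2 * δ * (P * 1)))
    (fun i _ => by positivity)
    (fun f _ => lint_ind_bound _ _ (XN_meas _ (C.smooth f).continuous _ _ _) _ _ (by positivity) (by
      have := C.XN_vol ha hb 1 δ one_pos hδ A E hEA P α hP hα hA a le_rfl C.hab f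
      rwa [hbm, Real.one_rpow] at this))
  have hpt : ∀ p : ℝ × ℝ, (∑ f : γ, (XN (φ f) a b δ).indicator (fun _ => (1:ℝ≥0∞)) p) ^ ((3:ℝ) / 2) ≤
      ENNReal.ofReal (∑ f : γ, (XN (φ f) a b δ).indicator (fun _ => M0) p + ∑ x ∈ I, S x p) := by
    intro p
    obtain ⟨V0, hV0⟩ : ∃ V0 : Finset γ, V0 = Finset.univ.filter (fun f => p ∈ XN (φ f) a b δ) := ⟨_, rfl⟩
    have e1 : ∑ f : γ, (XN (φ f) a b δ).indicator (fun _ => (1:ℝ≥0∞)) p = ENNReal.ofReal (V0.card : ℝ) := by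
      rw [hV0, Finset.card_filter, ENNReal.ofReal_natCast]
      push_cast
      apply Finset.sum_congr rfl
      intro f _
      by_cases h : p ∈ XN (φ f) a b δ <;> simp [h]
    rw [e1, ENNReal.ofReal_rpow_of_nonneg (Nat.cast_nonneg _) (by norm_num)]
    apply ENNReal.ofReal_le_ofReal
    rw [sum_ind Finset.univ (fun f => XN (φ f) a b δ) M0 p, ← hV0]
    apply pow32_aux _ _ _ _ (by linarith) (hJ1.2.1 p)
    · by_cases hpJ : p.1 ∈ Set.Icc a b
      swap
      · have : V0 = ∅ := by
          rw [hV0, Finset.filter_eq_empty_iff]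
          intro f _ hf
          exact hpJ hf.1
        rw [this]; simp
      obtain ⟨Dg, hDg⟩ : ∃ Dg, Dg = (V0 ×ˢ V0).filter (fun q => d q.1 q.2 ≤ δ) := ⟨_, rfl⟩
      obtain ⟨U, hU⟩ : ∃ U : ℕ × ℕ → Finset (γ × γ), U = fun x => (V0 ×ˢ V0).filter
        (fun q => Cls φ d (T x.1) (Sg x.1 x.2) δ q.1 q.2 p.1) := ⟨_, rfl⟩
      have hcov : V0 ×ˢ V0 ⊆ Dg ∪ I.biUnion U := by
        rintro ⟨f, g⟩ hq
        rw [Finset.mem_union]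
        by_cases hd : d f g ≤ δ
        · left; rw [hDg, Finset.mem_filter]; exact ⟨hq, hd⟩
        · right
          push Not at hd
          have hL2 : K ≤ 2 ^ L * δ := by linarith
          obtain ⟨j, hjL, hj1, hj2⟩ := find_scale (d f g) δ L ((hdK f g).trans hL2)
          have hj3 : T j / 2 < d f g := by
            rcases hj2 with rfl | h
            · exfalso; simp at hj1; linarith
            · rw [hT]; exact h
          have hj4 : d f g ≤ T j := by rw [hT]; exact hj1
          have ht2 : T j ≤ 2 * K := by linarith [hdK f g]
          have hder : |deriv (φ f) p.1 - deriv (φ g) p.1| ≤ T j := by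
            have := C.jet_le f g p.1 hpJ
            have := abs_nonneg (φ f p.1 - φ g p.1)
            have := abs_nonneg (deriv (deriv (φ f)) p.1 - deriv (deriv (φ g)) p.1)
            linarith
          obtain ⟨i, hiL, hi1, hi2⟩ := find_scale (|deriv (φ f) p.1 - deriv (φ g) p.1|) (Real.sqrt (δ * T j)) L (by
            have h1 : (2:ℝ) ^ L * δ ≤ 2 ^ L * Real.sqrt (δ * T j) := mul_le_mul_of_nonneg_left (hsq j) (by positivity)
            linarith)
          rw [Finset.mem_biUnion]
          refine ⟨(j, i), ?_, ?_⟩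
          · rw [hI, Finset.mem_filter, Finset.mem_product, Finset.mem_range, Finset.mem_range]
            exact ⟨⟨by simp only; omega, by simp only; omega⟩, ht2⟩
          · rw [hU, Finset.mem_filter]
            refine ⟨hq, hj3, hj4, by rw [hSg]; exact hi1, ?_⟩
            rcases hi2 with rfl | h
            · right
              rw [hSg]; simp only [pow_zero, one_mul]
              rw [hsq2]
            · left; rw [hSg]; exact h
      have hc1 : V0.card * V0.card ≤ Dg.card + ∑ x ∈ I, (U x).card := by
        rw [← Finset.card_product]
        refine (Finset.card_le_card hcov).trans ((Finset.card_union_le _ _).trans ?_)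
        exact Nat.add_le_add_left Finset.card_biUnion_le _
      have hc2 : (V0.card : ℝ) * V0.card ≤ Dg.card + ∑ x ∈ I, ((U x).card : ℝ) := by exact_mod_cast hc1
      have hc3 : (Dg.card : ℝ) ≤ M0 * V0.card := by
        have h1 : Dg.card ≤ ∑ g ∈ V0, (Dg.filter (fun q => q.2 = g)).card := by
          rw [← Finset.card_eq_sum_card_fiberwise]
          intro q hq
          rw [Finset.mem_coe, hDg, Finset.mem_filter, Finset.mem_product] at hq
          exact hq.1.2
        have h2 : (Dg.card : ℝ) ≤ ∑ g ∈ V0, ((Dg.filter (fun q => q.2 = g)).card : ℝ) := by exact_mod_cast h1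
        have h3 : ∀ g ∈ V0, ((Dg.filter (fun q => q.2 = g)).card : ℝ) ≤ M0 := by
          intro g _
          have h4 := hFr g δ le_rfl
          rw [div_self hδ.ne', Real.one_rpow, mul_one] at h4
          refine le_trans ?_ h4
          have : (Dg.filter (fun q => q.2 = g)).card ≤ (Finset.univ.filter (fun h => d h g ≤ δ)).card := by
            apply Finset.card_le_card_of_injOn (fun q => q.1)
            · rintro ⟨f, g'⟩ hq
              rw [Finset.mem_coe, Finset.mem_filter, hDg, Finset.mem_filter] at hq
              obtain ⟨⟨_, h5⟩, h6⟩ := hq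
              simp only at h5 h6
              rw [Finset.mem_coe, Finset.mem_filter, ← h6]
              exact ⟨Finset.mem_univ _, h5⟩
            · intro q hq q' hq' h
              rw [Finset.mem_coe, Finset.mem_filter] at hq hq'
              exact Prod.ext h (hq.2.trans hq'.2.symm)
          exact_mod_cast this
        calc _ ≤ _ := h2
          _ ≤ ∑ g ∈ V0, M0 := Finset.sum_le_sum h3
          _ = _ := by rw [Finset.sum_const, nsmul_eq_mul]; ring
      have hc4 : ∀ x ∈ I, ((U x).card : ℝ) ≤ Real.sqrt V0.card * S x p := by
        intro x hx
        apply (hS x hx).2 p _ _ hpJ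
        · intro q hq
          rw [hU, Finset.mem_filter, Finset.mem_product, hV0, Finset.mem_filter, Finset.mem_filter] at hq
          exact ⟨hq.1.1.2.2, hq.1.2.2.2, hq.2⟩
        · intro V hV
          have : V ⊆ V0 := by
            intro f hf
            rw [hV0, Finset.mem_filter]
            exact ⟨Finset.mem_univ _, hpJ, hV f hf⟩
          exact_mod_cast Finset.card_le_card this
      have hc5 := Finset.sum_le_sum hc4
      rw [Finset.mul_sum]
      nlinarith
    · rcases Nat.eq_zero_or_pos V0.card with h | h
      · left; exact_mod_cast h
      · right; exact_mod_cast h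
  calc _ ≤ ∫⁻ p in E, ENNReal.ofReal (∑ f : γ, (XN (φ f) a b δ).indicator (fun _ => M0) p + ∑ x ∈ I, S x p) :=
        lintegral_mono hpt
    _ = ∫⁻ p in E, (ENNReal.ofReal (∑ f : γ, (XN (φ f) a b δ).indicator (fun _ => M0) p) +
          ENNReal.ofReal (∑ x ∈ I, S x p)) := by
          congr 1; ext p; exact ENNReal.ofReal_add (hJ2.2.1 p) (hJ1.2.1 p)
    _ = _ := lintegral_add_left hJ2.1.ennreal_ofReal _
    _ ≤ _ := add_le_add hJ2.2.2 hJ1.2.2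
    _ = _ := by
        rw [← ENNReal.ofReal_add]
        · exact Finset.sum_nonneg (fun _ _ => by positivity)
        · exact Finset.sum_nonneg (fun _ _ => hZ0)
    _ ≤ _ := by
        apply ENNReal.ofReal_le_ofReal
        rw [Finset.sum_const, Finset.sum_const, nsmul_eq_mul, nsmul_eq_mul, Finset.card_univ]
        have hIc : (I.card : ℝ) ≤ 4 * (L:ℝ) ^ 2 := by
          have : I.card ≤ (L + 1) * (L + 1) := by
            rw [hI]
            refine (Finset.card_filter_le _ _).trans ?_
            rw [Finset.card_product, Finset.card_range]
          have : (I.card : ℝ) ≤ (L + 1) * (L + 1) := by exact_mod_cast this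
          nlinarith
        have hD : 1 ≤ (1 / δ) ^ ((ζ - α) / 2) :=
          Real.one_le_rpow (by rw [le_div_iff₀ hδ]; linarith) (by linarith)
        obtain ⟨D, hDD⟩ : ∃ D : ℝ, D = (1 / δ) ^ ((ζ - α) / 2) := ⟨_, rfl⟩
        rw [← hDD] at hD hZ ⊢
        have h1 : (I.card : ℝ) * Z ≤ 4 * (L:ℝ) ^ 2 * Z := mul_le_mul_of_nonneg_right hIc hZ0
        have hB : 0 ≤ M0 * (δ * P) * Fintype.card γ := by positivity
        have h2 : (1:ℝ) ≤ K ^ 2 * (L:ℝ) ^ 6 * D := by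
          have a1 : 1 ≤ K ^ 2 := one_le_pow₀ C.hK
          have a2 : 1 ≤ (L:ℝ) ^ 6 := one_le_pow₀ hL0
          calc (1:ℝ) = 1 * 1 * 1 := by norm_num
            _ ≤ _ := by gcongr
        have h3 := mul_le_mul_of_nonneg_left h2 hB
        have hW : 0 ≤ (M0 * (δ * P) * Fintype.card γ) * (K ^ 2 * (L:ℝ) ^ 6 * D) :=
          mul_nonneg hB (by linarith)
        calc _ ≤ (Fintype.card γ : ℝ) * (M0 * (2 * δ * (P * 1))) + 4 * (L:ℝ) ^ 2 * Z := by linarith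
          _ = 2 * (M0 * (δ * P) * Fintype.card γ * 1) + 13034000000000 *
              ((M0 * (δ * P) * Fintype.card γ) * (K ^ 2 * (L:ℝ) ^ 6 * D)) := by rw [hZ]; ring
          _ ≤ 10 ^ 14 * ((M0 * (δ * P) * Fintype.card γ) * (K ^ 2 * (L:ℝ) ^ 6 * D)) := by linarith
          _ = _ := by ring


theorem exists_L (ε K : ℝ) (hε : 0 < ε) (hK : 1 ≤ K) : ∃ δ₀ : ℝ, 0 < δ₀ ∧ δ₀ ≤ 1 ∧ ∀ δ, 0 < δ → δ ≤ δ₀ →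
    ∃ L : ℕ, 1 ≤ L ∧ 8 * K * δ ^ (-(1 + ε)) ≤ 2 ^ L ∧ 10 ^ 17 * K ^ 3 * (L:ℝ) ^ 6 ≤ δ ^ (-ε) := by
  have hKp : 0 < K := by linarith
  have hl2 : 0 < Real.log 2 := Real.log_pos (by norm_num)
  have hl8 : 0 ≤ Real.log (8 * K) := Real.log_nonneg (by linarith)
  obtain ⟨C1, hC1⟩ : ∃ C1 : ℝ, C1 = 2 + Real.log (8 * K) / Real.log 2 + (1 + ε) / Real.log 2 * (12 / ε) := ⟨_, rfl⟩
  have hq1 : 0 ≤ Real.log (8 * K) / Real.log 2 := by positivity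
  have hq2 : 0 ≤ (1 + ε) / Real.log 2 * (12 / ε) := by positivity
  have hC1p : 1 ≤ C1 := by rw [hC1]; linarith
  obtain ⟨B, hB⟩ : ∃ B : ℝ, B = 10 ^ 17 * K ^ 3 * C1 ^ 6 := ⟨_, rfl⟩
  have hB1 : 1 ≤ B := by
    rw [hB]
    have a1 : 1 ≤ K ^ 3 := one_le_pow₀ hK
    have a2 : 1 ≤ C1 ^ 6 := one_le_pow₀ hC1p
    calc (1:ℝ) = 1 * 1 * 1 := by norm_num
      _ ≤ _ := by gcongr; norm_num
  have hB0 : 0 < B := by linarith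
  refine ⟨B ^ (-(2 / ε)), by positivity, Real.rpow_le_one_of_one_le_of_nonpos hB1 (by
    have : 0 < 2 / ε := by positivity
    linarith), ?_⟩
  intro δ hδ hδ0
  have hδ1 : δ ≤ 1 := hδ0.trans (Real.rpow_le_one_of_one_le_of_nonpos hB1 (by
    have : 0 < 2 / ε := by positivity
    linarith))
  obtain ⟨x, hx⟩ : ∃ x : ℝ, x = δ⁻¹ := ⟨_, rfl⟩
  have hx1 : 1 ≤ x := by rw [hx]; exact (one_le_inv₀ hδ).2 hδ1
  have hx0 : 0 < x := by linarith
  have hxB : B ≤ x ^ (ε / 2) := by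
    have h := Real.rpow_le_rpow_of_nonpos hδ hδ0 (by linarith : -(ε / 2) ≤ 0)
    rw [← Real.rpow_mul hB0.le] at h
    have e : -(2 / ε) * -(ε / 2) = 1 := by field_simp
    rw [e, Real.rpow_one] at h
    rw [hx, Real.inv_rpow hδ.le, ← Real.rpow_neg hδ.le]
    exact h
  have e1 : δ ^ (-(1 + ε)) = x ^ (1 + ε) := by
    rw [hx, Real.inv_rpow hδ.le, ← Real.rpow_neg hδ.le]
  have e2 : δ ^ (-ε) = x ^ ε := by
    rw [hx, Real.inv_rpow hδ.le, ← Real.rpow_neg hδ.le]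
  rw [e1, e2]
  obtain ⟨Y, hY⟩ : ∃ Y : ℝ, Y = 8 * K * x ^ (1 + ε) := ⟨_, rfl⟩
  have hYp : 0 < Y := by rw [hY]; positivity
  have hlY : Real.log Y = Real.log (8 * K) + (1 + ε) * Real.log x := by
    rw [hY, Real.log_mul (by positivity) (by positivity), Real.log_rpow hx0]
  refine ⟨⌈Real.log Y / Real.log 2⌉₊ + 1, by omega, ?_, ?_⟩
  · rw [← hY]
    have h1 := Nat.le_ceil (Real.log Y / Real.log 2)
    rw [div_le_iff₀ hl2] at h1
    have h2 : Real.log Y ≤ Real.log (2 ^ (⌈Real.log Y / Real.log 2⌉₊ + 1)) := by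
      rw [Real.log_pow]; push_cast; nlinarith
    exact (Real.log_le_log_iff hYp (by positivity)).1 h2
  · have hlx : 0 ≤ Real.log x := Real.log_nonneg hx1
    have hYn : 0 ≤ Real.log Y / Real.log 2 := by
      rw [hlY]; positivity
    have h1 := (Nat.ceil_lt_add_one hYn).le
    have h2 : Real.log x ≤ x ^ (ε / 12) * (12 / ε) := by
      have := Real.log_le_rpow_div hx0.le (by positivity : 0 < ε / 12)
      refine this.trans (le_of_eq ?_)
      field_simp
    have h3 : (1:ℝ) ≤ x ^ (ε / 12) := Real.one_le_rpow hx1 (by positivity)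
    have h4 : ((⌈Real.log Y / Real.log 2⌉₊ + 1 : ℕ) : ℝ) ≤ C1 * x ^ (ε / 12) := by
      push_cast
      have h5 : Real.log Y / Real.log 2 ≤ Real.log (8 * K) / Real.log 2 +
          (1 + ε) / Real.log 2 * (12 / ε) * x ^ (ε / 12) := by
        rw [hlY, add_div]
        have : (1 + ε) * Real.log x / Real.log 2 = (1 + ε) / Real.log 2 * Real.log x := by ring
        rw [this]
        have h6 := mul_le_mul_of_nonneg_left h2 (by positivity : 0 ≤ (1 + ε) / Real.log 2)
        linarith
      have h6 := mul_le_mul_of_nonneg_left h3 (by linarith : 0 ≤ 2 + Real.log (8 * K) / Real.log 2)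
      rw [hC1]
      linarith
    have h5 : ((⌈Real.log Y / Real.log 2⌉₊ + 1 : ℕ) : ℝ) ^ 6 ≤ (C1 * x ^ (ε / 12)) ^ 6 :=
      pow_le_pow_left₀ (Nat.cast_nonneg _) h4 6
    have h6 : (x ^ (ε / 12)) ^ 6 = x ^ (ε / 2) := by
      rw [← Real.rpow_natCast, ← Real.rpow_mul hx0.le]
      congr 1; push_cast; ring
    calc 10 ^ 17 * K ^ 3 * ((⌈Real.log Y / Real.log 2⌉₊ + 1 : ℕ) : ℝ) ^ 6 ≤
          10 ^ 17 * K ^ 3 * (C1 * x ^ (ε / 12)) ^ 6 := mul_le_mul_of_nonneg_left h5 (by positivity)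
      _ = B * x ^ (ε / 2) := by rw [mul_pow, h6, hB]; ring
      _ ≤ x ^ (ε / 2) * x ^ (ε / 2) := mul_le_mul_of_nonneg_right hxB (by positivity)
      _ = x ^ ε := by rw [← Real.rpow_add hx0]; congr 1; ring

theorem c2_jet_le (a b : ℝ) (f g : ℝ → ℝ) (hf : ContDiff ℝ 2 f) (hg : ContDiff ℝ 2 g) (θ : ℝ)
    (hθ : θ ∈ Set.Icc a b) :
    |f θ - g θ| + |deriv f θ - deriv g θ| + |deriv (deriv f) θ - deriv (deriv g) θ| ≤ c2dist (Set.Icc a b) f g := by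
  obtain ⟨f0, f1, f2⟩ := smooth_facts _ hf
  obtain ⟨g0, g1, g2⟩ := smooth_facts _ hg
  have c1 : Continuous (deriv f) := continuous_iff_continuousAt.2 (fun x => (f1 x).continuousAt)
  have c2 : Continuous (deriv g) := continuous_iff_continuousAt.2 (fun x => (g1 x).continuousAt)
  have c3 := hf.continuous
  have c4 := hg.continuous
  have hc : Continuous (fun θ => |f θ - g θ| + |deriv f θ - deriv g θ| +
      |deriv (deriv f) θ - deriv (deriv g) θ|) := by fun_prop
  exact le_csSup (isCompact_Icc.bddAbove_image hc.continuousOn) ⟨θ, hθ, rfl⟩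

theorem c2_symm (J : Set ℝ) (f g : ℝ → ℝ) : c2dist J f g = c2dist J g f := by
  unfold c2dist
  congr 2
  funext θ
  rw [abs_sub_comm (f θ), abs_sub_comm (deriv f θ), abs_sub_comm (deriv (deriv f) θ)]

theorem c2_tri (a b : ℝ) (hab : a ≤ b) (f g h : ℝ → ℝ) (hf : ContDiff ℝ 2 f) (hg : ContDiff ℝ 2 g)
    (hh : ContDiff ℝ 2 h) :
    c2dist (Set.Icc a b) f h ≤ c2dist (Set.Icc a b) f g + c2dist (Set.Icc a b) g h := by
  apply csSup_le ((Set.nonempty_Icc.2 hab).image _)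
  rintro _ ⟨θ, hθ, rfl⟩
  have h1 := c2_jet_le a b f g hf hg θ hθ
  have h2 := c2_jet_le a b g h hg hh θ hθ
  have h3 := abs_sub_le (f θ) (g θ) (h θ)
  have h4 := abs_sub_le (deriv f θ) (deriv g θ) (deriv h θ)
  have h5 := abs_sub_le (deriv (deriv f) θ) (deriv (deriv g) θ) (deriv (deriv h) θ)
  simp only
  linarith

/-- **Theorem 1.6** of Pramanik–Yang–Zahl: sharp `L^{3/2}` bound for a variant
of Wolff's circular maximal function over quasi-products, for families of
cinematic functions. -/
theorem wolff_maximal_cinematic (D : ℝ) (hD : 1 ≤ D) :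
    ∃ C : ℝ, 0 < C ∧
    ∀ ε K : ℝ, 0 < ε → 1 ≤ K →
    ∃ δ₀ : ℝ, 0 < δ₀ ∧
    ∀ α ζ δ : ℝ, 0 < α → α ≤ ζ → ζ ≤ 1 → 0 < δ → δ ≤ δ₀ →
    ∀ a b : ℝ, a ≤ b →
    ∀ 𝓕 : Set (ℝ → ℝ), CinematicFamily (Set.Icc a b) K 𝓕 →
      DoublingFamily (Set.Icc a b) D 𝓕 →
    ∀ E : Set (ℝ × ℝ), IsQuasiProduct δ α α (δ ^ (-ε)) E →
    ∀ F : Finset (ℝ → ℝ), ↑F ⊆ 𝓕 →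
      (∀ g : ℝ → ℝ, ContDiff ℝ 2 g → ∀ r : ℝ, δ ≤ r →
        (({f ∈ (F : Set (ℝ → ℝ)) | c2dist (Set.Icc a b) f g ≤ r}).ncard : ℝ)
          ≤ δ ^ (-ε) * (r / δ) ^ ζ) →
      ∫⁻ p in E,
          (∑ f ∈ F, (vtube (Set.Icc a b) f δ).indicator (fun _ => (1 : ℝ≥0∞)) p)
            ^ ((3 : ℝ)/2)
        ≤ ENNReal.ofReal (δ ^ (2 - α/2 - ζ/2 - C * ε) * F.card) := by
  classical
  refine ⟨3, by norm_num, ?_⟩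
  intro ε K hε hK
  obtain ⟨δ₀, hδ₀, hδ₀1, hLex⟩ := exists_L ε K hε hK
  refine ⟨δ₀, hδ₀, ?_⟩
  intro α ζ δ hα hαζ hζ hδ hδδ a b hab 𝓕 hcin _ E hE F hF hFr
  obtain ⟨L, hL, hL2, hL6⟩ := hLex δ hδ hδδ
  have hδ1 : δ ≤ 1 := hδδ.trans hδ₀1
  have hKp : 0 < K := by linarith
  obtain ⟨hEm, A, B, hA, _, hEeq⟩ := hE
  have hEA : ∀ p ∈ E, p.1 ∈ A := by intro p hp; rw [hEeq] at hp; exact hp.1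
  obtain ⟨hsm, hdK, hcj⟩ := hcin
  obtain ⟨M0, hM0⟩ : ∃ M0 : ℝ, M0 = δ ^ (-ε) := ⟨_, rfl⟩
  obtain ⟨P, hP⟩ : ∃ P : ℝ, P = δ ^ (-ε) * δ ^ (1 - α) := ⟨_, rfl⟩
  have hM01 : 1 ≤ M0 := by
    rw [hM0]; exact Real.one_le_rpow_of_pos_of_le_one_of_nonpos hδ hδ1 (by linarith)
  have hP0 : 0 ≤ P := by rw [hP]; positivity
  have hsmF : ∀ f : {f // f ∈ F}, ContDiff ℝ 2 f.1 := fun f => hsm _ (hF f.2)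
  have hFrγ : ∀ f : {f // f ∈ F}, ∀ r, δ ≤ r →
      ((Finset.univ.filter (fun g : {f // f ∈ F} => c2dist (Set.Icc a b) g.1 f.1 ≤ r)).card : ℝ) ≤ M0 * (r / δ) ^ ζ := by
    intro f r hr
    rw [hM0]
    refine le_trans ?_ (hFr f.1 (hsmF f) r hr)
    have e : {h ∈ (F : Set (ℝ → ℝ)) | c2dist (Set.Icc a b) h f.1 ≤ r} =
        ((F.filter (fun h => c2dist (Set.Icc a b) h f.1 ≤ r) : Finset (ℝ → ℝ)) : Set (ℝ → ℝ)) := by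
      ext h; simp
    rw [e, Set.ncard_coe_finset]
    have : (Finset.univ.filter (fun g : {f // f ∈ F} => c2dist (Set.Icc a b) g.1 f.1 ≤ r)).card ≤
        (F.filter (fun h => c2dist (Set.Icc a b) h f.1 ≤ r)).card := by
      apply Finset.card_le_card_of_injOn (fun g => g.1)
      · intro g hg
        rw [Finset.mem_coe, Finset.mem_filter] at hg
        rw [Finset.mem_coe, Finset.mem_filter]
        exact ⟨g.2, hg.2⟩
      · exact Subtype.val_injective.injOn
    exact_mod_cast this
  have hx1 : 1 ≤ δ ^ (-ε) := by rw [← hM0]; exact hM01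
  have hsplit : δ ^ (-(1 + ε)) = δ⁻¹ * δ ^ (-ε) := by
    rw [neg_add, Real.rpow_add hδ, Real.rpow_neg_one]
  have hNL : Fintype.card {f // f ∈ F} ≤ 2 ^ L := by
    rcases isEmpty_or_nonempty {f // f ∈ F} with h | ⟨⟨f⟩⟩
    · rw [Fintype.card_eq_zero]; exact Nat.zero_le _
    · have h1 := hFrγ f K (hδ1.trans hK)
      have h2 : Finset.univ.filter (fun g : {f // f ∈ F} => c2dist (Set.Icc a b) g.1 f.1 ≤ K) = Finset.univ := by
        rw [Finset.filter_eq_self]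
        intro g _
        exact hdK _ (hF g.2) _ (hF f.2)
      rw [h2, Finset.card_univ] at h1
      have h3 : (K / δ) ^ ζ ≤ K / δ := by
        have h4 : 1 ≤ K / δ := by rw [le_div_iff₀ hδ]; linarith
        calc (K / δ) ^ ζ ≤ (K / δ) ^ (1:ℝ) := Real.rpow_le_rpow_of_exponent_le h4 hζ
          _ = _ := Real.rpow_one _
      have h5 : (Fintype.card {f // f ∈ F} : ℝ) ≤ 2 ^ L := by
        calc _ ≤ _ := h1
          _ ≤ M0 * (K / δ) := mul_le_mul_of_nonneg_left h3 (by linarith)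
          _ = K * (δ⁻¹ * δ ^ (-ε)) := by rw [hM0]; field_simp
          _ ≤ 8 * K * (δ⁻¹ * δ ^ (-ε)) := by
              have : 0 ≤ K * (δ⁻¹ * δ ^ (-ε)) := by positivity
              linarith
          _ ≤ _ := by rw [← hsplit]; exact hL2
      exact_mod_cast h5
  have hLK : 8 * K ≤ 2 ^ L * δ := by
    rw [hsplit] at hL2
    have h1 : 8 * K * δ⁻¹ * 1 ≤ 8 * K * δ⁻¹ * δ ^ (-ε) := mul_le_mul_of_nonneg_left hx1 (by positivity)
    have h2 : 8 * K / δ ≤ 2 ^ L := by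
      rw [div_eq_mul_inv]; linarith
    rwa [div_le_iff₀ hδ] at h2
  obtain ⟨n, hn⟩ : ∃ n : ℕ, n = ⌈100 * K⌉₊ := ⟨_, rfl⟩
  have hn1 : 100 * K ≤ n := by rw [hn]; exact Nat.le_ceil _
  have hn2 : (n:ℝ) ≤ 100 * K + 1 := by rw [hn]; exact (Nat.ceil_lt_add_one (by positivity)).le
  have hn0 : (0:ℝ) < n := by linarith
  obtain ⟨aa, haa⟩ : ∃ aa : ℕ → ℝ, aa = fun (i : ℕ) => max a ((i:ℝ) / n) := ⟨_, rfl⟩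
  obtain ⟨bb, hbb⟩ : ∃ bb : ℕ → ℝ, bb = fun (i : ℕ) => min b (min 1 (((i:ℝ) + 1) / n)) := ⟨_, rfl⟩
  obtain ⟨Z, hZ⟩ : ∃ Z : ℝ, Z = 10 ^ 14 * K ^ 2 * (L:ℝ) ^ 6 * M0 * (δ * P) * (1 / δ) ^ ((ζ - α) / 2) *
    Fintype.card {f // f ∈ F} := ⟨_, rfl⟩
  have hZ0 : 0 ≤ Z := by rw [hZ]; positivity
  have hpiece : ∀ i : ℕ, ∫⁻ p in E, (∑ f : {f // f ∈ F}, (XN f.1 (aa i) (bb i) δ).indicator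
      (fun _ => (1:ℝ≥0∞)) p) ^ ((3:ℝ) / 2) ≤ ENNReal.ofReal Z := by
    intro i
    by_cases hi : aa i ≤ bb i
    · have hi1 : a ≤ aa i := by rw [haa]; exact le_max_left _ _
      have hi2 : bb i ≤ b := by rw [hbb]; exact min_le_left _ _
      have hi3 : 0 ≤ aa i := by rw [haa]; exact le_trans (by positivity) (le_max_right _ _)
      have hi4 : bb i ≤ 1 := by rw [hbb]; exact (min_le_right _ _).trans (min_le_left _ _)
      have hi5 : bb i - aa i ≤ 1 / (100 * K) := by
        have h1 : bb i ≤ (i + 1) / n := by rw [hbb]; exact (min_le_right _ _).trans (min_le_right _ _)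
        have h2 : (i:ℝ) / n ≤ aa i := by rw [haa]; exact le_max_right _ _
        have h3 : 1 / (n:ℝ) ≤ 1 / (100 * K) := one_div_le_one_div_of_le (by positivity) hn1
        rw [add_div] at h1
        linarith
      have hCin : Cin (fun f : {f // f ∈ F} => f.1) (fun f g => c2dist (Set.Icc a b) f.1 g.1) (aa i) (bb i) K := by
        refine ⟨hsmF, hK, hi, hi5, ?_, ?_⟩
        · intro f g θ hθ
          exact c2_jet_le a b f.1 g.1 (hsmF f) (hsmF g) θ ⟨hi1.trans hθ.1, hθ.2.trans hi2⟩
        · intro f g θ hθ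
          have h := hcj f.1 (hF f.2) g.1 (hF g.2) θ ⟨hi1.trans hθ.1, hθ.2.trans hi2⟩
          rwa [inv_mul_le_iff₀ hKp] at h
      rw [hZ]
      exact hCin.loc (fun f g => c2_symm _ _ _) (fun f g h => c2_tri a b hab _ _ _ (hsmF f) (hsmF g) (hsmF h))
        (fun f g => hdK _ (hF f.2) _ (hF g.2)) hi3 hi4 δ hδ hδ1 A E hEA P α hP0 hα
        (fun u v huv hu hv => by
          rw [hP]; exact hA.2.2 u v huv (Set.Icc_subset_Icc hu hv)) L hL hNL hLK M0 ζ hM01 hαζ hζ hFrγ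
    · have : ∀ p : ℝ × ℝ, (∑ f : {f // f ∈ F}, (XN f.1 (aa i) (bb i) δ).indicator
          (fun _ => (1:ℝ≥0∞)) p) ^ ((3:ℝ) / 2) = 0 := by
        intro p
        rw [Finset.sum_eq_zero, ENNReal.zero_rpow_of_pos (by norm_num)]
        intro f _
        apply Set.indicator_of_notMem
        intro hp
        exact hi (hp.1.1.trans hp.1.2)
      simp_rw [this]
      simp
  have hpt : ∀ p ∈ E, (∑ f ∈ F, (vtube (Set.Icc a b) f δ).indicator (fun _ => (1 : ℝ≥0∞)) p) ^ ((3 : ℝ)/2) ≤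
      ∑ i ∈ Finset.range (n + 1), (∑ f : {f // f ∈ F}, (XN f.1 (aa i) (bb i) δ).indicator
        (fun _ => (1:ℝ≥0∞)) p) ^ ((3:ℝ) / 2) := by
    intro p hp
    by_cases hpJ : p.1 ∈ Set.Icc a b
    · have hp01 := hA.1 (hEA p hp)
      obtain ⟨i, hi⟩ : ∃ i : ℕ, i = ⌊n * p.1⌋₊ := ⟨_, rfl⟩
      have hnp : 0 ≤ n * p.1 := mul_nonneg hn0.le hp01.1
      have hi1 : (i:ℝ) ≤ n * p.1 := by rw [hi]; exact Nat.floor_le hnp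
      have hi2 : n * p.1 ≤ i + 1 := by rw [hi]; exact (Nat.lt_floor_add_one _).le
      have hi3 : i ≤ n := by
        have : (i:ℝ) ≤ n := by nlinarith [hp01.2]
        exact_mod_cast this
      have hmem : p.1 ∈ Set.Icc (aa i) (bb i) := by
        rw [haa, hbb]
        refine ⟨max_le hpJ.1 ?_, le_min hpJ.2 (le_min hp01.2 ?_)⟩
        · rw [div_le_iff₀ hn0]; linarith
        · rw [le_div_iff₀ hn0]; linarith
      have hmi : i ∈ Finset.range (n + 1) := Finset.mem_range.2 (by omega)
      refine le_trans (le_of_eq ?_) (Finset.single_le_sum (f := fun i => (∑ f : {f // f ∈ F},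
        (XN f.1 (aa i) (bb i) δ).indicator (fun _ => (1:ℝ≥0∞)) p) ^ ((3:ℝ) / 2)) (fun _ _ => zero_le) hmi)
      congr 1
      rw [← Finset.sum_coe_sort]
      apply Finset.sum_congr rfl
      intro f _
      have : p ∈ vtube (Set.Icc a b) f.1 δ ↔ p ∈ XN f.1 (aa i) (bb i) δ :=
        ⟨fun h => ⟨hmem, h.2⟩, fun h => ⟨hpJ, h.2⟩⟩
      by_cases h : p ∈ XN f.1 (aa i) (bb i) δ
      · rw [Set.indicator_of_mem h, Set.indicator_of_mem (this.2 h)]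
      · rw [Set.indicator_of_notMem h, Set.indicator_of_notMem (fun h' => h (this.1 h'))]
    · rw [Finset.sum_eq_zero, ENNReal.zero_rpow_of_pos (by norm_num)]
      · exact zero_le
      · intro f _
        apply Set.indicator_of_notMem
        intro h
        exact hpJ h.1
  calc _ ≤ ∫⁻ p in E, ∑ i ∈ Finset.range (n + 1), (∑ f : {f // f ∈ F}, (XN f.1 (aa i) (bb i) δ).indicator
        (fun _ => (1:ℝ≥0∞)) p) ^ ((3:ℝ) / 2) := setLIntegral_mono' hEm hpt
    _ = ∑ i ∈ Finset.range (n + 1), ∫⁻ p in E, (∑ f : {f // f ∈ F}, (XN f.1 (aa i) (bb i) δ).indicator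
        (fun _ => (1:ℝ≥0∞)) p) ^ ((3:ℝ) / 2) := by
        apply lintegral_finsetSum
        intro i _
        apply Measurable.pow_const
        apply Finset.measurable_sum
        intro f _
        exact measurable_const.indicator (XN_meas _ (hsmF f).continuous _ _ _)
    _ ≤ ∑ i ∈ Finset.range (n + 1), ENNReal.ofReal Z := Finset.sum_le_sum (fun i _ => hpiece i)
    _ = ENNReal.ofReal (∑ i ∈ Finset.range (n + 1), Z) := (ENNReal.ofReal_sum_of_nonneg (fun _ _ => hZ0)).symm
    _ ≤ _ := by
        apply ENNReal.ofReal_le_ofReal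
        rw [Finset.sum_const, nsmul_eq_mul, Finset.card_range]
        push_cast
        have hcard : Fintype.card {f // f ∈ F} = F.card := Fintype.card_coe F
        have hD : (1 / δ) ^ ((ζ - α) / 2) = δ ^ (-((ζ - α) / 2)) := by
          rw [one_div, Real.inv_rpow hδ.le, Real.rpow_neg hδ.le]
        have hexp : δ ^ (2 - α / 2 - ζ / 2 - 3 * ε) =
            δ ^ (-ε) * (M0 * (δ * P) * (1 / δ) ^ ((ζ - α) / 2)) := by
          rw [hM0, hP, hD]
          have h1 : δ * (δ ^ (-ε) * δ ^ (1 - α)) = δ ^ (1 + (-ε + (1 - α))) := by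
            rw [Real.rpow_add hδ, Real.rpow_add hδ, Real.rpow_one]
          rw [h1, ← Real.rpow_add hδ, ← Real.rpow_add hδ, ← Real.rpow_add hδ]
          congr 1; ring
        rw [hexp, hZ, hcard]
        obtain ⟨X, hX⟩ : ∃ X : ℝ, X = M0 * (δ * P) * (1 / δ) ^ ((ζ - α) / 2) := ⟨_, rfl⟩
        have hX0 : 0 ≤ X := by rw [hX]; positivity
        rw [← hX]
        have h1 : (n:ℝ) + 1 ≤ 1000 * K := by linarith
        calc ((n:ℝ) + 1) * (10 ^ 14 * K ^ 2 * (L:ℝ) ^ 6 * M0 * (δ * P) * (1 / δ) ^ ((ζ - α) / 2) * F.card) =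
              (n + 1) * (10 ^ 14 * K ^ 2 * (L:ℝ) ^ 6 * X * F.card) := by rw [hX]; ring
          _ ≤ (1000 * K) * (10 ^ 14 * K ^ 2 * (L:ℝ) ^ 6 * X * F.card) :=
              mul_le_mul_of_nonneg_right h1 (by positivity)
          _ = (10 ^ 17 * K ^ 3 * (L:ℝ) ^ 6) * (X * F.card) := by ring
          _ ≤ δ ^ (-ε) * (X * F.card) := mul_le_mul_of_nonneg_right hL6 (by positivity)
          _ = _ := by ring
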